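/- Let X be a Stein space and u ∈ PSH(X). Then for every real number c, the set Y := {x ∈ X : u(x) < c} is Runge in X (i.e. for every compact K ⊆ Y, the set K̂_X ∩ Y is compact, where K̂_X := {x ∈ X : |f(x)| ≤ ‖f‖_K for all f ∈ 𝒪(X)}); in particular Y is a Stein space. -/

import Mathlib

/-!
Common framework: plurisubharmonic functions, (reduced) complex spaces modeled by
charts onto analytic subvarieties of open subsets of finite-dimensional complex
normed spaces, relative extremal functions, pluripolarity, Stein spaces,
Monge–Ampère operators, and crosses in products of complex spaces.
-/

open Set Filter Topology Metric

noncomputable section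

/-- `ℂⁿ`, modeled as functions `Fin n → ℂ`. -/
abbrev Cn (n : ℕ) : Type := Fin n → ℂ

/-- A real-valued function is harmonic on a subset of `ℂ` if it is locally
the real part of a holomorphic function. -/
def HarmonicOnCC (h : ℂ → ℝ) (Ω : Set ℂ) : Prop :=
  ∀ z ∈ Ω, ∃ W : Set ℂ, IsOpen W ∧ z ∈ W ∧ W ⊆ Ω ∧
    ∃ f : ℂ → ℂ, DifferentiableOn ℂ f W ∧ ∀ w ∈ W, h w = (f w).re

/-- Subharmonicity for `[-∞,∞)`-valued functions (modeled as `EReal`-valued, with value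
`⊤` excluded in applications): upper semicontinuity together with domination on closed
discs by harmonic comparison functions. -/
def SubharmonicOnCC (u : ℂ → EReal) (Ω : Set ℂ) : Prop :=
  UpperSemicontinuousOn u Ω ∧
  ∀ (a : ℂ) (r : ℝ), 0 < r → closedBall a r ⊆ Ω →
    ∀ h : ℂ → ℝ, ContinuousOn h (closedBall a r) → HarmonicOnCC h (ball a r) →
      (∀ z ∈ sphere a r, u z ≤ (h z : EReal)) →
      ∀ z ∈ closedBall a r, u z ≤ (h z : EReal)

section NormedE

variable {E : Type*} [NormedAddCommGroup E] [NormedSpace ℂ E]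

/-- Plurisubharmonicity on an open subset `Ω` of a complex normed space: the function is
`< ⊤`, upper semicontinuous, not identically `-∞` on any nonempty open subset (equivalently,
on no irreducible = connected component of `Ω`), and subharmonic along every complex line. -/
def PSHOnE (u : E → EReal) (Ω : Set E) : Prop :=
  (∀ z ∈ Ω, u z < ⊤) ∧ UpperSemicontinuousOn u Ω ∧
  (¬ ∃ U : Set E, U ⊆ Ω ∧ IsOpen U ∧ U.Nonempty ∧ ∀ z ∈ U, u z = ⊥) ∧
  ∀ a b : E, SubharmonicOnCC (fun w : ℂ => u (a + w • b)) {w : ℂ | a + w • b ∈ Ω}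

/-- Strong (strict) plurisubharmonicity of a real-valued function: locally, subtracting a
small multiple of `‖z‖²` preserves plurisubharmonicity. -/
def StronglyPSHOnE (u : E → ℝ) (Ω : Set E) : Prop :=
  ∀ x ∈ Ω, ∃ ε : ℝ, 0 < ε ∧ ∃ U : Set E, IsOpen U ∧ x ∈ U ∧ U ⊆ Ω ∧
    PSHOnE (fun z => ((u z - ε * ‖z‖ ^ 2 : ℝ) : EReal)) U

/-- An analytic subvariety `B` of an open set `V`: locally the common zero locus of
finitely many holomorphic functions. -/
def IsSubvariety (B V : Set E) : Prop :=
  IsOpen V ∧ B ⊆ V ∧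
  ∀ z ∈ V, ∃ W : Set E, IsOpen W ∧ z ∈ W ∧ W ⊆ V ∧
    ∃ (m : ℕ) (F : Fin m → E → ℂ), (∀ i, DifferentiableOn ℂ (F i) W) ∧
      B ∩ W = {w ∈ W | ∀ i, F i w = 0}

end NormedE

/-- A chart `(U, φ, B, V)` of a complex space `X`: a homeomorphism `φ` of an open set
`U ⊆ X` onto an analytic subvariety `B` of an open subset `V` of a finite-dimensional
complex normed space. -/
structure CChart (X : Type*) [TopologicalSpace X] where
  E : Type
  [nacg : NormedAddCommGroup E]
  [nsp : NormedSpace ℂ E]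
  [fd : FiniteDimensional ℂ E]
  U : Set X
  V : Set E
  B : Set E
  φ : X → E
  openU : IsOpen U
  subvariety : IsSubvariety B V
  mapsToB : ∀ x ∈ U, φ x ∈ B
  injOn : Set.InjOn φ U
  image_eq : φ '' U = B
  contOn : ContinuousOn φ U
  open_image : ∀ W : Set X, W ⊆ U → IsOpen W → ∃ V'' : Set E, IsOpen V'' ∧ φ '' W = B ∩ V''

attribute [instance] CChart.nacg CChart.nsp CChart.fd

/-- Holomorphic compatibility of two charts: the transition map extends to a holomorphic
map of ambient open sets near every point of the overlap. -/
def ChartCompat {X : Type*} [TopologicalSpace X] (c d : CChart X) : Prop :=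
  ∀ x ∈ c.U ∩ d.U, ∃ W : Set c.E, IsOpen W ∧ c.φ x ∈ W ∧
    ∃ F : c.E → d.E, DifferentiableOn ℂ F W ∧
      ∀ y ∈ c.U ∩ d.U, c.φ y ∈ W → F (c.φ y) = d.φ y

/-- A (reduced) complex space structure on a topological space `X`: an atlas of pairwise
holomorphically compatible charts onto analytic subvarieties covering `X`. -/
structure CSpace (X : Type*) [TopologicalSpace X] where
  atlas : Set (CChart X)
  chart_cover : ∀ x : X, ∃ c ∈ atlas, x ∈ c.U
  compat : ∀ c ∈ atlas, ∀ d ∈ atlas, ChartCompat c d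

section Space

variable {X : Type*} [TopologicalSpace X]

/-- A function `f` is holomorphic on an open subset `D` of the complex space: near every
point it is, in some chart, the restriction of an ambient holomorphic function. -/
def SpaceHolOn (S : CSpace X) (f : X → ℂ) (D : Set X) : Prop :=
  ∀ x ∈ D, ∃ c ∈ S.atlas, x ∈ c.U ∧ ∃ V' : Set c.E, IsOpen V' ∧ V' ⊆ c.V ∧ c.φ x ∈ V' ∧
    {y ∈ c.U | c.φ y ∈ V'} ⊆ D ∧
    ∃ F : c.E → ℂ, DifferentiableOn ℂ F V' ∧ ∀ y ∈ c.U, c.φ y ∈ V' → F (c.φ y) = f y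

/-- A holomorphic map from a subset of `ℂ` into a complex space: continuous, and
holomorphic when read in any chart. -/
def HolMapTo (S : CSpace X) (f : ℂ → X) (Ω : Set ℂ) : Prop :=
  ContinuousOn f Ω ∧
  ∀ c ∈ S.atlas, DifferentiableOn ℂ (fun w => c.φ (f w)) (Ω ∩ f ⁻¹' c.U)

/-- An analytic subset `A` of an open subset `D` of a complex space: locally (in charts)
cut out in `D` by finitely many holomorphic equations. -/
def IsAnalyticIn (S : CSpace X) (A D : Set X) : Prop :=
  A ⊆ D ∧ ∀ x ∈ D, ∃ c ∈ S.atlas, x ∈ c.U ∧ ∃ V' : Set c.E, IsOpen V' ∧ V' ⊆ c.V ∧ c.φ x ∈ V' ∧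
    ∃ (m : ℕ) (F : Fin m → c.E → ℂ), (∀ i, DifferentiableOn ℂ (F i) V') ∧
      ∀ y ∈ c.U, c.φ y ∈ V' → y ∈ D → (y ∈ A ↔ ∀ i, F i (c.φ y) = 0)

/-- Irreducibility of the open subset `D` of a complex space. -/
def IsIrreducibleIn (S : CSpace X) (D : Set X) : Prop :=
  D.Nonempty ∧ ∀ A₁ A₂ : Set X, IsAnalyticIn S A₁ D → IsAnalyticIn S A₂ D →
    A₁ ∪ A₂ = D → A₁ = D ∨ A₂ = D

/-- An irreducible analytic subset of `D`. -/
def IsIrreducibleAnalyticIn (S : CSpace X) (C D : Set X) : Prop :=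
  IsAnalyticIn S C D ∧ C.Nonempty ∧
  ∀ A₁ A₂ : Set X, IsAnalyticIn S A₁ D → IsAnalyticIn S A₂ D →
    C ⊆ A₁ ∪ A₂ → C ⊆ A₁ ∨ C ⊆ A₂

/-- An irreducible component of `D`: a maximal irreducible analytic subset. -/
def IsIrredComponentIn (S : CSpace X) (C D : Set X) : Prop :=
  IsIrreducibleAnalyticIn S C D ∧
  ∀ C' : Set X, IsIrreducibleAnalyticIn S C' D → C ⊆ C' → C' = C

/-- Local irreducibility (on `D`): every point has arbitrarily small irreducible open
neighborhoods. -/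
def IsLocallyIrreducibleIn (S : CSpace X) (D : Set X) : Prop :=
  ∀ x ∈ D, ∀ W : Set X, IsOpen W → x ∈ W →
    ∃ D' : Set X, IsOpen D' ∧ x ∈ D' ∧ D' ⊆ W ∩ D ∧ IsIrreducibleIn S D'

/-- Plurisubharmonicity of `u : X → [-∞,∞)` on an open subset `D` of a complex space:
`u` is not identically `-∞` on any irreducible component of `D` and, locally in charts,
`u` is the restriction of an ambient plurisubharmonic function. -/
def SpacePSHOn (S : CSpace X) (u : X → EReal) (D : Set X) : Prop :=
  (∀ x ∈ D, u x < ⊤) ∧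
  (∀ C : Set X, IsIrredComponentIn S C D → ∃ x ∈ C, u x ≠ ⊥) ∧
  ∀ x ∈ D, ∃ c ∈ S.atlas, x ∈ c.U ∧ ∃ V' : Set c.E, IsOpen V' ∧ V' ⊆ c.V ∧ c.φ x ∈ V' ∧
    {y ∈ c.U | c.φ y ∈ V'} ⊆ D ∧
    ∃ ψ : c.E → EReal, PSHOnE ψ V' ∧ ∀ y ∈ c.U, c.φ y ∈ V' → ψ (c.φ y) = u y

/-- Real analyticity on an open subset of a complex space, via charts. -/
def SpaceRealAnalyticOn (S : CSpace X) (f : X → ℝ) (D : Set X) : Prop :=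
  ∀ x ∈ D, ∃ c ∈ S.atlas, x ∈ c.U ∧ ∃ V' : Set c.E, IsOpen V' ∧ V' ⊆ c.V ∧ c.φ x ∈ V' ∧
    {y ∈ c.U | c.φ y ∈ V'} ⊆ D ∧
    ∃ g : c.E → ℝ, AnalyticOnNhd ℝ g V' ∧ ∀ y ∈ c.U, c.φ y ∈ V' → g (c.φ y) = f y

/-- Strong plurisubharmonicity on an open subset of a complex space, via charts. -/
def SpaceStronglyPSHOn (S : CSpace X) (f : X → ℝ) (D : Set X) : Prop :=
  ∀ x ∈ D, ∃ c ∈ S.atlas, x ∈ c.U ∧ ∃ V' : Set c.E, IsOpen V' ∧ V' ⊆ c.V ∧ c.φ x ∈ V' ∧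
    {y ∈ c.U | c.φ y ∈ V'} ⊆ D ∧
    ∃ g : c.E → ℝ, StronglyPSHOnE g V' ∧ ∀ y ∈ c.U, c.φ y ∈ V' → g (c.φ y) = f y

/-- `ψ` is an exhaustion function of `D`: all sublevel sets are relatively compact in `D`. -/
def IsExhaustionOn (ψ : X → ℝ) (D : Set X) : Prop :=
  ∀ c : ℝ, IsCompact (closure {x ∈ D | ψ x < c}) ∧ closure {x ∈ D | ψ x < c} ⊆ D

/-- The holomorphically convex hull of `K` with respect to holomorphic functions on the
open set `G`. -/
def holHull (S : CSpace X) (K G : Set X) : Set X :=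
  {x ∈ G | ∀ f : X → ℂ, SpaceHolOn S f G → ‖f x‖ ≤ sSup ((fun y => ‖f y‖) '' K)}

/-- The open subset `G` of the complex space is Stein: holomorphically convex and
holomorphically separable. -/
def IsSteinIn (S : CSpace X) (G : Set X) : Prop :=
  (∀ K : Set X, K ⊆ G → IsCompact K → IsCompact (holHull S K G)) ∧
  ∀ x ∈ G, ∀ y ∈ G, x ≠ y → ∃ f : X → ℂ, SpaceHolOn S f G ∧ f x ≠ f y

/-- All points of `D` are manifold points (charts onto open subsets of complex normed
spaces). -/
def IsManifoldIn (S : CSpace X) (D : Set X) : Prop :=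
  ∀ x ∈ D, ∃ c ∈ S.atlas, x ∈ c.U ∧ c.B = c.V

/-- The function `h_{A,D}` of Definition 2.8 (before regularization). -/
def relExtRaw (S : CSpace X) (A D : Set X) : X → EReal := fun z =>
  ⨆ u ∈ {u : X → EReal | SpacePSHOn S u D ∧ (∀ x ∈ D, u x ≤ 1) ∧ ∀ x ∈ A, u x ≤ 0}, u z

/-- The relative extremal function `h*_{A,D}`: the upper semicontinuous regularization
(within `D`) of `h_{A,D}`. -/
def relExt (S : CSpace X) (A D : Set X) : X → EReal := fun z =>
  limsup (relExtRaw S A D) (𝓝[D] z)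

/-- `P` is (locally) pluripolar in the open set `D`. -/
def IsPluripolarIn (S : CSpace X) (P D : Set X) : Prop :=
  ∀ x ∈ P, ∃ U : Set X, IsOpen U ∧ x ∈ U ∧ U ⊆ D ∧
    ∃ u : X → EReal, SpacePSHOn S u U ∧ ∀ y ∈ P ∩ U, u y = ⊥

/-- `A` is pluriregular at the point `a`. -/
def PluriregularAt (S : CSpace X) (A : Set X) (a : X) : Prop :=
  a ∈ closure A ∧ ∀ U : Set X, IsOpen U → a ∈ U → relExt S (A ∩ U) U a = 0

/-- `A` is locally pluriregular: nonempty and pluriregular at each of its points. -/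
def LocallyPluriregular (S : CSpace X) (A : Set X) : Prop :=
  A.Nonempty ∧ ∀ a ∈ A, PluriregularAt S A a

/-- A Josefson manifold: a complex manifold on which every (locally) pluripolar set is
globally pluripolar. -/
def IsJosefsonManifold (S : CSpace X) : Prop :=
  IsManifoldIn S univ ∧ ∀ P : Set X, IsPluripolarIn S P univ →
    ∃ u : X → EReal, SpacePSHOn S u univ ∧ ∀ x ∈ P, u x = ⊥

/-- Local (two-sided) boundedness of an `EReal`-valued function on `D`. -/
def LocBoundedOn (u : X → EReal) (D : Set X) : Prop :=
  ∀ x ∈ D, ∃ U : Set X, IsOpen U ∧ x ∈ U ∧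
    ∃ m M : ℝ, ∀ y ∈ U ∩ D, (m : EReal) ≤ u y ∧ u y ≤ (M : EReal)

/-- (Global) boundedness of an `EReal`-valued function on `D`. -/
def BoundedOn (u : X → EReal) (D : Set X) : Prop :=
  ∃ m M : ℝ, ∀ y ∈ D, (m : EReal) ≤ u y ∧ u y ≤ (M : EReal)

/-- `E` is locally `L`-regular (in the sense of Zeriahi): each of its points has a basis of
open neighborhoods in which the corresponding relative extremal functions are continuous
and vanish on `E`. -/
def LocallyLRegular (S : CSpace X) (E : Set X) : Prop :=
  ∀ x ∈ E, ∀ W : Set X, IsOpen W → x ∈ W →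
    ∃ U₀ : Set X, IsOpen U₀ ∧ x ∈ U₀ ∧ U₀ ⊆ W ∧
      ContinuousOn (relExt S (E ∩ U₀) U₀) U₀ ∧
      ∀ y ∈ E ∩ U₀, relExt S (E ∩ U₀) U₀ y = 0

end Space

open MeasureTheory

/-! ### The complex Monge–Ampère operator -/

/-- Second directional derivative. -/
def d2 {n : ℕ} (u : Cn n → ℝ) (z v w : Cn n) : ℝ :=
  fderiv ℝ (fun x => fderiv ℝ u x v) z w

/-- The complex Hessian `(∂²u/∂z_j ∂z̄_k)_{j,k}` of a real-valued function on `ℂⁿ`. -/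
def cHess {n : ℕ} (u : Cn n → ℝ) (z : Cn n) : Matrix (Fin n) (Fin n) ℂ :=
  Matrix.of fun j k =>
    (((d2 u z (Pi.single j 1) (Pi.single k 1) +
        d2 u z (Pi.single j Complex.I) (Pi.single k Complex.I) : ℝ) : ℂ) +
      Complex.I * ((d2 u z (Pi.single j 1) (Pi.single k Complex.I) -
        d2 u z (Pi.single j Complex.I) (Pi.single k 1) : ℝ) : ℂ)) / 4

/-- The density of `(dd^c u)^n` for a smooth `u`. -/
def maDensity {n : ℕ} (u : Cn n → ℝ) (z : Cn n) : ℝ :=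
  (4 : ℝ) ^ n * (n.factorial : ℝ) * ((cHess u z).det).re

/-- The Monge–Ampère measure `(dd^c u)^n` of a smooth function on `ℂⁿ`. -/
def smoothMA {n : ℕ} (u : Cn n → ℝ) : Measure (Cn n) :=
  volume.withDensity fun z => ENNReal.ofReal (maDensity u z)

/-- `μ` is the Bedford–Taylor Monge–Ampère measure `(dd^c u)^n` of a locally bounded
plurisubharmonic `u` on the open set `Ω ⊆ ℂⁿ`: `μ` is carried by `Ω` and is the weak-*
limit of the Monge–Ampère measures of any decreasing smooth plurisubharmonic
approximation of `u`. -/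
def IsMAOn {n : ℕ} (u : Cn n → EReal) (Ω : Set (Cn n)) (μ : Measure (Cn n)) : Prop :=
  (∀ A : Set (Cn n), MeasurableSet A → Disjoint A Ω → μ A = 0) ∧
  ∀ v : ℕ → Cn n → ℝ, (∀ j, ContDiff ℝ (⊤ : ℕ∞) (v j)) →
    (∀ j, PSHOnE (fun z => ((v j z : ℝ) : EReal)) Ω) →
    (∀ z ∈ Ω, Antitone fun j => v j z) →
    (∀ z ∈ Ω, Tendsto (fun j => ((v j z : ℝ) : EReal)) atTop (𝓝 (u z))) →
    ∀ f : Cn n → ℝ, Continuous f → HasCompactSupport f → tsupport f ⊆ Ω →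
      Tendsto (fun j => ∫ z, f z ∂(smoothMA (v j))) atTop (𝓝 (∫ z, f z ∂μ))

section SpaceMA

variable {X : Type*} [TopologicalSpace X]

/-- A holomorphic local coordinate system of dimension `n` on a complex space: a
homeomorphism `ρ` of an open `U₀ ⊆ X` onto an open `Ω₀ ⊆ ℂⁿ` which identifies the
holomorphic functions on both sides. -/
def IsLocalCoord (S : CSpace X) (n : ℕ) (U₀ : Set X) (ρ : X → Cn n) (Ω₀ : Set (Cn n)) :
    Prop :=
  IsOpen U₀ ∧ IsOpen Ω₀ ∧ ρ '' U₀ = Ω₀ ∧ InjOn ρ U₀ ∧ ContinuousOn ρ U₀ ∧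
  (∀ W : Set X, W ⊆ U₀ → IsOpen W → IsOpen (ρ '' W)) ∧
  (∀ j : Fin n, SpaceHolOn S (fun x => ρ x j) U₀) ∧
  ∀ f : X → ℂ, SpaceHolOn S f U₀ →
    ∃ F : Cn n → ℂ, DifferentiableOn ℂ F Ω₀ ∧ ∀ x ∈ U₀, F (ρ x) = f x

/-- The set of regular points of dimension `n`. -/
def RegLocus (S : CSpace X) (n : ℕ) : Set X :=
  {x | ∃ (U₀ : Set X) (ρ : X → Cn n) (Ω₀ : Set (Cn n)), IsLocalCoord S n U₀ ρ Ω₀ ∧ x ∈ U₀}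

/-- The open set `D` has pure dimension `n`: its `n`-dimensional regular points are dense
in it and it has regular points of no other dimension. -/
def PureDimensionIn (S : CSpace X) (D : Set X) (n : ℕ) : Prop :=
  D ⊆ closure (RegLocus S n ∩ D) ∧ ∀ k : ℕ, (RegLocus S k ∩ D).Nonempty → k = n

/-- `μ` is the Monge–Ampère measure `(dd^c u)^n` of `u` on the open subset `D` of a
complex space: it is carried by the regular part of `D` (i.e. extended by zero through
the singular set) and corresponds, in every local coordinate system, to the
Monge–Ampère measure in `ℂⁿ`. -/
def IsMAOnSpace [MeasurableSpace X] (S : CSpace X) (n : ℕ) (u : X → EReal) (D : Set X)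
    (μ : Measure X) : Prop :=
  (∀ A : Set X, MeasurableSet A → Disjoint A D → μ A = 0) ∧
  (∀ A : Set X, MeasurableSet A → A ⊆ D → Disjoint A (RegLocus S n) → μ A = 0) ∧
  ∀ (U₀ : Set X) (ρ : X → Cn n) (Ω₀ : Set (Cn n)), IsLocalCoord S n U₀ ρ Ω₀ → U₀ ⊆ D →
    ∃ (uu : Cn n → EReal) (ν : Measure (Cn n)),
      (∀ x ∈ U₀, uu (ρ x) = u x) ∧ IsMAOn uu Ω₀ ν ∧
      ∀ A : Set X, MeasurableSet A → A ⊆ U₀ → μ A = ν (ρ '' A)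

/-- `log` with values in `[-∞, ∞)`. -/
def elog (t : ℝ) : EReal := if t ≤ 0 then ⊥ else ((Real.log t : ℝ) : EReal)

/-- `g` is a parabolic potential on `D`: a nonnegative continuous plurisubharmonic
exhaustion function of `D` such that `log g` is plurisubharmonic and maximal
(`(dd^c log g)^n = 0`) off the zero set of `g`.  A Stein space possessing such a
potential is called weakly parabolic. -/
def WeaklyParabolicIn [MeasurableSpace X] (S : CSpace X) (n : ℕ) (g : X → ℝ) (D : Set X) :
    Prop :=
  (∀ x ∈ D, 0 ≤ g x) ∧ ContinuousOn g D ∧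
  SpacePSHOn S (fun x => ((g x : ℝ) : EReal)) D ∧
  IsExhaustionOn g D ∧
  SpacePSHOn S (fun x => elog (g x)) D ∧
  IsMAOnSpace S n (fun x => elog (g x)) {x ∈ D | g x ≠ 0} (0 : Measure X)

end SpaceMA

/-! ### Products of complex spaces, generalized crosses -/

section Pi

variable {ι : Type*} [Fintype ι] {Z : ι → Type*} [∀ i, TopologicalSpace (Z i)]

/-- Holomorphy of a function on an open subset of a finite product of complex spaces,
via products of charts. -/
def PiHolOn (T : ∀ i, CSpace (Z i)) (f : (∀ i, Z i) → ℂ) (Ω : Set (∀ i, Z i)) : Prop :=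
  ∀ w ∈ Ω, ∃ c : ∀ i, CChart (Z i), (∀ i, c i ∈ (T i).atlas) ∧ (∀ i, w i ∈ (c i).U) ∧
    ∃ V' : Set (∀ i, (c i).E), IsOpen V' ∧ (fun i => (c i).φ (w i)) ∈ V' ∧
      {y : ∀ i, Z i | (∀ i, y i ∈ (c i).U) ∧ (fun i => (c i).φ (y i)) ∈ V'} ⊆ Ω ∧
      ∃ F : (∀ i, (c i).E) → ℂ, DifferentiableOn ℂ F V' ∧
        ∀ y : ∀ i, Z i, (∀ i, y i ∈ (c i).U) → ((fun i => (c i).φ (y i)) ∈ V') →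
          F (fun i => (c i).φ (y i)) = f y

/-- Plurisubharmonicity on an open subset of a finite product of complex spaces, via
products of charts. -/
def PiPSHOn (T : ∀ i, CSpace (Z i)) (u : (∀ i, Z i) → EReal) (Ω : Set (∀ i, Z i)) : Prop :=
  (∀ z ∈ Ω, u z < ⊤) ∧
  (¬ ∃ U : Set (∀ i, Z i), U ⊆ Ω ∧ IsOpen U ∧ U.Nonempty ∧ ∀ z ∈ U, u z = ⊥) ∧
  ∀ w ∈ Ω, ∃ c : ∀ i, CChart (Z i), (∀ i, c i ∈ (T i).atlas) ∧ (∀ i, w i ∈ (c i).U) ∧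
    ∃ V' : Set (∀ i, (c i).E), IsOpen V' ∧ (fun i => (c i).φ (w i)) ∈ V' ∧
      {y : ∀ i, Z i | (∀ i, y i ∈ (c i).U) ∧ (fun i => (c i).φ (y i)) ∈ V'} ⊆ Ω ∧
      ∃ ψ : (∀ i, (c i).E) → EReal, PSHOnE ψ V' ∧
        ∀ y : ∀ i, Z i, (∀ i, y i ∈ (c i).U) → ((fun i => (c i).φ (y i)) ∈ V') →
          ψ (fun i => (c i).φ (y i)) = u y

/-- The function `h_{A,D}` on a product of complex spaces. -/
def PiRelExtRaw (T : ∀ i, CSpace (Z i)) (A D : Set (∀ i, Z i)) : (∀ i, Z i) → EReal :=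
  fun z =>
    ⨆ u ∈ {u : (∀ i, Z i) → EReal |
      PiPSHOn T u D ∧ (∀ x ∈ D, u x ≤ 1) ∧ ∀ x ∈ A, u x ≤ 0}, u z

/-- The relative extremal function `h*_{A,D}` on a product of complex spaces. -/
def PiRelExt (T : ∀ i, CSpace (Z i)) (A D : Set (∀ i, Z i)) : (∀ i, Z i) → EReal :=
  fun z => limsup (PiRelExtRaw T A D) (𝓝[D] z)

/-- Pluripolar subsets of a finite product of complex spaces. -/
def PiPluripolar (T : ∀ i, CSpace (Z i)) (P : Set (∀ i, Z i)) : Prop :=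
  ∀ w ∈ P, ∃ U : Set (∀ i, Z i), IsOpen U ∧ w ∈ U ∧
    ∃ u : (∀ i, Z i) → EReal, PiPSHOn T u U ∧ ∀ y ∈ P ∩ U, u y = ⊥

end Pi

section Cross

variable {N : ℕ} {X : Fin N → Type*}

/-- The number of `1`-entries of `α`; `α ∈ I(N,k)` iff `idxCard α = k`. -/
def idxCard (α : Fin N → Bool) : ℕ := (Finset.univ.filter fun j => α j = true).card

/-- `i_{a,α}`: the point of the product whose coordinates are those of `z` where
`α j = 1` and those of `a` where `α j = 0`. -/
def insertCoords (α : Fin N → Bool) (a : ∀ j : {j : Fin N // α j = false}, X j.1)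
    (z : ∀ j : {j : Fin N // α j = true}, X j.1) : ∀ j, X j :=
  fun j => if h : α j = true then z ⟨j, h⟩ else a ⟨j, Bool.eq_false_iff.mpr h⟩

/-- The projection `a ↦ a_α^0` onto the coordinates with `α j = 0`. -/
def proj0 (α : Fin N → Bool) (w : ∀ j, X j) : ∀ j : {j : Fin N // α j = false}, X j.1 :=
  fun j => w j.1

/-- The set `A_α` (the product of the `A_j` with `α_j = 0`). -/
def piASet (A : ∀ j, Set (X j)) (α : Fin N → Bool) :
    Set (∀ j : {j : Fin N // α j = false}, X j.1) :=
  {a | ∀ j, a j ∈ A j.1}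

/-- The generalized `(N,k)`-cross `T_{N,k}((A_j, X_j)_j, (Σ_α)_α)` (with `D_j = X_j`). -/
def crossT (A : ∀ j, Set (X j)) (k : ℕ)
    (Sig : ∀ α : Fin N → Bool, Set (∀ j : {j : Fin N // α j = false}, X j.1)) :
    Set (∀ j, X j) :=
  {w | ∃ α : Fin N → Bool, idxCard α = k ∧
    (∀ j : {j : Fin N // α j = false}, w j.1 ∈ A j.1) ∧ proj0 α w ∉ Sig α}

variable [∀ j, TopologicalSpace (X j)]

/-- `f ∈ 𝒪_s(T_{N,k})`: separate holomorphy on the generalized `(N,k)`-cross. -/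
def SepHol (S : ∀ j, CSpace (X j)) (A : ∀ j, Set (X j)) (k : ℕ)
    (Sig : ∀ α : Fin N → Bool, Set (∀ j : {j : Fin N // α j = false}, X j.1))
    (f : (∀ j, X j) → ℂ) : Prop :=
  ∀ α : Fin N → Bool, idxCard α = k →
    ∀ a : ∀ j : {j : Fin N // α j = false}, X j.1, a ∈ piASet A α → a ∉ Sig α →
      PiHolOn (fun j : {j : Fin N // α j = true} => S j.1)
        (fun z => f (insertCoords α a z)) univ

/-- `f ∈ 𝒪_s^c(T_{N,k})`: separately holomorphic, and continuous on `A_α \ Σ_α` in the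
remaining variables. -/
def SepHolC (S : ∀ j, CSpace (X j)) (A : ∀ j, Set (X j)) (k : ℕ)
    (Sig : ∀ α : Fin N → Bool, Set (∀ j : {j : Fin N // α j = false}, X j.1))
    (f : (∀ j, X j) → ℂ) : Prop :=
  SepHol S A k Sig f ∧
  ∀ α : Fin N → Bool, idxCard α = k →
    ∀ b : ∀ j : {j : Fin N // α j = true}, X j.1,
      ContinuousOn (fun a : ∀ j : {j : Fin N // α j = false}, X j.1 =>
        f (insertCoords α a b)) (piASet A α \ Sig α)

/-- The envelope `X̂_{N,k}` of the `(N,k)`-cross. -/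
def crossEnvelope (S : ∀ j, CSpace (X j)) (A : ∀ j, Set (X j))
    (k : ℝ) : Set (∀ j, X j) :=
  {z | (∑ j, relExt (S j) (A j) univ (z j)) < ((k : ℝ) : EReal)}

end Cross

section fileA1
open Set Filter Topology Metric MeasureTheory

def dbarC (χ : ℂ → ℂ) (ζ : ℂ) : ℂ := (1/2) * (fderiv ℝ χ ζ 1 + Complex.I * fderiv ℝ χ ζ Complex.I)

theorem dbarC_continuous {χ : ℂ → ℂ} (h : ContDiff ℝ 1 χ) : Continuous (dbarC χ) := by
  have h1 : Continuous (fderiv ℝ χ) := h.continuous_fderiv (by norm_num)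
  unfold dbarC; fun_prop

theorem pompeiu {χ : ℂ → ℂ} (h : ContDiff ℝ 1 χ) (hc : HasCompactSupport χ) (z : ℂ) :
    ∫ ζ, dbarC χ ζ / (z - ζ) = Real.pi * χ z := by
  have h1 : Continuous (fderiv ℝ χ) := h.continuous_fderiv (by norm_num)
  have hd : ∀ x, HasFDerivAt χ (fderiv ℝ χ x) x := fun x =>
    (h.differentiable (by norm_num) x).hasFDerivAt
  have hc1 : HasCompactSupport (fderiv ℝ χ) := hc.fderiv ℝ
  obtain ⟨R, hR0, hR⟩ : ∃ R : ℝ, 0 < R ∧ ∀ r θ : ℝ, R ≤ r →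
      z + r * Complex.exp (θ * Complex.I) ∉ tsupport χ := by
    obtain ⟨R, hR⟩ := hc.isCompact.isBounded.subset_ball z
    refine ⟨max R 1, by positivity, fun r θ hr hmem => ?_⟩
    have := hR hmem
    have hr0 : 0 ≤ r := le_trans (by positivity) hr
    simp [dist_eq_norm, Complex.norm_exp_ofReal_mul_I, abs_of_nonneg hr0] at this
    exact absurd (le_trans (le_max_left _ _) hr) (not_le.2 this)
  set P : ℝ × ℝ → ℂ := fun p => z + p.1 * Complex.exp (p.2 * Complex.I) with hP
  have hPc : Continuous P := by rw [hP]; fun_prop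
  set A : ℝ × ℝ → ℂ := fun p => fderiv ℝ χ (P p) (Complex.exp (p.2 * Complex.I)) with hA
  set B : ℝ × ℝ → ℂ := fun p => fderiv ℝ χ (P p) (Complex.I * Complex.exp (p.2 * Complex.I)) with hB
  have hAc : Continuous A := by
    have := h1.comp hPc
    rw [hA]; exact this.clm_apply (by fun_prop)
  have hBc : Continuous B := by
    have := h1.comp hPc
    rw [hB]; exact this.clm_apply (by fun_prop)
  have hz : ∀ p : ℝ × ℝ, R ≤ p.1 → fderiv ℝ χ (P p) = 0 := by
    intro p hp
    have := hR p.1 p.2 hp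
    by_contra hne
    exact this (tsupport_fderiv_subset ℝ (subset_tsupport _ hne))
  have hint : ∀ G : ℝ × ℝ → ℂ, Continuous G → (∀ p : ℝ × ℝ, R ≤ p.1 → G p = 0) →
      IntegrableOn G (Ioi (0:ℝ) ×ˢ Ioo (-Real.pi) Real.pi) := by
    intro G hG hG0
    have hK : IntegrableOn G (Icc 0 R ×ˢ Icc (-Real.pi) Real.pi) :=
      hG.continuousOn.integrableOn_compact (isCompact_Icc.prod isCompact_Icc)
    refine hK.of_forall_sdiff_eq_zero (measurableSet_Ioi.prod measurableSet_Ioo) ?_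
    rintro p ⟨⟨hp1, hp2⟩, hp3⟩
    apply hG0
    by_contra hlt
    exact hp3 ⟨⟨le_of_lt hp1, le_of_lt (not_le.1 hlt)⟩, ⟨le_of_lt hp2.1, le_of_lt hp2.2⟩⟩
  have hAi := hint A hAc (fun p hp => by simp [hA, hz p hp])
  have hBi := hint B hBc (fun p hp => by simp [hB, hz p hp])
  have e1 : ∫ ζ, dbarC χ ζ / (z - ζ) = ∫ w, dbarC χ (z + w) / (-w) := by
    rw [← integral_add_left_eq_self (fun ζ => dbarC χ ζ / (z - ζ)) z]
    congr 1; ext w; congr 1; ring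
  rw [e1, ← Complex.integral_comp_polarCoord_symm, polarCoord_target]
  have e2 : ∀ p ∈ Ioi (0:ℝ) ×ˢ Ioo (-Real.pi) Real.pi,
      p.1 • (dbarC χ (z + Complex.polarCoord.symm p) / (-Complex.polarCoord.symm p)) =
      -(1/2) * (A p + Complex.I * B p) := by
    rintro ⟨r, θ⟩ ⟨hr, -⟩
    have hr' : (r : ℂ) ≠ 0 := by simpa using (ne_of_gt hr)
    have hs : Complex.polarCoord.symm (r, θ) = r * Complex.exp (θ * Complex.I) := by
      rw [Complex.polarCoord_symm_apply, Complex.exp_mul_I]; simp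
    simp only [hs, hA, hB, hP, dbarC]
    set D := fderiv ℝ χ (z + r * Complex.exp (θ * Complex.I)) with hD
    have hlin : ∀ w : ℂ, D w = w.re * D 1 + w.im * D Complex.I := by
      intro w
      conv_lhs => rw [show w = w.re • (1:ℂ) + w.im • Complex.I by
        simp [Complex.re_add_im]]
      rw [map_add, map_smul, map_smul]; simp
    rw [hlin (Complex.exp (θ * Complex.I)), hlin (Complex.I * Complex.exp (θ * Complex.I))]
    have hne : Complex.exp (θ * Complex.I) ≠ 0 := Complex.exp_ne_zero _
    have h1 : (Complex.exp (θ * Complex.I))⁻¹ = Complex.cos θ - Complex.sin θ * Complex.I := by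
      rw [← Complex.exp_neg, show -(θ * Complex.I) = ((-θ : ℂ)) * Complex.I by ring,
        Complex.exp_mul_I]; simp; ring
    rw [Complex.real_smul, show (r:ℂ) * (1 / 2 * (D 1 + Complex.I * D Complex.I) /
      -(r * Complex.exp (θ * Complex.I))) = -(1/2) * (D 1 + Complex.I * D Complex.I) *
        (Complex.exp (θ * Complex.I))⁻¹ by field_simp, h1]
    simp [Complex.exp_ofReal_mul_I_re, Complex.exp_ofReal_mul_I_im]
    ring_nf; simp; ring
  rw [setIntegral_congr_fun (measurableSet_Ioi.prod measurableSet_Ioo) e2, integral_const_mul,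
    integral_add hAi (hBi.const_mul _), integral_const_mul]
  have iA : ∫ p in Ioi (0:ℝ) ×ˢ Ioo (-Real.pi) Real.pi, A p = -(2 * Real.pi * χ z) := by
    have hsw := setIntegral_prod_swap (μ := volume) (ν := volume) (Ioi (0:ℝ)) (Ioo (-Real.pi) Real.pi) A
    rw [Measure.volume_eq_prod, ← hsw]
    have hAs : IntegrableOn (fun p : ℝ × ℝ => A p.swap) (Ioo (-Real.pi) Real.pi ×ˢ Ioi (0:ℝ))
        (volume.prod volume) := by
      have := hAi
      rw [IntegrableOn, Measure.volume_eq_prod, ← Measure.prod_restrict] at this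
      rw [IntegrableOn, ← Measure.prod_restrict]
      exact this.swap
    rw [setIntegral_prod _ hAs]
    have : ∀ θ : ℝ, ∫ r in Ioi (0:ℝ), A (r, θ) = - χ z := by
      intro θ
      have hder : ∀ r ∈ Ici (0:ℝ), HasDerivAt (fun r : ℝ => χ (P (r, θ))) (A (r, θ)) r := by
        intro r _
        have hp : HasDerivAt (fun r : ℝ => P (r, θ)) (Complex.exp (θ * Complex.I)) r := by
          simp only [hP]
          simpa using ((Complex.ofRealCLM.hasDerivAt (x := r)).mul_const
            (Complex.exp (θ * Complex.I))).const_add z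
        exact (hd _).comp_hasDerivAt r hp
      have hi : IntegrableOn (fun r : ℝ => A (r, θ)) (Ioi 0) := by
        have hK : IntegrableOn (fun r : ℝ => A (r, θ)) (Icc 0 R) :=
          (Continuous.continuousOn (by fun_prop)).integrableOn_compact isCompact_Icc
        refine hK.of_forall_sdiff_eq_zero measurableSet_Ioi ?_
        rintro r ⟨hr, hr2⟩
        have : R ≤ r := by
          by_contra hlt; exact hr2 ⟨le_of_lt hr, le_of_lt (not_le.1 hlt)⟩
        simp [hA, hz (r, θ) this]
      have ht : Tendsto (fun r : ℝ => χ (P (r, θ))) atTop (𝓝 0) := by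
        apply tendsto_const_nhds.congr'
        filter_upwards [eventually_ge_atTop R] with r hr
        exact (image_eq_zero_of_notMem_tsupport (hR r θ hr)).symm
      rw [integral_Ioi_of_hasDerivAt_of_tendsto' hder hi ht]
      simp [hP]
    simp only [Prod.swap_prod_mk, this]
    simp
    rw [max_eq_left (by positivity)]; left; push_cast; ring
  have iB : ∫ p in Ioi (0:ℝ) ×ˢ Ioo (-Real.pi) Real.pi, B p = 0 := by
    rw [Measure.volume_eq_prod, setIntegral_prod _ (by rwa [← Measure.volume_eq_prod])]
    apply setIntegral_eq_zero_of_forall_eq_zero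
    intro r hr
    have hr' : (r : ℂ) ≠ 0 := by simpa using (ne_of_gt hr)
    have hder : ∀ θ : ℝ, HasDerivAt (fun θ : ℝ => χ (P (r, θ))) (r * B (r, θ)) θ := by
      intro θ
      have hp : HasDerivAt (fun θ : ℝ => P (r, θ)) (r * (Complex.I * Complex.exp (θ * Complex.I))) θ := by
        simp only [hP]
        have := (((Complex.ofRealCLM.hasDerivAt (x := θ)).mul_const Complex.I).cexp.const_mul
          (r:ℂ)).const_add z
        refine this.congr_deriv ?_
        simp [mul_comm]
      have := (hd (P (r, θ))).comp_hasDerivAt θ hp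
      refine this.congr_deriv ?_
      rw [← Complex.real_smul, map_smul, Complex.real_smul]
    have hi := intervalIntegral.integral_eq_sub_of_hasDerivAt (a := -Real.pi) (b := Real.pi)
      (fun θ _ => hder θ) (Continuous.intervalIntegrable (by fun_prop) _ _)
    have hper : P (r, Real.pi) = P (r, -Real.pi) := by
      simp only [hP]
      rw [show ((-Real.pi : ℝ) : ℂ) * Complex.I = -(Real.pi * Complex.I) by push_cast; ring,
        Complex.exp_neg, Complex.exp_pi_mul_I]; norm_num
    rw [hper, sub_self, intervalIntegral.integral_const_mul,
      intervalIntegral.integral_of_le (by linarith [Real.pi_pos]),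
      integral_Ioc_eq_integral_Ioo] at hi
    exact (mul_eq_zero.1 hi).resolve_left hr'
  rw [iA, iB]; ring

end fileA1

section fileA2
open Set Filter Topology Metric MeasureTheory

theorem inv_norm_integrableOn (z : ℂ) (R : ℝ) : IntegrableOn (fun ζ : ℂ => ‖z - ζ‖⁻¹) (ball 0 R) := by
  have h0 : ∀ r : ℝ, IntegrableOn (fun ζ : ℂ => ‖ζ‖⁻¹) (ball 0 r) := by
    intro r
    have := (locallyIntegrable_of_norm_le_rpow (μ := (volume : Measure ℂ)) (E := ℂ) (F := ℝ) (f := fun ζ : ℂ => ‖ζ‖⁻¹)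
      (C := 1) (α := 1) (by simp [Complex.finrank_real_complex]) (by simp [Complex.finrank_real_complex])
      (by filter_upwards with x; simp [Real.rpow_neg_one]) (by fun_prop))
    exact (this.integrableOn_isCompact (isCompact_closedBall 0 r)).mono_set ball_subset_closedBall
  have h1 := (Measure.measurePreserving_sub_left (volume : Measure ℂ) z).integrableOn_comp_preimage
    (MeasurableEquiv.subLeft z).measurableEmbedding (f := fun ζ : ℂ => ‖ζ‖⁻¹) (s := ball 0 (R + ‖z‖))
  have h2 := h1.2 (h0 _)
  refine h2.mono_set ?_
  intro w hw
  simp at hw ⊢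
  calc ‖z - w‖ ≤ ‖z‖ + ‖w‖ := norm_sub_le _ _
    _ < _ := by linarith

theorem inv_norm_integral_le (z : ℂ) (R S : ℝ) (hz : ‖z‖ ≤ S) :
    ∫ ζ in ball 0 R, ‖z - ζ‖⁻¹ ≤ ∫ ζ in ball (0:ℂ) (R + S), ‖(0:ℂ) - ζ‖⁻¹ := by
  have h1 := (Measure.measurePreserving_sub_left (volume : Measure ℂ) z).setIntegral_preimage_emb
    (MeasurableEquiv.subLeft z).measurableEmbedding (fun ζ : ℂ => ‖ζ‖⁻¹) (ball 0 (R + S))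
  have h0 := inv_norm_integrableOn 0 (R + S)
  simp only [zero_sub, norm_neg] at h0 ⊢
  rw [← h1]
  apply setIntegral_mono_set
  · exact ((Measure.measurePreserving_sub_left (volume : Measure ℂ) z).integrableOn_comp_preimage
      (MeasurableEquiv.subLeft z).measurableEmbedding).2 h0
  · filter_upwards with x; positivity
  · apply HasSubset.Subset.eventuallyLE
    intro w hw
    simp at hw ⊢
    calc ‖z - w‖ ≤ ‖z‖ + ‖w‖ := norm_sub_le _ _
      _ < _ := by linarith

open WeakDual in
theorem char_bound {𝔅 : Type*} [NormedCommRing 𝔅] [NormedAlgebra ℂ 𝔅] [CompleteSpace 𝔅]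
    (m : characterSpace ℂ 𝔅) (x : 𝔅) : ‖m x‖ ≤ ‖x‖ * ‖(1:𝔅)‖ :=
  AlgHom.norm_apply_le_self_mul_norm_one (CharacterSpace.toAlgHom m) x

open WeakDual in
theorem gl_core {𝔅 : Type*} [NormedCommRing 𝔅] [NormedAlgebra ℂ 𝔅] [CompleteSpace 𝔅] (b : 𝔅)
    {ι : Type*} [Fintype ι] (χ : ι → ℂ → ℂ) (h : ∀ i, ContDiff ℝ 1 (χ i))
    (hc : ∀ i, HasCompactSupport (χ i)) :
    ∃ C : ℝ, 0 ≤ C ∧ ∀ (p : ι → 𝔅) (δ : ℝ), 0 < δ →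
      (∀ ζ, ∃ r, ‖∑ i, dbarC (χ i) ζ • p i - (b - algebraMap ℂ 𝔅 ζ) * r‖ < δ) →
      ∃ a : 𝔅, ∀ m : characterSpace ℂ 𝔅, ‖m a - ∑ i, χ i (m b) * m (p i)‖ ≤ C * δ := by
  obtain ⟨R, hR⟩ : ∃ R : ℝ, ∀ i, ∀ ζ ∉ ball (0:ℂ) R, dbarC (χ i) ζ = 0 := by
    have hb : Bornology.IsBounded (⋃ i, tsupport (χ i)) :=
      Bornology.isBounded_iUnion.2 fun i => (hc i).isCompact.isBounded
    obtain ⟨R, hR⟩ := hb.subset_ball 0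
    refine ⟨R, fun i ζ hζ => ?_⟩
    have : fderiv ℝ (χ i) ζ = 0 := by
      by_contra hne
      exact hζ (hR (mem_iUnion.2 ⟨i, tsupport_fderiv_subset ℝ (subset_tsupport _ hne)⟩))
    simp [dbarC, this]
  set S := ‖b‖ * ‖(1:𝔅)‖
  set J := ∫ ζ in ball (0:ℂ) (R + S), ‖(0:ℂ) - ζ‖⁻¹ with hJ
  have hJ0 : 0 ≤ J := setIntegral_nonneg measurableSet_ball (fun x _ => by positivity)
  have hpi := Real.pi_pos
  refine ⟨Real.pi⁻¹ * (‖(1:𝔅)‖ * J), by positivity, fun p δ hδ hr => ?_⟩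
  set ω : ℂ → 𝔅 := fun ζ => ∑ i, dbarC (χ i) ζ • p i with hω
  have hωc : Continuous ω := by
    apply continuous_finset_sum
    intro i _
    exact (dbarC_continuous (h i)).smul continuous_const
  have halg : Continuous (algebraMap ℂ 𝔅) := continuous_algebraMap ℂ 𝔅
  letI : NormedSpace ℝ 𝔅 := NormedSpace.restrictScalars ℝ ℂ 𝔅
  obtain ⟨g, hg⟩ := exists_continuous_forall_mem_convex_of_local_const
    (t := fun ζ : ℂ => {r : 𝔅 | ‖ω ζ - (b - algebraMap ℂ 𝔅 ζ) * r‖ < δ}) (by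
      intro ζ r hr s hs α β hα hβ hαβ
      simp only [mem_setOf_eq] at hr hs ⊢
      have e : ω ζ - (b - algebraMap ℂ 𝔅 ζ) * (α • r + β • s) =
        α • (ω ζ - (b - algebraMap ℂ 𝔅 ζ) * r) + β • (ω ζ - (b - algebraMap ℂ 𝔅 ζ) * s) := by
        have hα' : ∀ (t : ℝ) (x y : 𝔅), x * (t • y) = t • (x * y) := fun t x y =>
          mul_smul_comm (t : ℂ) x y
        rw [mul_add, hα', hα']
        simp only [smul_sub]
        have : ω ζ = α • ω ζ + β • ω ζ := by rw [← add_smul, hαβ, one_smul]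
        nth_rewrite 1 [this]; abel
      rw [e]
      calc _ ≤ ‖α • (ω ζ - (b - algebraMap ℂ 𝔅 ζ) * r)‖ + ‖β • (ω ζ - (b - algebraMap ℂ 𝔅 ζ) * s)‖ :=
            norm_add_le _ _
        _ = α * ‖ω ζ - (b - algebraMap ℂ 𝔅 ζ) * r‖ + β * ‖ω ζ - (b - algebraMap ℂ 𝔅 ζ) * s‖ := by
            rw [norm_smul, norm_smul, Real.norm_of_nonneg hα, Real.norm_of_nonneg hβ]
        _ < δ := by
          rcases eq_or_lt_of_le hα with h0 | h0
          · have : β = 1 := by linarith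
            subst this; rw [← h0]; linarith
          · nlinarith [mul_le_mul_of_nonneg_left hs.le hβ, mul_lt_mul_of_pos_left hr h0])
    (by
      intro ζ
      obtain ⟨r, hr⟩ := hr ζ
      refine ⟨r, ?_⟩
      have : Continuous fun ζ => ‖ω ζ - (b - algebraMap ℂ 𝔅 ζ) * r‖ := by fun_prop
      exact this.continuousAt.eventually_lt continuousAt_const hr)
  have hgi : IntegrableOn g (ball 0 R) := ((map_continuous g).continuousOn.integrableOn_compact
    (isCompact_closedBall 0 R)).mono_set ball_subset_closedBall
  set c : ℂ := (Real.pi : ℂ)⁻¹ with hcdef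
  refine ⟨c • ∫ ζ in ball (0:ℂ) R, g ζ, fun m => ?_⟩
  set z := m b with hz
  have hzS : ‖z‖ ≤ S := char_bound m b
  have hma : m (c • ∫ ζ in ball (0:ℂ) R, g ζ) = c * ∫ ζ in ball (0:ℂ) R, m (g ζ) := by
    rw [map_smul, smul_eq_mul]
    congr 1
    have := (((CharacterSpace.toCLM m) : 𝔅 →L[ℂ] ℂ).restrictScalars ℝ).integral_comp_comm hgi
    exact this.symm
  have hmω : ∀ ζ, m (ω ζ) = ∑ i, dbarC (χ i) ζ * m (p i) := by
    intro ζ; simp [hω, map_sum, map_smul]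
  set e : ℂ → ℂ := fun ζ => m (ω ζ) - (z - ζ) * m (g ζ) with he
  have heb : ∀ ζ, ‖e ζ‖ ≤ δ * ‖(1:𝔅)‖ := by
    intro ζ
    have : e ζ = m (ω ζ - (b - algebraMap ℂ 𝔅 ζ) * g ζ) := by
      simp [he, map_sub, map_mul, hz]
      left
      exact ((CharacterSpace.toAlgHom m).commutes ζ).symm
    rw [this]
    refine (char_bound m _).trans ?_
    gcongr
    exact (hg ζ).le
  have hint1 : ∀ i, Integrable (fun ζ => dbarC (χ i) ζ / (z - ζ)) := by
    intro i
    have hcd := dbarC_continuous (h i)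
    have h2 : IntegrableOn (fun ζ => (z - ζ)⁻¹ * dbarC (χ i) ζ) (ball 0 R) := by
      obtain ⟨B, hB⟩ := (isCompact_closedBall (0:ℂ) R).exists_bound_of_continuousOn hcd.continuousOn
      refine Integrable.mul_bdd (c := B) ?_ hcd.aestronglyMeasurable ?_
      · refine (inv_norm_integrableOn z R).integrable.mono (Measurable.aestronglyMeasurable (by fun_prop)) ?_
        filter_upwards with x; simp
      · refine (ae_restrict_iff' measurableSet_ball).2 ?_
        filter_upwards with x hx using hB x (ball_subset_closedBall hx)
    have h3 : IntegrableOn (fun ζ => (z - ζ)⁻¹ * dbarC (χ i) ζ) univ :=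
      h2.of_forall_sdiff_eq_zero MeasurableSet.univ (fun x hx => by simp [hR i x hx.2])
    rw [integrableOn_univ] at h3
    refine h3.congr ?_
    filter_upwards with x; field_simp
  have hsum : ∑ i, χ i z * m (p i) = c * ∫ ζ in ball (0:ℂ) R, m (ω ζ) / (z - ζ) := by
    have : ∫ ζ in ball (0:ℂ) R, m (ω ζ) / (z - ζ) = ∑ i, (∫ ζ, dbarC (χ i) ζ / (z - ζ)) * m (p i) := by
      rw [setIntegral_eq_integral_of_forall_compl_eq_zero
        (fun x hx => by simp [hmω, hR _ x hx])]
      simp_rw [← integral_mul_const]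
      rw [← integral_finset_sum _ (fun i _ => (hint1 i).mul_const _)]
      congr 1; ext ζ
      rw [hmω, Finset.sum_div]
      exact Finset.sum_congr rfl fun i _ => by ring
    rw [this, Finset.mul_sum]
    refine Finset.sum_congr rfl fun i _ => ?_
    rw [pompeiu (h i) (hc i), hcdef]
    have : (Real.pi : ℂ) ≠ 0 := by exact_mod_cast hpi.ne'
    field_simp
  rw [hma, hsum, ← mul_sub]
  have hmg : IntegrableOn (fun ζ => m (g ζ)) (ball 0 R) :=
    (((CharacterSpace.toCLM m) : 𝔅 →L[ℂ] ℂ).restrictScalars ℝ).integrable_comp hgi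
  have hmi : IntegrableOn (fun ζ => m (ω ζ) / (z - ζ)) (ball 0 R) := by
    have : Integrable (fun ζ => m (ω ζ) / (z - ζ)) := by
      have := integrable_finset_sum Finset.univ (fun i _ => (hint1 i).mul_const (m (p i)))
      refine this.congr ?_
      filter_upwards with ζ
      rw [hmω, Finset.sum_div]
      exact Finset.sum_congr rfl fun i _ => by ring
    exact this.integrableOn
  rw [← integral_sub hmg hmi, norm_mul, hcdef, norm_inv, Complex.norm_real,
    Real.norm_of_nonneg hpi.le, mul_assoc]
  gcongr
  have hb : ‖∫ ζ in ball (0:ℂ) R, (m (g ζ) - m (ω ζ) / (z - ζ))‖ ≤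
      ∫ ζ in ball (0:ℂ) R, (δ * ‖(1:𝔅)‖) * ‖z - ζ‖⁻¹ := by
    refine norm_integral_le_of_norm_le ((inv_norm_integrableOn z R).const_mul _) ?_
    apply ae_restrict_of_ae
    have hne : ∀ᵐ ζ : ℂ, ζ ≠ z := by
      simp [ae_iff]
    filter_upwards [hne] with ζ hζ
    have hζ' : z - ζ ≠ 0 := sub_ne_zero.2 hζ.symm
    have : m (g ζ) - m (ω ζ) / (z - ζ) = - e ζ * (z - ζ)⁻¹ := by
      simp only [he]; field_simp; ring
    rw [this, norm_mul, norm_neg, norm_inv]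
    gcongr
    exact heb ζ
  refine hb.trans ?_
  rw [integral_const_mul]
  calc _ ≤ δ * ‖(1:𝔅)‖ * J := by
        gcongr
        exact inv_norm_integral_le z R S hzS
    _ = _ := by ring

end fileA2

section fileA3
open Set Filter Topology Metric MeasureTheory

theorem cb_conv (n : ℕ) : ∑ kl ∈ Finset.HasAntidiagonal.antidiagonal n, ((kl.1.centralBinom : ℤ) * kl.2.centralBinom) = 4 ^ n := by
  classical
  set c : PowerSeries ℤ := PowerSeries.map (Nat.castRingHom ℤ) PowerSeries.catalanSeries with hc
  have h1 : c ^ 2 * PowerSeries.X + 1 = c := by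
    have := congrArg (PowerSeries.map (Nat.castRingHom ℤ)) PowerSeries.catalanSeries_sq_mul_X_add_one
    simpa [hc] using this
  set t := PowerSeries.X * c with ht
  have h2 : t = PowerSeries.X + t ^ 2 := by
    rw [ht]; nth_rewrite 1 [← h1]; ring
  set b := PowerSeries.derivative ℤ t with hb
  have h3 : b = 1 + 2 * t * b := by
    have := congrArg (PowerSeries.derivative ℤ) h2
    rw [map_add, PowerSeries.derivative_X, PowerSeries.derivative_pow] at this
    simp only [hb]; nth_rewrite 1 [this]; simp
  have h4 : (1 - 4 * PowerSeries.X) * b ^ 2 = 1 := by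
    have e1 : b * (1 - 2 * t) = 1 := by linear_combination h3
    have e2 : (1 - 2 * t) ^ 2 = 1 - 4 * PowerSeries.X := by linear_combination (-4) * h2
    rw [← e2]; linear_combination (b * (1 - 2 * t) + 1) * e1
  have h5 : (1 - 4 * PowerSeries.X) * PowerSeries.mk (fun n => (4:ℤ) ^ n) = 1 := by
    ext n
    rw [sub_mul, one_mul, mul_assoc, map_sub]
    rw [show (4 : PowerSeries ℤ) = PowerSeries.C 4 by simp, PowerSeries.coeff_C_mul]
    cases n with
    | zero => simp
    | succ n => simp [PowerSeries.coeff_succ_X_mul, PowerSeries.coeff_one, pow_succ]; ring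
  have h6 : b ^ 2 = PowerSeries.mk (fun n => (4:ℤ) ^ n) := by
    have hne : (1 - 4 * PowerSeries.X : PowerSeries ℤ) ≠ 0 := by
      intro h0; rw [h0, zero_mul] at h4; exact zero_ne_one h4
    exact mul_left_cancel₀ hne (h4.trans h5.symm)
  have h7 : ∀ k, PowerSeries.coeff k b = k.centralBinom := by
    intro k
    rw [hb, PowerSeries.coeff_derivative, ht, PowerSeries.coeff_succ_X_mul, hc,
      PowerSeries.coeff_map, PowerSeries.catalanSeries_coeff, ← succ_mul_catalan_eq_centralBinom]
    simp; ring
  have h8 := congrArg (PowerSeries.coeff n) h6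
  rw [sq, PowerSeries.coeff_mul, PowerSeries.coeff_mk] at h8
  simpa [h7] using h8

/-- truncated series for `1/sqrt(1+4y)` -/
def cbs {𝔅 : Type*} [Ring 𝔅] [Algebra ℂ 𝔅] (k : ℕ) (y : 𝔅) : 𝔅 :=
  ∑ j ∈ Finset.range k, ((-1) ^ j * (j.centralBinom : ℂ)) • y ^ j

def Gk {𝔅 : Type*} [Ring 𝔅] [Algebra ℂ 𝔅] (k : ℕ) (p : 𝔅) : 𝔅 :=
  (1/2 : ℂ) • (1 + (p + p - 1) * cbs k (p * p - p))

theorem map_Gk {𝔅 𝔅' : Type*} [Ring 𝔅] [Algebra ℂ 𝔅] [Ring 𝔅'] [Algebra ℂ 𝔅'] {F : Type*}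
    [FunLike F 𝔅 𝔅'] [AlgHomClass F ℂ 𝔅 𝔅'] (m : F) (k : ℕ) (p : 𝔅) : m (Gk k p) = Gk k (m p) := by
  simp [Gk, cbs, map_sum, map_smul, map_mul, map_add, map_sub, map_one, map_pow]

theorem idem_gen {𝔅 : Type*} [NormedCommRing 𝔅] [NormedAlgebra ℂ 𝔅] [CompleteSpace 𝔅] (p : 𝔅)
    (hs : Summable (fun j : ℕ => 4 ^ j * ‖(p * p - p) ^ j‖)) :
    ∃ e : 𝔅, e * e = e ∧ (∀ k, ‖Gk k p - e‖ ≤ ‖p + p - 1‖ * ∑' j : ℕ, 4 ^ (j + k) * ‖(p * p - p) ^ (j + k)‖) := by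
  set y := p * p - p with hy
  set f : ℕ → 𝔅 := fun j => ((-1) ^ j * (j.centralBinom : ℂ)) • y ^ j with hf
  have hfn : ∀ j, ‖f j‖ ≤ 4 ^ j * ‖y ^ j‖ := by
    intro j
    simp only [hf, norm_smul, norm_mul, norm_pow, norm_neg, norm_one, one_pow, one_mul]
    gcongr
    rw [Complex.norm_natCast]
    exact_mod_cast Nat.centralBinom_le_four_pow j
  have hfs : Summable (fun j => ‖f j‖) := Summable.of_nonneg_of_le (fun _ => norm_nonneg _) hfn hs
  set s := ∑' j, f j with hsdef
  have hss : s * s = ∑' n : ℕ, (-4 : ℂ) ^ n • y ^ n := by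
    rw [hsdef, tsum_mul_tsum_eq_tsum_sum_antidiagonal_of_summable_norm hfs hfs]
    congr 1; ext n
    have : ∀ kl ∈ Finset.HasAntidiagonal.antidiagonal n, f kl.1 * f kl.2 =
        ((-1 : ℂ) ^ n * ((kl.1.centralBinom : ℂ) * kl.2.centralBinom)) • y ^ n := by
      intro kl hkl
      have := Finset.HasAntidiagonal.mem_antidiagonal.1 hkl
      simp only [hf, smul_mul_smul_comm, ← pow_add, this]
      congr 1; rw [← this, pow_add]; ring
    rw [Finset.sum_congr rfl this, ← Finset.sum_smul, ← Finset.mul_sum]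
    have h2 : (∑ kl ∈ Finset.HasAntidiagonal.antidiagonal n, ((kl.1.centralBinom : ℂ) * kl.2.centralBinom)) = 4 ^ n := by
      exact_mod_cast cb_conv n
    rw [h2, ← mul_pow]; norm_num
  have hsum4 : Summable (fun n : ℕ => (-4 : ℂ) ^ n • y ^ n) := by
    apply Summable.of_norm
    refine hs.congr fun n => ?_
    simp [norm_smul]
  have hinv : (1 + (4:ℂ) • y) * (s * s) = 1 := by
    rw [hss, add_mul, one_mul]
    rw [← hsum4.tsum_mul_left]
    nth_rewrite 1 [hsum4.tsum_eq_zero_add]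
    have e : ∀ n : ℕ, ((4:ℂ) • y) * ((-4 : ℂ) ^ n • y ^ n) = -((-4 : ℂ) ^ (n + 1) • y ^ (n + 1)) := by
      intro n
      rw [smul_mul_smul_comm, ← pow_succ', ← neg_smul]; congr 1; ring
    simp_rw [e]
    rw [tsum_neg]; simp
  refine ⟨(1/2 : ℂ) • (1 + (p + p - 1) * s), ?_, fun k => ?_⟩
  · have hq : (p + p - 1) * (p + p - 1) = 1 + (4:ℂ) • y := by
      have : (4:ℂ) • y = y + y + y + y := by
        rw [show (4:ℂ) = 1 + 1 + 1 + 1 by norm_num]; simp [add_smul]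
      rw [this, hy]; ring
    have h1 : ((p + p - 1) * s) * ((p + p - 1) * s) = 1 := by
      calc _ = ((p + p - 1) * (p + p - 1)) * (s * s) := by ring
        _ = 1 := by rw [hq, hinv]
    rw [smul_mul_smul_comm, mul_add, add_mul, add_mul, h1]
    have : (1:𝔅) * 1 + (p + p - 1) * s * 1 + (1 * ((p + p - 1) * s) + 1) =
      (2:ℂ) • (1 + (p + p - 1) * s) := by
      rw [two_smul]; ring
    rw [this, smul_smul]; norm_num
  · have : Gk k p - (1/2 : ℂ) • (1 + (p + p - 1) * s) = (1/2:ℂ) • ((p + p - 1) * (cbs k y - s)) := by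
      rw [Gk, ← smul_sub]; congr 1; ring
    rw [this, norm_smul]
    have h2 : s - cbs k y = ∑' j, f (j + k) := by
      have := hfs.of_norm.sum_add_tsum_nat_add k
      rw [hsdef, ← this]; simp [cbs, hf]
    have h3 : ‖cbs k y - s‖ ≤ ∑' j : ℕ, 4 ^ (j + k) * ‖y ^ (j + k)‖ := by
      rw [norm_sub_rev, h2]
      refine tsum_of_norm_bounded (Summable.hasSum ?_) (fun j => hfn (j + k))
      exact (summable_nat_add_iff k).2 hs
    calc ‖(1/2:ℂ)‖ * ‖(p + p - 1) * (cbs k y - s)‖ ≤ 1 * (‖p + p - 1‖ * ‖cbs k y - s‖) := by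
          gcongr
          · norm_num
          · exact norm_mul_le _ _
      _ ≤ _ := by rw [one_mul]; gcongr

theorem idem_unif {𝔅 : Type*} [NormedCommRing 𝔅] [NormedAlgebra ℂ 𝔅] [CompleteSpace 𝔅] (p : 𝔅)
    (hp : ‖p * p - p‖ ≤ 1/8) :
    ∃ e : 𝔅, e * e = e ∧ ∀ k, 1 ≤ k → ‖Gk k p - e‖ ≤ ‖p + p - 1‖ * (2 * (1/2) ^ k) := by
  have hb : ∀ j : ℕ, 1 ≤ j → 4 ^ j * ‖(p * p - p) ^ j‖ ≤ (1/2 : ℝ) ^ j := by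
    intro j hj
    calc 4 ^ j * ‖(p * p - p) ^ j‖ ≤ 4 ^ j * (1/8) ^ j := by
          gcongr
          exact (norm_pow_le' _ hj).trans (by gcongr)
      _ = _ := by rw [← mul_pow]; norm_num
  have hs : Summable (fun j : ℕ => 4 ^ j * ‖(p * p - p) ^ j‖) := by
    rw [← summable_nat_add_iff 1]
    refine Summable.of_nonneg_of_le (fun _ => by positivity) (fun j => hb (j + 1) (by omega)) ?_
    exact (summable_nat_add_iff 1).2 (summable_geometric_of_lt_one (by norm_num) (by norm_num))
  obtain ⟨e, he, hk⟩ := idem_gen p hs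
  refine ⟨e, he, fun k hk1 => (hk k).trans ?_⟩
  gcongr
  have hg : Summable (fun j : ℕ => (1/2 : ℝ) ^ (j + k)) :=
    (summable_nat_add_iff k).2 (summable_geometric_of_lt_one (by norm_num) (by norm_num))
  calc _ ≤ ∑' j : ℕ, (1/2 : ℝ) ^ (j + k) :=
        Summable.tsum_le_tsum (fun j => hb _ (by omega)) ((summable_nat_add_iff k).2 hs) hg
    _ = 2 * (1/2) ^ k := by
        simp_rw [pow_add]
        rw [tsum_mul_right, tsum_geometric_of_lt_one (by norm_num) (by norm_num)]; norm_num

theorem Gk_complex (z : ℂ) (ε : ℂ) (hε : ε = 0 ∨ ε = 1) (hz : ‖z - ε‖ < 1/16) (k : ℕ) (hk : 1 ≤ k) :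
    ‖Gk k z - ε‖ ≤ 4 * (1/2) ^ k := by
  have hz1 : ‖z - 1‖ ≤ 17/16 := by
    rcases hε with rfl | rfl
    · calc ‖z - 1‖ ≤ ‖z‖ + ‖(1:ℂ)‖ := norm_sub_le _ _
        _ ≤ _ := by simp at hz ⊢; linarith
    · linarith
  have hz0 : ‖z‖ ≤ 17/16 := by
    rcases hε with rfl | rfl
    · simp at hz; linarith
    · calc ‖z‖ = ‖(z - 1) + 1‖ := by ring_nf
        _ ≤ ‖z - 1‖ + ‖(1:ℂ)‖ := norm_add_le _ _
        _ ≤ _ := by simp at hz ⊢; linarith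
  have hy : ‖z * z - z‖ ≤ 17/256 := by
    rw [show z * z - z = z * (z - 1) by ring, norm_mul]
    rcases hε with rfl | rfl
    · simp at hz
      nlinarith [norm_nonneg z, norm_nonneg (z - 1)]
    · nlinarith [norm_nonneg z, norm_nonneg (z - 1)]
  have h2 : ‖z + z - 1‖ ≤ 9/8 := by
    rcases hε with rfl | rfl
    · calc ‖z + z - 1‖ ≤ ‖z + z‖ + ‖(1:ℂ)‖ := norm_sub_le _ _
        _ ≤ ‖z‖ + ‖z‖ + 1 := by simpa using norm_add_le z z
        _ ≤ _ := by simp at hz; linarith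
    · calc ‖z + z - 1‖ = ‖((z - 1) + (z - 1)) + 1‖ := by ring_nf
        _ ≤ ‖(z - 1) + (z - 1)‖ + ‖(1:ℂ)‖ := norm_add_le _ _
        _ ≤ ‖z - 1‖ + ‖z - 1‖ + 1 := by simpa using norm_add_le (z - 1) (z - 1)
        _ ≤ _ := by linarith
  obtain ⟨e, he, hek⟩ := idem_unif z (hy.trans (by norm_num))
  have hee : e = ε := by
    have h3 := hek 3 (by norm_num)
    have h4 : ‖Gk 3 z - ε‖ ≤ 1/2 := by
      have : Gk 3 z - ε = (z - ε) + (1/2) * (z + z - 1) * ((z * z - z) * (-2 + 6 * (z * z - z))) := by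
        simp [Gk, cbs, Finset.sum_range_succ, Nat.centralBinom, Nat.choose]; ring
      rw [this]
      refine (norm_add_le _ _).trans ?_
      have h6 : ‖-2 + 6 * (z * z - z)‖ ≤ 2 + 6 * (17/256) := by
        refine (norm_add_le _ _).trans ?_
        rw [norm_mul]; simp
        linarith
      have : ‖(1/2:ℂ) * (z + z - 1) * ((z * z - z) * (-2 + 6 * (z * z - z)))‖ ≤ (1/2) * (9/8) * ((17/256) * (2 + 6 * (17/256))) := by
        rw [norm_mul, norm_mul, norm_mul]
        gcongr
        norm_num
      linarith
    have h5 : ‖e - ε‖ < 1 := by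
      calc ‖e - ε‖ = ‖(Gk 3 z - ε) - (Gk 3 z - e)‖ := by ring_nf
        _ ≤ ‖Gk 3 z - ε‖ + ‖Gk 3 z - e‖ := norm_sub_le _ _
        _ ≤ 1/2 + (9/8) * (2 * (1/2)^3) := by
          gcongr
          exact h3.trans (by gcongr)
        _ < 1 := by norm_num
    have h01 : e = 0 ∨ e = 1 := by
      have : e * (e - 1) = 0 := by rw [mul_sub, he]; ring
      rcases mul_eq_zero.1 this with h | h
      · exact Or.inl h
      · exact Or.inr (sub_eq_zero.1 h)
    rcases h01 with rfl | rfl <;> rcases hε with rfl | rfl <;> simp at h5 ⊢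
  subst hee
  refine (hek k hk).trans ?_
  have : (0:ℝ) ≤ (1/2) ^ k := by positivity
  nlinarith

/-- idempotents agreeing on characters agree -/
theorem idem_unique {𝔅 : Type*} [NormedCommRing 𝔅] [NormedAlgebra ℂ 𝔅] [CompleteSpace 𝔅] (e e' : 𝔅)
    (he : e * e = e) (he' : e' * e' = e') (h : ∀ m : WeakDual.characterSpace ℂ 𝔅, m e = m e') : e = e' := by
  have h1 : IsUnit (1 - (e - e') * (e - e')) := by
    by_contra hnu
    obtain ⟨m, hm⟩ := WeakDual.CharacterSpace.exists_apply_eq_zero hnu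
    simp [map_sub, map_mul, h m] at hm
  have h2 : (1 - (e - e') * (e - e')) * (e - e') = 0 := by
    have : (e - e') * (e - e') * (e - e') = e * e * e - 3 * (e * e) * e' + 3 * e * (e' * e') - e' * e' * e' := by
      ring
    rw [sub_mul, one_mul, this, he, he', he, he']; ring
  exact sub_eq_zero.1 ((h1.mul_right_eq_zero).1 h2)

end fileA3

section fileA4
open Set Filter Topology Metric MeasureTheory WeakDual
universe v

section quot
variable {𝔅 : Type v} [NormedCommRing 𝔅] [NormedAlgebra ℂ 𝔅] [CompleteSpace 𝔅]

def Jz (b : 𝔅) (ζ : ℂ) : Ideal 𝔅 := (Ideal.span {b - algebraMap ℂ 𝔅 ζ}).closure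

instance Jz_closed (b : 𝔅) (ζ : ℂ) : IsClosed (Jz b ζ : Set 𝔅) := by
  rw [Jz, Ideal.coe_closure]; exact isClosed_closure

abbrev mkz (b : 𝔅) (ζ : ℂ) (x : 𝔅) : 𝔅 ⧸ Jz b ζ := Ideal.Quotient.mk (Jz b ζ) x

instance mkz_complete (b : 𝔅) (ζ : ℂ) : CompleteSpace (𝔅 ⧸ Jz b ζ) :=
  Submodule.Quotient.completeSpace (Jz b ζ)

theorem mul_mem_Jz (b : 𝔅) (ζ : ℂ) (r : 𝔅) : (b - algebraMap ℂ 𝔅 ζ) * r ∈ Jz b ζ := by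
  apply Ideal.mul_mem_right
  rw [Jz]
  exact (subset_closure : ((Ideal.span {b - algebraMap ℂ 𝔅 ζ} : Ideal 𝔅) : Set 𝔅) ⊆ _)
    (Ideal.subset_span rfl)

theorem mkz_norm_le (b : 𝔅) (ζ : ℂ) (x : 𝔅) : ‖mkz b ζ x‖ ≤ ‖x‖ := Ideal.Quotient.norm_mk_le _ _

theorem mkz_lt_of {b : 𝔅} {ζ : ℂ} {x r : 𝔅} {δ : ℝ} (h : ‖x - (b - algebraMap ℂ 𝔅 ζ) * r‖ < δ) :
    ‖mkz b ζ x‖ < δ := by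
  have : mkz b ζ x = mkz b ζ (x - (b - algebraMap ℂ 𝔅 ζ) * r) := by
    rw [mkz, Ideal.Quotient.mk_eq_mk_iff_sub_mem]
    simpa using mul_mem_Jz b ζ r
  rw [this]
  exact (mkz_norm_le _ _ _).trans_lt h

theorem exists_of_mkz_lt {b : 𝔅} {ζ : ℂ} {x : 𝔅} {δ : ℝ} (h : ‖mkz b ζ x‖ < δ) :
    ∃ r, ‖x - (b - algebraMap ℂ 𝔅 ζ) * r‖ < δ := by
  obtain ⟨y, hy, hyn⟩ := Ideal.Quotient.norm_mk_lt (mkz b ζ x) (sub_pos.2 h)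
  have hy' : x - y ∈ Jz b ζ := by
    rw [← Ideal.Quotient.mk_eq_mk_iff_sub_mem]; exact hy.symm
  have hyd : ‖y‖ < δ := by linarith
  have hcl : x - y ∈ closure ((Ideal.span {b - algebraMap ℂ 𝔅 ζ} : Ideal 𝔅) : Set 𝔅) := hy'
  obtain ⟨w, hw, hwd⟩ := Metric.mem_closure_iff.1 hcl (δ - ‖y‖) (by linarith)
  obtain ⟨r, rfl⟩ := Ideal.mem_span_singleton'.1 hw
  refine ⟨r, ?_⟩
  rw [dist_eq_norm] at hwd
  calc ‖x - (b - algebraMap ℂ 𝔅 ζ) * r‖ = ‖(x - y - r * (b - algebraMap ℂ 𝔅 ζ)) + y‖ := by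
        congr 1; ring
    _ ≤ _ := norm_add_le _ _
    _ < δ := by linarith

def mkzA (b : 𝔅) (ζ : ℂ) : 𝔅 →ₐ[ℂ] 𝔅 ⧸ Jz b ζ := Ideal.Quotient.mkₐ ℂ (Jz b ζ)

theorem mkz_Gk (b : 𝔅) (ζ : ℂ) (k : ℕ) (p : 𝔅) : mkz b ζ (Gk k p) = Gk k (mkz b ζ p) :=
  map_Gk (mkzA b ζ) k p

theorem mkzA_continuous (b : 𝔅) (ζ : ℂ) : Continuous (mkzA b ζ) :=
  AddMonoidHomClass.continuous_of_bound (mkzA b ζ) 1 (fun x => by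
    rw [one_mul]; exact mkz_norm_le b ζ x)

theorem mkz_self (b : 𝔅) (ζ : ℂ) : mkz b ζ b = algebraMap ℂ (𝔅 ⧸ Jz b ζ) ζ := by
  have h : mkz b ζ (b - algebraMap ℂ 𝔅 ζ) = 0 := by
    rw [mkz, Ideal.Quotient.eq_zero_iff_mem]; simpa using mul_mem_Jz b ζ 1
  rw [mkz, map_sub, sub_eq_zero] at h
  exact h

/-- pull back a character of the fibre algebra -/
def pullc (b : 𝔅) (ζ : ℂ) (φ : characterSpace ℂ (𝔅 ⧸ Jz b ζ)) : characterSpace ℂ 𝔅 :=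
  CharacterSpace.equivAlgHom.symm ((CharacterSpace.toAlgHom φ).comp (mkzA b ζ))

theorem pullc_apply (b : 𝔅) (ζ : ℂ) (φ : characterSpace ℂ (𝔅 ⧸ Jz b ζ)) (x : 𝔅) :
    pullc b ζ φ x = φ (mkz b ζ x) := rfl

theorem char_algebraMap {𝔅 : Type*} [NormedCommRing 𝔅] [NormedAlgebra ℂ 𝔅] [CompleteSpace 𝔅]
    (m : characterSpace ℂ 𝔅) (ζ : ℂ) : m (algebraMap ℂ 𝔅 ζ) = ζ :=
  (CharacterSpace.toAlgHom m).commutes ζ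

theorem pullc_b (b : 𝔅) (ζ : ℂ) (φ : characterSpace ℂ (𝔅 ⧸ Jz b ζ)) : pullc b ζ φ b = ζ := by
  rw [pullc_apply, mkz_self, char_algebraMap]

theorem pullc_continuous (b : 𝔅) (ζ : ℂ) : Continuous (pullc b ζ) := by
  rw [continuous_induced_rng]
  apply WeakDual.continuous_of_continuous_eval
  intro x
  have : Continuous fun φ : characterSpace ℂ (𝔅 ⧸ Jz b ζ) => (φ : WeakDual ℂ (𝔅 ⧸ Jz b ζ)) (mkz b ζ x) :=
    (WeakDual.eval_continuous _).comp continuous_subtype_val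
  exact this

theorem exists_pullc (b : 𝔅) (ζ : ℂ) (m : characterSpace ℂ 𝔅) (hm : m b = ζ) :
    ∃ φ : characterSpace ℂ (𝔅 ⧸ Jz b ζ), pullc b ζ φ = m := by
  have hcm : Continuous m := map_continuous m
  have hk : ∀ x ∈ Jz b ζ, CharacterSpace.toAlgHom m x = 0 := by
    intro x hx
    have hcl : IsClosed {x : 𝔅 | m x = 0} := isClosed_eq hcm continuous_const
    have : closure ((Ideal.span {b - algebraMap ℂ 𝔅 ζ} : Ideal 𝔅) : Set 𝔅) ⊆ {x : 𝔅 | m x = 0} := by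
      apply hcl.closure_subset_iff.2
      intro w hw
      obtain ⟨r, rfl⟩ := Ideal.mem_span_singleton'.1 hw
      simp [map_mul, map_sub, char_algebraMap, hm]
    exact this hx
  refine ⟨CharacterSpace.equivAlgHom.symm (Ideal.Quotient.liftₐ (Jz b ζ) (CharacterSpace.toAlgHom m) hk), ?_⟩
  apply CharacterSpace.ext
  intro x
  rfl

theorem mkz_trivial (b : 𝔅) (ζ : ℂ) (h : ∀ m : characterSpace ℂ 𝔅, m b ≠ ζ) (x : 𝔅) : mkz b ζ x = 0 := by
  have hu : IsUnit (b - algebraMap ℂ 𝔅 ζ) := by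
    by_contra hnu
    obtain ⟨m, hm⟩ := CharacterSpace.exists_apply_eq_zero hnu
    rw [map_sub, char_algebraMap] at hm
    exact h m (sub_eq_zero.1 hm)
  rw [mkz, Ideal.Quotient.eq_zero_iff_mem]
  obtain ⟨w, hw⟩ := hu.exists_right_inv
  have := mul_mem_Jz b ζ (w * x)
  rwa [← mul_assoc, hw, one_mul] at this

theorem gl_thm (b : 𝔅) {ι : Type*} [Fintype ι] (χ : ι → ℂ → ℝ) (V : ι → Set ℂ) (R : ℝ)
    (hbR : ‖b‖ * ‖(1:𝔅)‖ < R)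
    (h : ∀ i, ContDiff ℝ 1 (χ i)) (hc : ∀ i, HasCompactSupport (χ i))
    (hV : ∀ i, tsupport (χ i) ⊆ V i) (hsum : ∀ ζ ∈ ball (0:ℂ) R, ∑ i, χ i ζ = 1) :
    ∃ C : ℝ, 0 ≤ C ∧ ∀ (p : ι → 𝔅) (ε : ℝ), 0 < ε →
      (∀ i j, ∀ ζ ∈ V i, ζ ∈ V j → ‖mkz b ζ (p i - p j)‖ ≤ ε) →
      ∃ a : 𝔅, ∀ m : characterSpace ℂ 𝔅, ‖m a - ∑ i, (χ i (m b) : ℂ) * m (p i)‖ ≤ C * ε := by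
  set X : ι → ℂ → ℂ := fun i ζ => (χ i ζ : ℂ) with hX
  have hXd : ∀ i, ContDiff ℝ 1 (X i) := fun i => Complex.ofRealCLM.contDiff.comp (h i)
  have hXc : ∀ i, HasCompactSupport (X i) := fun i => (hc i).comp_left (g := fun x : ℝ => (x:ℂ)) (by simp)
  have hXV : ∀ i ζ, dbarC (X i) ζ ≠ 0 → ζ ∈ V i := by
    intro i ζ hne
    apply hV i
    have h1 : ζ ∈ tsupport (X i) := by
      apply tsupport_fderiv_subset ℝ (subset_tsupport _ ?_)
      intro h0; exact hne (by simp [dbarC, h0])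
    refine closure_mono ?_ h1
    intro w hw; simpa [hX] using hw
  obtain ⟨C, hC0, hC⟩ := gl_core b X hXd hXc
  have hcd : ∀ i, Continuous (dbarC (X i)) := fun i => dbarC_continuous (hXd i)
  have hD : ∀ i, ∃ D, ∀ ζ, ‖dbarC (X i) ζ‖ ≤ D := by
    intro i
    have : HasCompactSupport (dbarC (X i)) := by
      refine HasCompactSupport.intro (hXc i).isCompact ?_
      intro ζ hζ
      have : fderiv ℝ (X i) ζ = 0 := by
        by_contra hne
        exact hζ (tsupport_fderiv_subset ℝ (subset_tsupport _ hne))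
      simp [dbarC, this]
    exact (hcd i).bounded_above_of_compact_support this
  choose D hD using hD
  have hD0 : ∀ i, 0 ≤ D i := fun i => (norm_nonneg _).trans (hD i 0)
  have hDs : 0 ≤ ∑ i, D i := Finset.sum_nonneg fun i _ => hD0 i
  refine ⟨C * (∑ i, D i + 1), by positivity, fun p ε hε hp => ?_⟩
  rw [mul_assoc]
  refine hC p ((∑ i, D i + 1) * ε) (by positivity) fun ζ => ?_
  apply exists_of_mkz_lt
  by_cases hζ : ζ ∈ ball (0:ℂ) R
  · have hs0 : ∑ i, dbarC (X i) ζ = 0 := by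
      have hev : (fun w => ∑ i, X i w) =ᶠ[𝓝 ζ] fun _ => (1:ℂ) := by
        filter_upwards [isOpen_ball.mem_nhds hζ] with w hw
        have := hsum w hw
        simp only [hX]; exact_mod_cast this
      have hfd : fderiv ℝ (fun w => ∑ i, X i w) ζ = ∑ i, fderiv ℝ (X i) ζ :=
        fderiv_fun_sum fun i _ => ((hXd i).differentiable (by norm_num)) ζ
      rw [hev.fderiv_eq] at hfd
      simp only [fderiv_fun_const, Pi.zero_apply] at hfd
      simp only [dbarC]
      rw [← Finset.mul_sum, Finset.sum_add_distrib, ← Finset.mul_sum]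
      have a1 : ∀ w : ℂ, ∑ i, fderiv ℝ (X i) ζ w = 0 := by
        intro w
        have := congrArg (fun T : ℂ →L[ℝ] ℂ => T w) hfd
        simpa using this.symm
      rw [a1, a1]; simp
    obtain ⟨i0, hi0⟩ : ∃ i0, χ i0 ζ ≠ 0 := by
      by_contra hno
      push Not at hno
      have := hsum ζ hζ
      simp [hno] at this
    have hζV : ζ ∈ V i0 := hV i0 (subset_tsupport _ hi0)
    have e : ∑ i, dbarC (X i) ζ • p i = ∑ i, dbarC (X i) ζ • (p i - p i0) := by
      simp_rw [smul_sub]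
      rw [Finset.sum_sub_distrib, ← Finset.sum_smul, hs0]; simp
    rw [e]
    have e2 : mkz b ζ (∑ i, dbarC (X i) ζ • (p i - p i0)) = ∑ i, dbarC (X i) ζ • mkz b ζ (p i - p i0) := by
      have := map_sum (mkzA b ζ) (fun i => dbarC (X i) ζ • (p i - p i0)) Finset.univ
      simp only [map_smul] at this
      exact this
    rw [e2]
    calc _ ≤ ∑ i, ‖dbarC (X i) ζ • mkz b ζ (p i - p i0)‖ := norm_sum_le _ _
      _ ≤ ∑ i, D i * ε := by
        refine Finset.sum_le_sum fun i _ => ?_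
        by_cases h0 : dbarC (X i) ζ = 0
        · rw [h0, zero_smul, norm_zero]; exact mul_nonneg (hD0 i) hε.le
        · rw [norm_smul]
          exact mul_le_mul (hD i ζ) (hp i i0 ζ (hXV i ζ h0) hζV) (norm_nonneg _) (hD0 i)
      _ < _ := by rw [← Finset.sum_mul]; nlinarith
  · rw [mkz_trivial]
    · rw [norm_zero]; positivity
    · rintro m rfl
      apply hζ
      simpa using (char_bound m b).trans_lt hbR

theorem char_closed_image (b : 𝔅) : Continuous fun m : characterSpace ℂ 𝔅 => m b :=
  (WeakDual.eval_continuous _).comp continuous_subtype_val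

open Classical in
def ind {M : Type*} (U : Set M) (m : M) : ℂ := if m ∈ U then 1 else 0

theorem ind_cases {M : Type*} (U : Set M) (m : M) : ind U m = 0 ∨ ind U m = 1 := by
  unfold ind; split_ifs <;> simp

/-- `p` is good at `ζ` -/
def GoodAt (b : 𝔅) (U : Set (characterSpace ℂ 𝔅)) (p : 𝔅) (ζ : ℂ) : Prop :=
  ‖mkz b ζ (p * p - p)‖ ≤ 1/8 ∧ ∀ m : characterSpace ℂ 𝔅, m b = ζ → ‖m p - ind U m‖ < 1/16

def FibClopen (b : 𝔅) (U : Set (characterSpace ℂ 𝔅)) (ζ : ℂ) : Prop :=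
  ∀ m : characterSpace ℂ 𝔅, m b = ζ → m ∈ interior U ∨ m ∈ interior Uᶜ

theorem good_nhds (b : 𝔅) (U : Set (characterSpace ℂ 𝔅)) (p : 𝔅) (ζ : ℂ) (hf : FibClopen b U ζ)
    (h1 : mkz b ζ (p * p - p) = 0) (h2 : ∀ m : characterSpace ℂ 𝔅, m b = ζ → m p = ind U m) :
    ∃ r > 0, ∀ ζ' ∈ ball ζ r, GoodAt b U p ζ' := by
  obtain ⟨y, hy⟩ := exists_of_mkz_lt (b := b) (ζ := ζ) (x := p * p - p) (δ := 1/8) (by rw [h1]; norm_num)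
  have hev1 : ∀ᶠ ζ' in 𝓝 ζ, ‖mkz b ζ' (p * p - p)‖ < 1/8 := by
    have hc : Continuous fun ζ' => ‖p * p - p - (b - algebraMap ℂ 𝔅 ζ') * y‖ := by
      have : Continuous (algebraMap ℂ 𝔅) := continuous_algebraMap ℂ 𝔅
      fun_prop
    filter_upwards [hc.continuousAt.eventually_lt continuousAt_const hy] with ζ' h'
    exact mkz_lt_of h'
  set O : Set (characterSpace ℂ 𝔅) := (interior U ∩ {m | ‖m p - 1‖ < 1/16}) ∪
    (interior Uᶜ ∩ {m | ‖m p - 0‖ < 1/16}) with hO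
  have hOo : IsOpen O := by
    have hc := char_closed_image p
    refine (isOpen_interior.inter ?_).union (isOpen_interior.inter ?_)
    · exact isOpen_lt (hc.sub continuous_const).norm continuous_const
    · exact isOpen_lt (hc.sub continuous_const).norm continuous_const
  have hK : IsCompact ((fun m : characterSpace ℂ 𝔅 => m b) '' Oᶜ) :=
    hOo.isClosed_compl.isCompact.image (char_closed_image b)
  have hζ : ζ ∉ (fun m : characterSpace ℂ 𝔅 => m b) '' Oᶜ := by
    rintro ⟨m, hm, hmb⟩
    apply hm
    have := h2 m hmb
    rcases hf m hmb with h | h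
    · left; refine ⟨h, ?_⟩
      have : m p = 1 := by rw [this]; simp [ind, interior_subset h]
      simp [this]
    · right; refine ⟨h, ?_⟩
      have : m p = 0 := by rw [this]; simp [ind]; exact interior_subset h
      simp [this]
  have hev2 : ∀ᶠ ζ' in 𝓝 ζ, ζ' ∉ (fun m : characterSpace ℂ 𝔅 => m b) '' Oᶜ :=
    hK.isClosed.isOpen_compl.mem_nhds hζ
  obtain ⟨r, hr, hb⟩ := Metric.eventually_nhds_iff_ball.1 (hev1.and hev2)
  refine ⟨r, hr, fun ζ' hζ' => ⟨(hb ζ' hζ').1.le, fun m hm => ?_⟩⟩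
  have hmO : m ∈ O := by
    by_contra hno; exact (hb ζ' hζ').2 ⟨m, hno, hm⟩
  rcases hmO with ⟨h, h'⟩ | ⟨h, h'⟩
  · have : ind U m = 1 := by simp [ind, interior_subset h]
    rw [this]; exact h'
  · have : ind U m = 0 := by simp [ind]; exact interior_subset h
    rw [this]; exact h'

theorem good_diff (b : 𝔅) (U : Set (characterSpace ℂ 𝔅)) (p : 𝔅) (ζ : ℂ) (h : GoodAt b U p ζ) :
    ∃ e : 𝔅 ⧸ Jz b ζ, e * e = e ∧ (∀ k, 1 ≤ k → ‖mkz b ζ (Gk k p) - e‖ ≤ ‖p + p - 1‖ * (2 * (1/2) ^ k)) ∧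
      ∀ φ : characterSpace ℂ (𝔅 ⧸ Jz b ζ), φ e = ind U (pullc b ζ φ) := by
  obtain ⟨e, he, hk⟩ := idem_unif (mkz b ζ p) (by
    have := h.1
    rwa [mkz, map_sub, map_mul] at this)
  have hk' : ∀ k, 1 ≤ k → ‖mkz b ζ (Gk k p) - e‖ ≤ ‖p + p - 1‖ * (2 * (1/2) ^ k) := by
    intro k h1
    rw [mkz_Gk]
    refine (hk k h1).trans ?_
    gcongr
    have := mkz_norm_le b ζ (p + p - 1)
    rwa [mkz, map_sub, map_add, map_one] at this
  refine ⟨e, he, hk', fun φ => ?_⟩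
  have hp2 : Tendsto (fun k : ℕ => (1/2 : ℝ) ^ k) atTop (𝓝 0) :=
    tendsto_pow_atTop_nhds_zero_of_lt_one (by norm_num) (by norm_num)
  have t1 : Tendsto (fun k => φ (mkz b ζ (Gk k p))) atTop (𝓝 (φ e)) := by
    refine ((map_continuous φ).tendsto e).comp ?_
    rw [tendsto_iff_norm_sub_tendsto_zero]
    refine squeeze_zero' (Eventually.of_forall fun _ => norm_nonneg _)
      (eventually_atTop.2 ⟨1, hk'⟩) ?_
    simpa using (hp2.const_mul 2).const_mul ‖p + p - 1‖
  have t2 : Tendsto (fun k => φ (mkz b ζ (Gk k p))) atTop (𝓝 (ind U (pullc b ζ φ))) := by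
    rw [tendsto_iff_norm_sub_tendsto_zero]
    refine squeeze_zero' (Eventually.of_forall fun _ => norm_nonneg _)
      (eventually_atTop.2 ⟨1, fun k h1 => ?_⟩)
      (show Tendsto (fun k : ℕ => 4 * (1/2 : ℝ) ^ k) atTop (𝓝 0) by simpa using hp2.const_mul 4)
    rw [mkz_Gk, map_Gk φ]
    exact Gk_complex _ _ (ind_cases _ _) (h.2 (pullc b ζ φ) (pullc_b b ζ φ)) k h1
  exact tendsto_nhds_unique t1 t2

end quot

end fileA4

section fileA5
open Set Filter Topology Metric MeasureTheory WeakDual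
universe v

section patch
variable {𝔅 : Type v} [NormedCommRing 𝔅] [NormedAlgebra ℂ 𝔅] [CompleteSpace 𝔅]

theorem smooth_part {ι : Type} [Fintype ι] (V : ι → Set ℂ) (hV : ∀ i, IsOpen (V i)) (R : ℝ)
    (hcov : closedBall (0:ℂ) R ⊆ ⋃ i, V i) :
    ∃ χ : ι → ℂ → ℝ, (∀ i, ContDiff ℝ 1 (χ i)) ∧ (∀ i, HasCompactSupport (χ i)) ∧
      (∀ i, tsupport (χ i) ⊆ V i) ∧ (∀ ζ ∈ ball (0:ℂ) R, ∑ i, χ i ζ = 1) ∧ ∀ i ζ, 0 ≤ χ i ζ := by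
  obtain ⟨f, hf⟩ := SmoothPartitionOfUnity.exists_isSubordinate (modelWithCornersSelf ℝ ℂ)
    (s := closedBall (0:ℂ) R) isClosed_closedBall (fun i => V i ∩ ball 0 (R + 1))
    (fun i => (hV i).inter isOpen_ball) (by
      intro z hz
      obtain ⟨i, hi⟩ := mem_iUnion.1 (hcov hz)
      refine mem_iUnion.2 ⟨i, hi, ?_⟩
      simp at hz ⊢; linarith)
  refine ⟨fun i => f i, fun i => ?_, fun i => ?_, fun i => (hf i).trans inter_subset_left, ?_, fun i ζ => f.nonneg i ζ⟩
  · exact ((f i).contMDiff.contDiff).of_le (by exact_mod_cast le_top)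
  · apply IsCompact.of_isClosed_subset (isCompact_closedBall (0:ℂ) (R + 1)) (isClosed_tsupport _)
    exact ((hf i).trans inter_subset_right).trans ball_subset_closedBall
  · intro ζ hζ
    have := f.sum_eq_one (ball_subset_closedBall hζ)
    rwa [finsum_eq_sum_of_fintype] at this

theorem patch (b : 𝔅) (U : Set (characterSpace ℂ 𝔅)) (V0 : Set ℂ) (hV0 : IsOpen V0)
    (hgood : ∀ ζ, ζ ∉ V0 → ∃ p, ∃ r > 0, ∀ ζ' ∈ ball ζ r, GoodAt b U p ζ') :
    ∃ (χ0 : ℂ → ℝ) (C : ℝ), 0 ≤ C ∧ (∀ ζ ∉ V0, χ0 ζ = 0) ∧ (∀ ζ, 0 ≤ χ0 ζ) ∧ ∀ (x : 𝔅) (ε : ℝ), 0 < ε →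
      (∀ ζ ∈ V0, ‖mkz b ζ x‖ ≤ ε) →
      ∃ Q : 𝔅, ∀ m : characterSpace ℂ 𝔅, ‖m Q - (1 - χ0 (m b)) * ind U m * m x‖ ≤ C * ε := by
  classical
  set R := ‖b‖ * ‖(1:𝔅)‖ + 1 with hR
  choose! p r hr hg using hgood
  have hcomp : IsCompact (closedBall (0:ℂ) R \ V0) := (ProperSpace.isCompact_closedBall _ _).diff hV0
  obtain ⟨t, htS, htc⟩ := hcomp.elim_nhds_subcover (fun ζ => ball ζ (r ζ))
    (fun ζ hζ => ball_mem_nhds ζ (hr ζ hζ.2))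
  set V : Option t → Set ℂ := fun o => o.elim V0 (fun ζ => ball (ζ:ℂ) (r ζ)) with hV
  have hVo : ∀ i, IsOpen (V i) := by
    rintro (_ | i)
    · exact hV0
    · exact isOpen_ball
  have hcov : closedBall (0:ℂ) R ⊆ ⋃ i, V i := by
    intro z hz
    by_cases h0 : z ∈ V0
    · exact mem_iUnion.2 ⟨none, h0⟩
    · obtain ⟨ζ, hζ, hz'⟩ := mem_iUnion₂.1 (htc ⟨hz, h0⟩)
      exact mem_iUnion.2 ⟨some ⟨ζ, hζ⟩, hz'⟩
  obtain ⟨χ, hχd, hχc, hχV, hχs, hχ0⟩ := smooth_part V hVo R hcov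
  obtain ⟨C, hC0, hC⟩ := gl_thm b χ V R (by rw [hR]; linarith) hχd hχc hχV hχs
  have hgt : ∀ i : t, ∀ ζ ∈ V (some i), GoodAt b U (p i) ζ := fun i ζ hζ => hg i (htS i i.2).2 ζ hζ
  set D : ℝ := ∑ i : t, ‖p i + p i - 1‖ with hD
  have hDi : ∀ i : t, ‖p i + p i - 1‖ ≤ D := fun i =>
    Finset.single_le_sum (f := fun i : t => ‖p i + p i - 1‖) (fun _ _ => norm_nonneg _) (Finset.mem_univ i)
  have hD0 : 0 ≤ D := Finset.sum_nonneg fun _ _ => norm_nonneg _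
  set B : ℝ := ∑ i : t, ‖Gk 1 (p i)‖ + 2 * D + 1 with hB
  have hBi : ∀ i : t, ‖Gk 1 (p i)‖ + 2 * D ≤ B := fun i => by
    have := Finset.single_le_sum (f := fun i : t => ‖Gk 1 (p i)‖) (fun _ _ => norm_nonneg _) (Finset.mem_univ i)
    rw [hB]; linarith
  have hB1 : 1 ≤ B := by
    have : 0 ≤ ∑ i : t, ‖Gk 1 (p i)‖ := Finset.sum_nonneg fun _ _ => norm_nonneg _
    rw [hB]; linarith
  refine ⟨χ none, C * B + 1, by positivity, ?_, hχ0 none, fun x ε hε hx => ?_⟩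
  · intro ζ hζ
    by_contra hne
    exact hζ (hχV none (subset_tsupport _ hne))
  obtain ⟨k, hk1, hk2, hk3⟩ : ∃ k : ℕ, 1 ≤ k ∧ D * (4 * (1/2) ^ k) * ‖x‖ ≤ ε ∧
      4 * (1/2) ^ k * (‖x‖ * ‖(1:𝔅)‖) ≤ ε := by
    have hp2 : Tendsto (fun k : ℕ => (1/2 : ℝ) ^ k) atTop (𝓝 0) :=
      tendsto_pow_atTop_nhds_zero_of_lt_one (by norm_num) (by norm_num)
    have a1 : ∀ᶠ k : ℕ in atTop, D * (4 * (1/2) ^ k) * ‖x‖ < ε := by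
      have : Tendsto (fun k : ℕ => D * (4 * (1/2 : ℝ) ^ k) * ‖x‖) atTop (𝓝 (D * (4 * 0) * ‖x‖)) :=
        ((hp2.const_mul 4).const_mul D).mul_const _
      exact this.eventually_lt_const (by simpa using hε)
    have a2 : ∀ᶠ k : ℕ in atTop, 4 * (1/2) ^ k * (‖x‖ * ‖(1:𝔅)‖) < ε := by
      have : Tendsto (fun k : ℕ => 4 * (1/2 : ℝ) ^ k * (‖x‖ * ‖(1:𝔅)‖)) atTop (𝓝 (4 * 0 * (‖x‖ * ‖(1:𝔅)‖))) :=
        (hp2.const_mul 4).mul_const _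
      exact this.eventually_lt_const (by simpa using hε)
    obtain ⟨k, h1, h2, h3⟩ := ((eventually_ge_atTop 1).and (a1.and a2)).exists
    exact ⟨k, h1, h2.le, h3.le⟩
  set P : Option t → 𝔅 := fun o => o.elim 0 (fun i => Gk k (p i) * x) with hP
  have hpow : (0:ℝ) ≤ (1/2) ^ k := by positivity
  have hsome_none : ∀ (i : t) (ζ : ℂ), ζ ∈ V (some i) → ζ ∈ V0 → ‖mkz b ζ (Gk k (p i) * x)‖ ≤ B * ε := by
    intro i ζ hζ hζ0
    obtain ⟨e, -, he, -⟩ := good_diff b U (p i) ζ (hgt i ζ hζ)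
    have h1 := he 1 le_rfl
    have hkk := he k hk1
    have hle : (1/2:ℝ)^k ≤ 1/2 := by
      simpa using pow_le_pow_of_le_one (by norm_num : (0:ℝ) ≤ 1/2) (by norm_num) hk1
    have hn : ‖mkz b ζ (Gk k (p i))‖ ≤ B := by
      calc ‖mkz b ζ (Gk k (p i))‖ = ‖(mkz b ζ (Gk k (p i)) - e) - (mkz b ζ (Gk 1 (p i)) - e) + mkz b ζ (Gk 1 (p i))‖ := by
            congr 1; ring
        _ ≤ ‖(mkz b ζ (Gk k (p i)) - e) - (mkz b ζ (Gk 1 (p i)) - e)‖ + ‖mkz b ζ (Gk 1 (p i))‖ := norm_add_le _ _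
        _ ≤ ‖mkz b ζ (Gk k (p i)) - e‖ + ‖mkz b ζ (Gk 1 (p i)) - e‖ + ‖Gk 1 (p i)‖ := by
            gcongr
            · exact norm_sub_le _ _
            · exact mkz_norm_le _ _ _
        _ ≤ D + D + ‖Gk 1 (p i)‖ := by
            gcongr
            · exact hkk.trans (by nlinarith [hDi i, norm_nonneg (p i + p i - 1)])
            · exact h1.trans (by nlinarith [hDi i, norm_nonneg (p i + p i - 1)])
        _ ≤ B := by linarith [hBi i]
    rw [mkz, map_mul]
    calc _ ≤ ‖mkz b ζ (Gk k (p i))‖ * ‖mkz b ζ x‖ := norm_mul_le _ _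
      _ ≤ B * ε := by gcongr; exact hx ζ hζ0
  obtain ⟨Q, hQ⟩ := hC P (B * ε) (by positivity) (by
    rintro (_ | i) (_ | j) ζ hi hj
    · simp [hP]; positivity
    · have := hsome_none j ζ hj hi
      simp only [hP, Option.elim]
      rw [zero_sub, mkz, map_neg, norm_neg]; exact this
    · have := hsome_none i ζ hi hj
      simp only [hP, Option.elim]
      rwa [sub_zero]
    · simp only [hP, Option.elim]
      rw [← sub_mul, mkz, map_mul]
      obtain ⟨e, he1, he2, he3⟩ := good_diff b U (p i) ζ (hgt i ζ hi)
      obtain ⟨e', he1', he2', he3'⟩ := good_diff b U (p j) ζ (hgt j ζ hj)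
      have hee : e = e' := idem_unique e e' he1 he1' (fun φ => by rw [he3, he3'])
      subst hee
      have hn : ‖mkz b ζ (Gk k (p i) - Gk k (p j))‖ ≤ D * (4 * (1/2) ^ k) := by
        calc _ = ‖(mkz b ζ (Gk k (p i)) - e) - (mkz b ζ (Gk k (p j)) - e)‖ := by
              rw [mkz, map_sub]; congr 1; ring
          _ ≤ ‖mkz b ζ (Gk k (p i)) - e‖ + ‖mkz b ζ (Gk k (p j)) - e‖ := norm_sub_le _ _
          _ ≤ D * (2 * (1/2) ^ k) + D * (2 * (1/2) ^ k) := by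
              gcongr
              · exact (he2 k hk1).trans (by gcongr; exact hDi i)
              · exact (he2' k hk1).trans (by gcongr; exact hDi j)
          _ = _ := by ring
      calc _ ≤ ‖mkz b ζ (Gk k (p i) - Gk k (p j))‖ * ‖mkz b ζ x‖ := norm_mul_le _ _
        _ ≤ D * (4 * (1/2) ^ k) * ‖x‖ := by gcongr; exact mkz_norm_le _ _ _
        _ ≤ ε := hk2
        _ ≤ B * ε := by nlinarith)
  refine ⟨Q, fun m => ?_⟩
  have hmb : m b ∈ ball (0:ℂ) R := by
    have := char_bound m b
    rw [mem_ball_zero_iff, hR]; linarith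
  have hs := hχs (m b) hmb
  rw [Fintype.sum_option] at hs
  have hss : (1 - (χ none (m b) : ℂ)) = ∑ i : t, (χ (some i) (m b) : ℂ) := by
    rw [← Complex.ofReal_one, ← hs]; push_cast; ring
  have hQm := hQ m
  rw [Fintype.sum_option] at hQm
  simp only [hP, Option.elim, map_zero, mul_zero, zero_add] at hQm
  have hle1 : ∑ i : t, χ (some i) (m b) ≤ 1 := by linarith [hχ0 none (m b)]
  have h2 : ‖∑ i : t, (χ (some i) (m b) : ℂ) * m (Gk k (p i) * x) - (1 - (χ none (m b) : ℂ)) * ind U m * m x‖ ≤ ε := by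
    rw [hss, Finset.sum_mul, Finset.sum_mul, ← Finset.sum_sub_distrib]
    calc _ ≤ ∑ i : t, ‖(χ (some i) (m b) : ℂ) * m (Gk k (p i) * x) - (χ (some i) (m b) : ℂ) * ind U m * m x‖ := norm_sum_le _ _
      _ ≤ ∑ i : t, χ (some i) (m b) * (4 * (1/2) ^ k * (‖x‖ * ‖(1:𝔅)‖)) := by
        refine Finset.sum_le_sum fun i _ => ?_
        by_cases h0 : χ (some i) (m b) = 0
        · simp [h0]
        · have hmem : m b ∈ V (some i) := hχV (some i) (subset_tsupport _ h0)
          have := Gk_complex (m (p i)) _ (ind_cases U m) ((hgt i _ hmem).2 m rfl) k hk1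
          rw [map_mul, map_Gk m]
          rw [show (χ (some i) (m b) : ℂ) * (Gk k (m (p i)) * m x) - (χ (some i) (m b) : ℂ) * ind U m * m x =
            (χ (some i) (m b) : ℂ) * ((Gk k (m (p i)) - ind U m) * m x) by ring, norm_mul, norm_mul,
            Complex.norm_real, Real.norm_of_nonneg (hχ0 _ _)]
          gcongr
          · exact hχ0 _ _
          · exact char_bound m x
      _ ≤ 1 * ε := by
        rw [← Finset.sum_mul]
        exact mul_le_mul hle1 hk3 (by positivity) zero_le_one
      _ = ε := one_mul _
  calc ‖m Q - (1 - (χ none (m b) : ℂ)) * ind U m * m x‖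
      = ‖(m Q - ∑ i : t, (χ (some i) (m b) : ℂ) * m (Gk k (p i) * x)) + (∑ i : t, (χ (some i) (m b) : ℂ) * m (Gk k (p i) * x) - (1 - (χ none (m b) : ℂ)) * ind U m * m x)‖ := by
        congr 1; ring
    _ ≤ C * (B * ε) + ε := (norm_add_le _ _).trans (add_le_add hQm h2)
    _ = _ := by ring

theorem fiber_good (b : 𝔅) (U : Set (characterSpace ℂ 𝔅)) (ζ : ℂ) (hf : FibClopen b U ζ)
    (hsh : ∀ U' : Set (characterSpace ℂ (𝔅 ⧸ Jz b ζ)), IsClopen U' → U' = pullc b ζ ⁻¹' U →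
      ∃ e : 𝔅 ⧸ Jz b ζ, e * e = e ∧ ∀ φ : characterSpace ℂ (𝔅 ⧸ Jz b ζ), φ e = ind U' φ) :
    ∃ p, ∃ r > 0, ∀ ζ' ∈ ball ζ r, GoodAt b U p ζ' := by
  have hcl : IsClopen (pullc b ζ ⁻¹' U) := by
    constructor
    · rw [← isOpen_compl_iff, ← preimage_compl]
      have : pullc b ζ ⁻¹' Uᶜ = pullc b ζ ⁻¹' (interior Uᶜ) := by
        ext φ
        refine ⟨fun h => ?_, fun h => interior_subset (s := Uᶜ) h⟩
        exact (hf _ (pullc_b b ζ φ)).resolve_left (fun h' => h (interior_subset h'))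
      rw [this]; exact isOpen_interior.preimage (pullc_continuous b ζ)
    · have : pullc b ζ ⁻¹' U = pullc b ζ ⁻¹' (interior U) := by
        ext φ
        refine ⟨fun h => ?_, fun h => interior_subset (s := U) h⟩
        exact (hf _ (pullc_b b ζ φ)).resolve_right (fun h' => interior_subset h' h)
      rw [this]; exact isOpen_interior.preimage (pullc_continuous b ζ)
  obtain ⟨e, he, hφ⟩ := hsh _ hcl rfl
  obtain ⟨p, rfl⟩ := Ideal.Quotient.mk_surjective e
  refine ⟨p, good_nhds b U p ζ hf ?_ fun m hm => ?_⟩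
  · rw [mkz, map_sub, map_mul, he, sub_self]
  · obtain ⟨φ, rfl⟩ := exists_pullc b ζ m hm
    rw [pullc_apply]; exact hφ φ

theorem idem_spec (Q : 𝔅) (U : Set (characterSpace ℂ 𝔅))
    (h : ∀ m : characterSpace ℂ 𝔅, ‖m Q - ind U m‖ < 1/16) :
    ∃ e : 𝔅, e * e = e ∧ ∀ m : characterSpace ℂ 𝔅, m e = ind U m := by
  set y := Q * Q - Q with hy
  have hmy : ∀ m : characterSpace ℂ 𝔅, ‖m y‖ < 1/8 := by
    intro m
    have h1 := h m
    rw [hy, map_sub, map_mul]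
    rw [show m Q * m Q - m Q = m Q * (m Q - 1) by ring, norm_mul]
    rcases ind_cases U m with h0 | h0 <;> rw [h0] at h1
    · have : ‖m Q - 1‖ ≤ ‖m Q‖ + 1 := by simpa using norm_sub_le (m Q) 1
      rw [sub_zero] at h1
      nlinarith [norm_nonneg (m Q), norm_nonneg (m Q - 1)]
    · have : ‖m Q‖ ≤ ‖m Q - 1‖ + 1 := by simpa using norm_add_le (m Q - 1) 1
      nlinarith [norm_nonneg (m Q), norm_nonneg (m Q - 1)]
  have hsum : Summable (fun j : ℕ => 4 ^ j * ‖y ^ j‖) := by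
    rcases subsingleton_or_nontrivial 𝔅 with hsub | hnt
    · have : ∀ j : ℕ, 4 ^ j * ‖y ^ j‖ = 0 := fun j => by
        rw [Subsingleton.elim (y ^ j) 0]; simp
      simp_rw [this]; exact summable_zero
    have hsr : spectralRadius ℂ y < ((1/8 : NNReal) : ENNReal) := by
      apply spectrum.spectralRadius_lt_of_forall_lt_of_nonempty
      · exact spectrum.nonempty y
      · intro z hz
        obtain ⟨m, rfl⟩ := (CharacterSpace.mem_spectrum_iff_exists).1 hz
        have := hmy m
        rw [← NNReal.coe_lt_coe]; simpa using this
    have ht := spectrum.pow_nnnorm_pow_one_div_tendsto_nhds_spectralRadius y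
    have hev := (ht.eventually_lt_const hsr).and (eventually_ge_atTop 1)
    have hb : ∀ᶠ j : ℕ in atTop, 4 ^ j * ‖y ^ j‖ ≤ (1/2 : ℝ) ^ j := by
      filter_upwards [hev] with j hj
      have hj0 : (0:ℝ) < j := by exact_mod_cast hj.2
      have h1 : (‖y ^ j‖₊ : ENNReal) ≤ ((1/8 : NNReal) : ENNReal) ^ j := by
        have := ENNReal.rpow_le_rpow hj.1.le hj0.le
        rw [← ENNReal.rpow_mul, one_div_mul_cancel hj0.ne', ENNReal.rpow_one, ENNReal.rpow_natCast] at this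
        exact this
      rw [← ENNReal.coe_pow, ENNReal.coe_le_coe, ← NNReal.coe_le_coe] at h1
      simp only [coe_nnnorm, NNReal.coe_pow] at h1
      have h2 : ((1/8 : NNReal) : ℝ) = 1/8 := by norm_num
      rw [h2] at h1
      calc 4 ^ j * ‖y ^ j‖ ≤ 4 ^ j * (1/8) ^ j := by gcongr
        _ = (1/2) ^ j := by rw [← mul_pow]; norm_num
    refine Summable.of_norm_bounded_eventually_nat
      (summable_geometric_of_lt_one (by norm_num) (by norm_num) : Summable fun j : ℕ => (1/2 : ℝ) ^ j) ?_
    filter_upwards [hb] with j hj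
    rwa [Real.norm_of_nonneg (by positivity)]
  obtain ⟨e, he, hk⟩ := idem_gen Q hsum
  refine ⟨e, he, fun m => ?_⟩
  have hp2 : Tendsto (fun k : ℕ => (1/2 : ℝ) ^ k) atTop (𝓝 0) :=
    tendsto_pow_atTop_nhds_zero_of_lt_one (by norm_num) (by norm_num)
  have t1 : Tendsto (fun k => m (Gk k Q)) atTop (𝓝 (m e)) := by
    refine ((map_continuous m).tendsto e).comp ?_
    rw [tendsto_iff_norm_sub_tendsto_zero]
    refine squeeze_zero (fun _ => norm_nonneg _) hk ?_
    simpa using (tendsto_sum_nat_add (fun j : ℕ => 4 ^ j * ‖y ^ j‖)).const_mul ‖Q + Q - 1‖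
  have t2 : Tendsto (fun k => m (Gk k Q)) atTop (𝓝 (ind U m)) := by
    rw [tendsto_iff_norm_sub_tendsto_zero]
    refine squeeze_zero' (Eventually.of_forall fun _ => norm_nonneg _)
      (eventually_atTop.2 ⟨1, fun k h1 => ?_⟩)
      (show Tendsto (fun k : ℕ => 4 * (1/2 : ℝ) ^ k) atTop (𝓝 0) by simpa using hp2.const_mul 4)
    rw [map_Gk m]
    exact Gk_complex _ _ (ind_cases _ _) (h m) k h1
  exact tendsto_nhds_unique t1 t2

end patch

theorem shilov_n (n : ℕ) : ∀ (𝔅 : Type v) [NormedCommRing 𝔅] [NormedAlgebra ℂ 𝔅] [CompleteSpace 𝔅]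
    (U : Set (characterSpace ℂ 𝔅)) (_ : IsClopen U) (b : Fin n → 𝔅)
    (_ : ∀ m m' : characterSpace ℂ 𝔅, m ∈ U → m' ∉ U → ∃ i, m (b i) ≠ m' (b i)),
    ∃ e : 𝔅, e * e = e ∧ ∀ m : characterSpace ℂ 𝔅, m e = ind U m := by
  induction n with
  | zero =>
    intro 𝔅 _ _ _ U hU b hsep
    by_cases hne : U.Nonempty
    · obtain ⟨m0, hm0⟩ := hne
      refine ⟨1, one_mul 1, fun m => ?_⟩
      have : m ∈ U := by
        by_contra hno
        obtain ⟨i, -⟩ := hsep m0 m hm0 hno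
        exact i.elim0
      rw [map_one]; simp [ind, this]
    · refine ⟨0, zero_mul 0, fun m => ?_⟩
      have : m ∉ U := fun h => hne ⟨m, h⟩
      rw [map_zero]; simp [ind, this]
  | succ n ih =>
    intro 𝔅 _ _ _ U hU b hsep
    have hfc : ∀ ζ, FibClopen (b 0) U ζ := by
      intro ζ m _
      by_cases h : m ∈ U
      · left; rwa [hU.isOpen.interior_eq]
      · right; rwa [hU.compl.isOpen.interior_eq]
    obtain ⟨χ0, C, hC, hχ, -, hQ⟩ := patch (b 0) U ∅ isOpen_empty (fun ζ _ => by
      apply fiber_good (b 0) U ζ (hfc ζ)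
      intro U' hU' hUU
      refine ih (𝔅 ⧸ Jz (b 0) ζ) U' hU' (fun i => mkz (b 0) ζ (b i.succ)) ?_
      intro φ φ' h h'
      rw [hUU] at h h'
      obtain ⟨i, hi⟩ := hsep (pullc (b 0) ζ φ) (pullc (b 0) ζ φ') h h'
      rcases Fin.eq_zero_or_eq_succ i with rfl | ⟨j, rfl⟩
      · exact absurd (by rw [pullc_b, pullc_b]) hi
      · exact ⟨j, hi⟩)
    obtain ⟨Q, hQ⟩ := hQ 1 (1 / (32 * (C + 1))) (by positivity) (by simp)
    refine idem_spec Q U fun m => ?_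
    have := hQ m
    rw [hχ _ (by simp), map_one] at this
    simp only [Complex.ofReal_zero, sub_zero, one_mul, mul_one] at this
    refine this.trans_lt ?_
    rw [mul_one_div, div_lt_div_iff₀ (by positivity) (by norm_num)]
    linarith

theorem shilov (𝔅 : Type v) [NormedCommRing 𝔅] [NormedAlgebra ℂ 𝔅] [CompleteSpace 𝔅]
    (U : Set (characterSpace ℂ 𝔅)) (hU : IsClopen U) :
    ∃ e : 𝔅, e * e = e ∧ ∀ m : characterSpace ℂ 𝔅, m e = ind U m := by
  classical
  have hcomp : IsCompact (U ×ˢ Uᶜ) := hU.isClosed.isCompact.prod hU.compl.isClosed.isCompact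
  obtain ⟨t, ht⟩ := hcomp.elim_finite_subcover
    (fun x : 𝔅 => {q : characterSpace ℂ 𝔅 × characterSpace ℂ 𝔅 | q.1 x ≠ q.2 x})
    (fun x => isOpen_ne_fun ((char_closed_image x).comp continuous_fst) ((char_closed_image x).comp continuous_snd))
    (by
      rintro ⟨m, m'⟩ ⟨h, h'⟩
      by_contra hno
      simp only [mem_iUnion, mem_setOf_eq, not_exists, not_not] at hno
      have : m = m' := CharacterSpace.ext hno
      subst this; exact h' h)
  refine shilov_n t.card 𝔅 U hU (fun i => (t.equivFin.symm i : 𝔅)) fun m m' h h' => ?_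
  obtain ⟨x, hx, hne⟩ := mem_iUnion₂.1 (ht (show (m, m') ∈ U ×ˢ Uᶜ from ⟨h, h'⟩))
  exact ⟨t.equivFin ⟨x, hx⟩, by simpa using hne⟩

/-- Rossi's local maximum principle. -/
theorem lmp {𝔅 : Type v} [NormedCommRing 𝔅] [NormedAlgebra ℂ 𝔅] [CompleteSpace 𝔅]
    (K U : Set (characterSpace ℂ 𝔅)) (hK : ∀ (m : characterSpace ℂ 𝔅) (x : 𝔅) (t : ℝ), (∀ k ∈ K, ‖k x‖ ≤ t) → ‖m x‖ ≤ t)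
    (hU : IsOpen U) (hUK : Disjoint U K) (m0 : characterSpace ℂ 𝔅) (hm0 : m0 ∈ U) (a : 𝔅)
    (ha : ∀ m ∈ closure U \ U, (m a).re < (m0 a).re) : False := by
  letI : NormedAlgebra ℚ 𝔅 := NormedAlgebra.restrictScalars ℚ ℂ 𝔅
  set b := a - algebraMap ℂ 𝔅 (m0 a) with hb
  have hmb : ∀ m : characterSpace ℂ 𝔅, m b = m a - m0 a := fun m => by
    rw [hb, map_sub, char_algebraMap]
  have hcomp : IsCompact (closure U \ U) := isClosed_closure.isCompact.diff hU
  obtain ⟨η, hη, hηm⟩ : ∃ η > 0, ∀ m ∈ closure U \ U, (m b).re < - η := by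
    have hcont : Continuous fun m : characterSpace ℂ 𝔅 => (m b).re :=
      Complex.continuous_re.comp (char_closed_image b)
    by_cases hne : (closure U \ U).Nonempty
    · obtain ⟨m1, hm1, hmax⟩ := hcomp.exists_isMaxOn hne hcont.continuousOn
      have h1 := ha m1 hm1
      have h2 : (m1 b).re < 0 := by rw [hmb]; simp; linarith
      refine ⟨-(m1 b).re / 2, by linarith, fun m hm => ?_⟩
      have : (m b).re ≤ (m1 b).re := hmax hm
      linarith
    · exact ⟨1, one_pos, fun m hm => absurd ⟨m, hm⟩ hne⟩
  set V0 : Set ℂ := {ζ | ζ.re < -(η/2)} with hV0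
  obtain ⟨χ0, C, hC, hχ, -, hQ⟩ := patch b U V0 (isOpen_lt Complex.continuous_re continuous_const) (fun ζ hζ => by
    apply fiber_good b U ζ
    · intro m hm
      by_cases h : m ∈ U
      · left; rwa [hU.interior_eq]
      · right
        rw [interior_compl]
        intro hcl
        have := hηm m ⟨hcl, h⟩
        rw [hm] at this
        exact hζ (show ζ.re < -(η/2) by linarith)
    · intro U' hU' _
      exact shilov _ U' hU')
  obtain ⟨c, hc0, hc⟩ : ∃ c : ℝ, 0 < c ∧ C * (Real.exp (-(c * (η/2))) * (‖(1:𝔅)‖ + 1)) < 1/2 := by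
    have ht : Tendsto (fun c : ℝ => C * (Real.exp (-(c * (η/2))) * (‖(1:𝔅)‖ + 1))) atTop (𝓝 (C * (0 * (‖(1:𝔅)‖ + 1)))) := by
      refine (Tendsto.mul_const _ ?_).const_mul C
      exact Real.tendsto_exp_neg_atTop_nhds_zero.comp (tendsto_id.atTop_mul_const (by positivity))
    obtain ⟨c, h1, h2⟩ := ((eventually_gt_atTop 0).and (ht.eventually_lt_const (by simp : C * (0 * (‖(1:𝔅)‖ + 1)) < 1/2))).exists
    exact ⟨c, h1, h2⟩
  set x : 𝔅 := NormedSpace.exp ((c:ℂ) • b) with hx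
  have hmx : ∀ m : characterSpace ℂ 𝔅, m x = Complex.exp (c * m b) := by
    intro m
    rw [hx]
    have := NormedSpace.map_exp (CharacterSpace.toAlgHom m) (map_continuous m) ((c:ℂ) • b)
    rw [Complex.exp_eq_exp_ℂ]
    refine this.trans ?_
    congr 1
    show m ((c:ℂ) • b) = _
    rw [map_smul]; rfl
  obtain ⟨Q, hQ⟩ := hQ x (Real.exp (-(c * (η/2))) * (‖(1:𝔅)‖ + 1)) (by positivity) (by
    intro ζ hζ
    have h1 : mkz b ζ x = Complex.exp (c * ζ) • (1 : 𝔅 ⧸ Jz b ζ) := by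
      letI : NormedAlgebra ℚ (𝔅 ⧸ Jz b ζ) := NormedAlgebra.restrictScalars ℚ ℂ (𝔅 ⧸ Jz b ζ)
      have := NormedSpace.map_exp (mkzA b ζ) (mkzA_continuous b ζ) ((c:ℂ) • b)
      rw [← Algebra.algebraMap_eq_smul_one, Complex.exp_eq_exp_ℂ, NormedSpace.algebraMap_exp_comm]
      refine this.trans ?_
      congr 1
      rw [map_smul]
      show (c:ℂ) • mkz b ζ b = _
      rw [mkz_self, map_mul, Algebra.smul_def]
    rw [h1, norm_smul, Complex.norm_exp]
    have h2 : ‖(1 : 𝔅 ⧸ Jz b ζ)‖ ≤ ‖(1:𝔅)‖ + 1 := by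
      have := mkz_norm_le b ζ 1
      rw [mkz, map_one] at this; linarith
    gcongr
    simp
    have : ζ.re < -(η/2) := hζ
    nlinarith)
  have hm0b : m0 b = 0 := by rw [hmb, sub_self]
  have h1 := hQ m0
  rw [hmx, hm0b, hχ 0 (by simp [hV0]; positivity)] at h1
  have : ind U m0 = 1 := by simp [ind, hm0]
  rw [this] at h1
  simp at h1
  set δ := C * (Real.exp (-(c * (η/2))) * (‖(1:𝔅)‖ + 1)) with hδ
  have h2 : ‖m0 Q‖ ≤ δ := by
    apply hK m0 Q
    intro k hk
    have h3 := hQ k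
    have : ind U k = 0 := by
      have : k ∉ U := fun h => hUK.le_bot ⟨h, hk⟩
      simp [ind, this]
    rw [this] at h3
    simpa using h3
  have h4 : (1:ℝ) ≤ ‖m0 Q - 1‖ + ‖m0 Q‖ := by
    calc (1:ℝ) = ‖(1:ℂ)‖ := by simp
      _ = ‖m0 Q - (m0 Q - 1)‖ := by congr 1; ring
      _ ≤ ‖m0 Q‖ + ‖m0 Q - 1‖ := norm_sub_le _ _
      _ = _ := add_comm _ _
  linarith

end fileA5

section fileB1
open Set Filter Topology Metric MeasureTheory

section partP
variable {E : Type*} [NormedAddCommGroup E] [NormedSpace ℂ E]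

theorem c1_of_diff {f : E → ℂ} {G : Set E} (hG : IsOpen G) (hf : DifferentiableOn ℂ f G) :
    ContinuousOn (fderiv ℂ f) G := by
  intro x hx
  apply ContinuousAt.continuousWithinAt
  have hc : ContinuousAt f x := (hf.differentiableAt (hG.mem_nhds hx)).continuousAt
  obtain ⟨R, hR, hRG⟩ : ∃ R > 0, ∀ z ∈ ball x R, z ∈ G ∧ dist (f z) (f x) < 1 := by
    have : ∀ᶠ z in 𝓝 x, z ∈ G ∧ dist (f z) (f x) < 1 :=
      Filter.Eventually.and (hG.mem_nhds hx) (hc.eventually (ball_mem_nhds _ one_pos))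
    obtain ⟨R, hR, h⟩ := Metric.eventually_nhds_iff.1 this
    exact ⟨R, hR, fun z hz => h hz⟩
  have hlip : ∀ z ∈ ball x (R/2), ∀ w ∈ ball z (R/2), dist (f w) (f z) ≤ 2 / (R/2) * dist w z := by
    intro z hz w hw
    refine Complex.dist_le_div_mul_dist_of_mapsTo_ball (R₁ := R/2) (R₂ := 2) ?_ ?_ hw
    · intro y hy
      refine (hf.differentiableAt (hG.mem_nhds (hRG y ?_).1)).differentiableWithinAt
      rw [mem_ball] at *; linarith [dist_triangle y z x]
    · intro y hy
      have h1 := (hRG y (by rw [mem_ball] at *; linarith [dist_triangle y z x])).2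
      have h2 := (hRG z (by rw [mem_ball] at *; linarith)).2
      have := dist_triangle_right (f y) (f z) (f x)
      rw [mem_closedBall]; linarith
  rw [Metric.continuousAt_iff]
  intro ε hε
  refine ⟨min (R/4) (ε * R^2/64), by positivity, fun {x'} hx' => ?_⟩
  have hx'1 := hx'.trans_le (min_le_left _ _)
  have hx'2 := hx'.trans_le (min_le_right _ _)
  set h := x' - x with hh
  have hnh : ‖h‖ = dist x' x := (dist_eq_norm _ _).symm
  set g : E → ℂ := fun z => f (z + h) - f z with hg
  have hfx : ∀ z ∈ ball x (R/4), DifferentiableAt ℂ f (z + h) := by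
    intro z hz
    refine hf.differentiableAt (hG.mem_nhds (hRG _ ?_).1)
    rw [mem_ball] at *
    have : dist (z + h) z = dist x' x := by rw [dist_eq_norm, ← hnh]; simp
    linarith [dist_triangle (z + h) z x]
  have hfx2 : ∀ z ∈ ball x (R/4), DifferentiableAt ℂ f z := by
    intro z hz
    refine hf.differentiableAt (hG.mem_nhds (hRG _ ?_).1)
    rw [mem_ball] at *; linarith
  have hgd : DifferentiableOn ℂ g (ball x (R/4)) := by
    intro z hz
    have h1 := (hasFDerivAt_comp_add_right h).2 (hfx z hz).hasFDerivAt
    exact (h1.differentiableAt.sub (hfx2 z hz)).differentiableWithinAt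
  have hgb : ∀ z ∈ ball x (R/4), ‖g z‖ ≤ 4 / R * dist x' x := by
    intro z hz
    rw [mem_ball] at hz
    have h1 := hlip z (by rw [mem_ball]; linarith) (z + h) (by
      rw [mem_ball, dist_eq_norm, add_sub_cancel_left, hnh]; linarith)
    rw [dist_eq_norm, dist_eq_norm, add_sub_cancel_left, hnh] at h1
    refine h1.trans (le_of_eq ?_); field_simp; ring
  have hle := Complex.norm_fderiv_le_div_of_mapsTo_ball (R₂ := 2 * (4 / R * dist x' x)) hgd (by
    intro z hz
    rw [mem_closedBall, dist_eq_norm]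
    have h1 := hgb z hz
    have h2 := hgb x (mem_ball_self (by positivity))
    linarith [norm_sub_le (g z) (g x)]) (by positivity)
  have hfd : fderiv ℂ g x = fderiv ℂ f x' - fderiv ℂ f x := by
    have hx0 : x ∈ ball x (R/4) := mem_ball_self (by positivity)
    have h1 := (hasFDerivAt_comp_add_right h).2 (hfx x hx0).hasFDerivAt
    have : x + h = x' := by simp [hh]
    rw [this] at h1
    exact (h1.sub (hfx2 x hx0).hasFDerivAt).fderiv
  rw [hfd] at hle
  rw [dist_eq_norm]
  refine hle.trans_lt ?_
  rw [div_lt_iff₀ (by positivity)]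
  have : 2 * (4 / R * dist x' x) = 8 * dist x' x / R := by ring
  rw [this, div_lt_iff₀ hR]
  nlinarith

theorem diff_circle {Φ : E × ℂ → ℂ} {G : Set (E × ℂ)} (hG : IsOpen G) (hΦ : DifferentiableOn ℂ Φ G)
    {c : ℂ} {r : ℝ} (hr : 0 ≤ r) {y0 : E} (h : ∀ t ∈ sphere c r, (y0, t) ∈ G) :
    DifferentiableAt ℂ (fun y => ∮ t in C(c, r), Φ (y, t)) y0 := by
  have hfd := c1_of_diff hG hΦ
  set G' : Set (E × ℂ) := {p ∈ G | ‖fderiv ℂ Φ p‖ < (sSup ((fun t => ‖fderiv ℂ Φ (y0, t)‖) '' sphere c r)) + 1} with hG'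
  have hcs : ContinuousOn (fun t => fderiv ℂ Φ (y0, t)) (sphere c r) :=
    hfd.comp (Continuous.continuousOn (by fun_prop)) h
  have hG'o : IsOpen G' := hfd.norm.isOpen_inter_preimage hG isOpen_Iio
  set B := (sSup ((fun t => ‖fderiv ℂ Φ (y0, t)‖) '' sphere c r)) + 1
  have hsub : ({y0} : Set E) ×ˢ sphere c r ⊆ G' := by
    rintro ⟨y, t⟩ ⟨hy, ht⟩
    simp only [mem_singleton_iff] at hy
    subst hy
    refine ⟨h t ht, ?_⟩
    have : ‖fderiv ℂ Φ (y, t)‖ ≤ _ := le_csSup (IsCompact.bddAbove ((isCompact_sphere c r).image_of_continuousOn hcs.norm)) ⟨t, ht, rfl⟩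
    linarith
  obtain ⟨u, v, hu, hv, hyu, hsv, huv⟩ := generalized_tube_lemma isCompact_singleton (isCompact_sphere c r) hG'o hsub
  obtain ⟨ρ, hρ, hρu⟩ := Metric.isOpen_iff.1 hu y0 (hyu rfl)
  have hmem : ∀ y ∈ ball y0 ρ, ∀ θ : ℝ, (y, circleMap c r θ) ∈ G' := fun y hy θ =>
    huv ⟨hρu hy, hsv (circleMap_mem_sphere c hr θ)⟩
  have hcy : ∀ y ∈ ball y0 ρ, Continuous fun θ : ℝ => Φ (y, circleMap c r θ) := fun y hy =>
    continuousOn_univ.1 (hΦ.continuousOn.comp (Continuous.continuousOn (by fun_prop)) fun θ _ => (hmem y hy θ).1)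
  have hy0 : y0 ∈ ball y0 ρ := mem_ball_self hρ
  have hdc : Continuous (deriv (circleMap c r)) := by
    have : deriv (circleMap c r) = fun θ => circleMap 0 r θ * Complex.I := by
      funext θ; simp
    rw [this]; fun_prop
  have key := intervalIntegral.hasFDerivAt_integral_of_dominated_of_fderiv_le (𝕜 := ℂ) (μ := volume)
    (a := 0) (b := 2 * Real.pi) (s := ball y0 ρ) (x₀ := y0)
    (F := fun y θ => deriv (circleMap c r) θ • Φ (y, circleMap c r θ))
    (F' := fun y θ => deriv (circleMap c r) θ • (fderiv ℂ Φ (y, circleMap c r θ)).comp (ContinuousLinearMap.inl ℂ E ℂ))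
    (bound := fun _ => |r| * (B * ‖ContinuousLinearMap.inl ℂ E ℂ‖)) (ball_mem_nhds _ hρ) ?_ ?_ ?_ ?_ ?_ ?_
  · exact key.differentiableAt
  · filter_upwards [ball_mem_nhds y0 hρ] with y hy
    have := hcy y hy
    exact (Continuous.smul hdc this).aestronglyMeasurable
  · exact (Continuous.smul hdc (hcy y0 hy0)).intervalIntegrable _ _
  · refine Continuous.aestronglyMeasurable ?_
    refine Continuous.smul hdc ?_
    refine Continuous.clm_comp ?_ continuous_const
    exact continuousOn_univ.1 (hfd.comp (Continuous.continuousOn (by fun_prop)) fun θ _ => (hmem y0 hy0 θ).1)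
  · refine Eventually.of_forall fun θ _ y hy => ?_
    rw [norm_smul]
    have h1 : ‖deriv (circleMap c r) θ‖ = |r| := by simp [deriv_circleMap]
    rw [h1]
    gcongr
    refine (ContinuousLinearMap.opNorm_comp_le _ _).trans ?_
    gcongr
    exact (hmem y hy θ).2.le
  · exact intervalIntegrable_const
  · refine Eventually.of_forall fun θ _ y hy => ?_
    have h1 : HasFDerivAt Φ (fderiv ℂ Φ (y, circleMap c r θ)) (y, circleMap c r θ) :=
      (hΦ.differentiableAt (hG.mem_nhds (hmem y hy θ).1)).hasFDerivAt
    exact (h1.comp y (hasFDerivAt_prodMk_left y (circleMap c r θ))).const_smul (deriv (circleMap c r) θ)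

end partP

end fileB1

section fileB2
open Set Filter Topology Metric MeasureTheory

section partP
variable {E : Type*} [NormedAddCommGroup E] [NormedSpace ℂ E]

theorem diff_dir {f : E → ℂ} {G : Set E} (hG : IsOpen G) (hf : DifferentiableOn ℂ f G) (v : E) :
    DifferentiableOn ℂ (fun x => fderiv ℂ f x v) G := by
  intro x0 hx0
  obtain ⟨ρ, hρ, hρG⟩ : ∃ ρ > 0, ∀ x ∈ ball x0 ρ, ∀ ζ ∈ ball (0:ℂ) ρ, x + ζ • v ∈ G := by
    have hc : Continuous fun p : E × ℂ => p.1 + p.2 • v := by fun_prop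
    have : ∀ᶠ p : E × ℂ in 𝓝 (x0, 0), p.1 + p.2 • v ∈ G :=
      hc.continuousAt.eventually (hG.mem_nhds (by simpa using hx0))
    obtain ⟨ρ, hρ, h⟩ := Metric.eventually_nhds_iff_ball.1 this
    exact ⟨ρ, hρ, fun x hx ζ hζ => h (x, ζ) (by rw [← ball_prod_same]; exact ⟨hx, hζ⟩)⟩
  set G' : Set (E × ℂ) := {p | p.1 + p.2 • v ∈ G ∧ p.2 ≠ 0} with hG'
  have hG'o : IsOpen G' := (hG.preimage (by fun_prop)).inter (isOpen_ne_fun (by fun_prop) (by fun_prop))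
  have hd : DifferentiableOn ℂ (fun p : E × ℂ => ((p.2) ^ 2)⁻¹ • f (p.1 + p.2 • v)) G' := by
    intro p hp
    have h1 : DifferentiableAt ℂ f (p.1 + p.2 • v) := hf.differentiableAt (hG.mem_nhds hp.1)
    have h2 : DifferentiableAt ℂ (fun p : E × ℂ => f (p.1 + p.2 • v)) p :=
      DifferentiableAt.comp (g := f) (f := fun p : E × ℂ => p.1 + p.2 • v) p h1 (by fun_prop)
    have h3 : DifferentiableAt ℂ (fun p : E × ℂ => ((p.2) ^ 2)⁻¹) p := by
      apply DifferentiableAt.inv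
      · fun_prop
      · exact pow_ne_zero _ hp.2
    exact (h3.smul h2).differentiableWithinAt
  have key := diff_circle (c := 0) (r := ρ/2) (y0 := x0) hG'o hd (by positivity) (by
    intro t ht
    rw [mem_sphere, dist_zero_right] at ht
    refine ⟨hρG x0 (mem_ball_self hρ) t ?_, fun h => ?_⟩
    · rw [mem_ball, dist_zero_right]; linarith
    · simp only at h; rw [h, norm_zero] at ht; linarith)
  have key2 := key.const_smul (2 * Real.pi * Complex.I : ℂ)⁻¹
  refine (key2.congr_of_eventuallyEq ?_).differentiableWithinAt
  filter_upwards [ball_mem_nhds x0 hρ] with x hx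
  have hs : ∀ ζ ∈ ball (0:ℂ) ρ, HasDerivAt (fun ζ : ℂ => f (x + ζ • v)) (fderiv ℂ f (x + ζ • v) v) ζ := by
    intro ζ hζ
    have h1 : HasFDerivAt f (fderiv ℂ f (x + ζ • v)) (x + ζ • v) := (hf.differentiableAt (hG.mem_nhds (hρG x hx ζ hζ))).hasFDerivAt
    have h2 : HasDerivAt (fun ζ : ℂ => x + ζ • v) v ζ := by
      simpa using ((hasDerivAt_id ζ).smul_const v).const_add x
    exact h1.comp_hasDerivAt ζ h2
  have := Complex.two_pi_I_inv_smul_circleIntegral_sub_sq_inv_smul_of_differentiable (c := 0) (R := ρ/2) (w₀ := 0)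
    (f := fun ζ : ℂ => f (x + ζ • v)) (U := ball 0 ρ) isOpen_ball (by
      intro z hz; rw [mem_closedBall] at hz; rw [mem_ball]; linarith)
    (fun ζ hζ => (hs ζ hζ).differentiableAt.differentiableWithinAt) (mem_ball_self (by positivity))
  rw [(hs 0 (mem_ball_self hρ)).deriv] at this
  simp only [sub_zero, zero_smul, add_zero] at this
  rw [← this]
  rfl

end partP

theorem pull_zero {H : ℂ → ℂ} {c a : ℂ} {ρ : ℝ} (hH : DifferentiableOn ℂ H (ball c ρ)) (ha : a ∈ ball c ρ)
    (hne : ¬ ∀ᶠ z in 𝓝 a, H z = 0) :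
    ∃ (n : ℕ) (g : ℂ → ℂ), DifferentiableOn ℂ g (ball c ρ) ∧ g a ≠ 0 ∧ ∀ t, H t = (t - a) ^ n * g t := by
  have hA : AnalyticAt ℂ H a := hH.analyticAt (isOpen_ball.mem_nhds ha)
  obtain ⟨n, g, hg, hga, hgH⟩ := hA.exists_eventuallyEq_pow_smul_nonzero_iff.2 hne
  refine ⟨n, fun t => if t = a then g a else H t / (t - a) ^ n, ?_, by simpa using hga, ?_⟩
  · intro t ht
    apply DifferentiableAt.differentiableWithinAt
    by_cases hta : t = a
    · subst hta
      refine hg.differentiableAt.congr_of_eventuallyEq ?_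
      filter_upwards [hgH] with z hz
      by_cases hz' : z = t
      · simp [hz']
      · have : (z - t) ^ n ≠ 0 := pow_ne_zero _ (sub_ne_zero.2 hz')
        rw [if_neg hz', hz, smul_eq_mul]; field_simp
    · have hd : DifferentiableAt ℂ (fun t => H t / (t - a) ^ n) t :=
        (hH.differentiableAt (isOpen_ball.mem_nhds ht)).div (by fun_prop) (pow_ne_zero _ (sub_ne_zero.2 hta))
      refine hd.congr_of_eventuallyEq ?_
      filter_upwards [isOpen_ne.mem_nhds hta] with z hz
      rw [if_neg hz]
  · intro t
    by_cases hta : t = a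
    · subst hta
      have := hgH.self_of_nhds
      rw [smul_eq_mul] at this
      simpa using this
    · have : (t - a) ^ n ≠ 0 := pow_ne_zero _ (sub_ne_zero.2 hta)
      simp only [if_neg hta]; field_simp

theorem not_ev_zero {H : ℂ → ℂ} {c a t : ℂ} {ρ : ℝ} (hH : DifferentiableOn ℂ H (ball c ρ)) (ha : a ∈ ball c ρ)
    (ht : t ∈ ball c ρ) (h : H t ≠ 0) : ¬ ∃ᶠ z in 𝓝[≠] a, H z = 0 := by
  intro hf
  exact h ((hH.analyticOnNhd isOpen_ball).eqOn_zero_of_preconnected_of_frequently_eq_zero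
    (convex_ball c ρ).isPreconnected ha hf ht)

theorem factor_disc {H : ℂ → ℂ} {c : ℂ} {r ρ : ℝ} (hr : 0 < r) (hrρ : r < ρ) (hH : DifferentiableOn ℂ H (ball c ρ))
    (hS : ∀ t ∈ sphere c r, H t ≠ 0) :
    ∃ (s : Multiset ℂ) (e : ℂ → ℂ), (∀ t, t ∈ s ↔ t ∈ ball c r ∧ H t = 0) ∧ DifferentiableOn ℂ e (ball c ρ) ∧
      (∀ t ∈ closedBall c r, e t ≠ 0) ∧ ∀ t, H t = (s.map fun a => t - a).prod * e t := by
  have hsub : closedBall c r ⊆ ball c ρ := closedBall_subset_ball hrρ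
  have hp : c + r ∈ sphere c r := by simp [abs_of_pos hr]
  have hfin : ∀ H : ℂ → ℂ, DifferentiableOn ℂ H (ball c ρ) → (∀ t ∈ sphere c r, H t ≠ 0) → {t ∈ closedBall c r | H t = 0}.Finite := by
    intro H hH hS
    by_contra hinf
    obtain ⟨a, ha, hacc⟩ := Set.Infinite.exists_accPt_of_subset_isCompact hinf (isCompact_closedBall c r) (fun t ht => ht.1)
    refine not_ev_zero hH (hsub ha) (hsub (sphere_subset_closedBall hp)) (hS _ hp) ?_
    rw [accPt_iff_frequently_nhdsNE] at hacc
    exact hacc.mono fun z hz => hz.2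
  suffices ∀ n : ℕ, ∀ H : ℂ → ℂ, DifferentiableOn ℂ H (ball c ρ) → (∀ t ∈ sphere c r, H t ≠ 0) →
      {t ∈ closedBall c r | H t = 0}.ncard = n → ∃ (s : Multiset ℂ) (e : ℂ → ℂ), (∀ t, t ∈ s ↔ t ∈ ball c r ∧ H t = 0) ∧ DifferentiableOn ℂ e (ball c ρ) ∧
      (∀ t ∈ closedBall c r, e t ≠ 0) ∧ ∀ t, H t = (s.map fun a => t - a).prod * e t from this _ H hH hS rfl
  intro n
  induction n with
  | zero =>
    intro H hH hS hn
    rw [Set.ncard_eq_zero (hfin H hH hS)] at hn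
    refine ⟨0, H, fun t => ?_, hH, fun t ht h0 => ?_, fun t => by simp⟩
    · simp only [Multiset.notMem_zero, false_iff]
      rintro ⟨h1, h2⟩
      exact (hn ▸ (⟨ball_subset_closedBall h1, h2⟩ : t ∈ {t ∈ closedBall c r | H t = 0}) : t ∈ (∅ : Set ℂ))
    · exact (hn ▸ (⟨ht, h0⟩ : t ∈ {t ∈ closedBall c r | H t = 0}) : t ∈ (∅ : Set ℂ))
  | succ n ih =>
    intro H hH hS hn
    have hne : {t ∈ closedBall c r | H t = 0}.Nonempty := by
      rw [← Set.ncard_pos (hfin H hH hS)]; omega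
    obtain ⟨a, ha, hHa⟩ := hne
    have hab : a ∈ ball c r := by
      rcases eq_or_lt_of_le (mem_closedBall.1 ha) with h | h
      · exact absurd hHa (hS a h)
      · exact h
    obtain ⟨k, g, hg, hga, hgH⟩ := pull_zero hH (hsub ha) (fun hev =>
      not_ev_zero hH (hsub ha) (hsub (sphere_subset_closedBall hp)) (hS _ hp) (hev.filter_mono nhdsWithin_le_nhds).frequently)
    have hk : k ≠ 0 := by
      rintro rfl; apply hga; rw [hgH a] at hHa; simpa using hHa
    have hz : ∀ t, H t = 0 ↔ t = a ∨ g t = 0 := by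
      intro t; rw [hgH t, mul_eq_zero, pow_eq_zero_iff hk, sub_eq_zero]
    obtain ⟨s, e, h1, h2, h3, h4⟩ := ih g hg (fun t ht h => hS t ht ((hz t).2 (Or.inr h))) (by
      have : {t ∈ closedBall c r | H t = 0} = insert a {t ∈ closedBall c r | g t = 0} := by
        ext t
        simp only [mem_setOf_eq, mem_insert_iff, hz]
        constructor
        · tauto
        · rintro (rfl | h)
          · exact ⟨ha, Or.inl rfl⟩
          · exact ⟨h.1, Or.inr h.2⟩
      rw [this, Set.ncard_insert_of_notMem (fun h => hga h.2)
        (hfin g hg (fun t ht h => hS t ht ((hz t).2 (Or.inr h))))] at hn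
      omega)
    refine ⟨Multiset.replicate k a + s, e, fun t => ?_, h2, h3, fun t => ?_⟩
    · rw [Multiset.mem_add, Multiset.mem_replicate, h1, hz]
      constructor
      · rintro (⟨-, rfl⟩ | h)
        · exact ⟨hab, Or.inl rfl⟩
        · exact ⟨h.1, Or.inr h.2⟩
      · rintro ⟨h, rfl | h'⟩
        · exact Or.inl ⟨hk, rfl⟩
        · exact Or.inr ⟨h, h'⟩
    · rw [hgH t, h4 t]; simp [mul_assoc]

theorem rootsum {c : ℂ} {r : ℝ} (hr : 0 < r) {U : Set ℂ} (hU : IsOpen U) (hsub : closedBall c r ⊆ U) {e g : ℂ → ℂ} (he : DifferentiableOn ℂ e U)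
    (he0 : ∀ t ∈ closedBall c r, e t ≠ 0) (hg : DifferentiableOn ℂ g U) (s : Multiset ℂ) (hs : ∀ t ∈ s, t ∈ ball c r) :
    ∀ H : ℂ → ℂ, (∀ t, H t = (s.map fun a => t - a).prod * e t) →
    ContinuousOn (fun t => g t * (deriv H t / H t)) (sphere c r) ∧
    (∮ t in C(c, r), g t * (deriv H t / H t)) = 2 * Real.pi * Complex.I * (s.map g).sum := by
  have hss : sphere c r ⊆ U := sphere_subset_closedBall.trans hsub
  induction s using Multiset.induction_on with
  | empty =>
    intro H hH
    have hH : H = e := by funext t; simp [hH t]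
    subst hH
    have hd : DifferentiableOn ℂ (fun t => g t * (deriv H t / H t)) (closedBall c r) := by
      intro t ht
      have h1 := (hg.differentiableAt (hU.mem_nhds (hsub ht)))
      have h2 := (he.differentiableAt (hU.mem_nhds (hsub ht)))
      have h3 := ((he.deriv hU).differentiableAt (hU.mem_nhds (hsub ht)))
      exact (h1.mul (h3.div h2 (he0 t ht))).differentiableWithinAt
    refine ⟨hd.continuousOn.mono sphere_subset_closedBall, ?_⟩
    simp only [Multiset.map_zero, Multiset.sum_zero, mul_zero]
    exact DiffContOnCl.circleIntegral_eq_zero hr.le (hd.diffContOnCl_ball subset_rfl)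
  | cons a s ih =>
    intro H hH
    set H1 : ℂ → ℂ := fun t => (s.map fun a => t - a).prod * e t with hH1
    obtain ⟨ih1, ih2⟩ := ih (fun t ht => hs t (Multiset.mem_cons_of_mem ht)) H1 (fun t => rfl)
    have hHH : H = fun t => (t - a) * H1 t := by
      funext t; rw [hH t]; simp [hH1, mul_assoc]
    have hab := hs a (Multiset.mem_cons_self a s)
    have hd1 : ∀ t ∈ U, DifferentiableAt ℂ H1 t := by
      intro t ht
      refine DifferentiableAt.mul ?_ (he.differentiableAt (hU.mem_nhds ht))
      clear_value H1
      clear * -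
      induction s using Multiset.induction_on with
      | empty => simp
      | cons b s ih => simp only [Multiset.map_cons, Multiset.prod_cons]; exact DifferentiableAt.mul (by fun_prop) ih
    have hne : ∀ t ∈ sphere c r, t - a ≠ 0 := by
      intro t ht h
      rw [sub_eq_zero] at h; subst h
      rw [mem_ball] at hab; rw [mem_sphere] at ht; linarith
    have hne1 : ∀ t ∈ sphere c r, H1 t ≠ 0 := by
      intro t ht
      refine mul_ne_zero ?_ (he0 t (sphere_subset_closedBall ht))
      intro hx
      rw [Multiset.prod_eq_zero_iff] at hx
      obtain ⟨b, hb, h⟩ := Multiset.mem_map.1 hx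
      rw [sub_eq_zero] at h; subst h
      have := hs t (Multiset.mem_cons_of_mem hb)
      rw [mem_ball] at this; rw [mem_sphere] at ht; linarith
    have heq : EqOn (fun t => g t * (deriv H t / H t)) (fun t => (t - a)⁻¹ • g t + g t * (deriv H1 t / H1 t)) (sphere c r) := by
      intro t ht
      have hdt : deriv H t = H1 t + (t - a) * deriv H1 t := by
        rw [hHH]
        have := ((hasDerivAt_id t).sub_const a).mul (hd1 t (hss ht)).hasDerivAt
        refine this.deriv.trans ?_
        simp
      have h1 := hne t ht
      have h2 := hne1 t ht
      simp only [smul_eq_mul]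
      rw [hdt, hHH]
      field_simp
    have hc2 : ContinuousOn (fun t => (t - a)⁻¹ • g t) (sphere c r) :=
      ContinuousOn.smul (ContinuousOn.inv₀ (by fun_prop) hne) (hg.continuousOn.mono hss)
    refine ⟨(hc2.add ih1).congr heq, ?_⟩
    rw [circleIntegral.integral_congr hr.le heq, circleIntegral.integral_add (hc2.circleIntegrable hr.le) (ih1.circleIntegrable hr.le), ih2]
    rw [DiffContOnCl.circleIntegral_sub_inv_smul ((hg.mono hsub).diffContOnCl_ball subset_rfl) hab]
    simp; ring

end fileB2

section fileB3
open Set Filter Topology Metric MeasureTheory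

theorem msprod_exp {b : ℂ} (hb : b ≠ 0) (s : Multiset ℂ) (g : ℂ → ℂ) :
    (∀ t ∈ s, 1 + g t / b ≠ 0) → (s.map fun t => b + g t).prod = b ^ s.card * Complex.exp ((s.map fun t => Complex.log (1 + g t / b)).sum) := by
  induction s using Multiset.induction_on with
  | empty => simp
  | cons a s ih =>
    intro h
    simp only [Multiset.map_cons, Multiset.prod_cons, Multiset.sum_cons, Multiset.card_cons]
    rw [ih fun t ht => h t (Multiset.mem_cons_of_mem ht), Complex.exp_add, Complex.exp_log (h a (Multiset.mem_cons_self a s)), pow_succ]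
    field_simp

theorem wprep {E : Type*} [NormedAddCommGroup E] [NormedSpace ℂ E] [FiniteDimensional ℂ E]
    {H : E × ℂ → ℂ} {G : Set (E × ℂ)} (hG : IsOpen G) (hH : DifferentiableOn ℂ H G) {y0 : E} {c : ℂ}
    (h0 : (y0, c) ∈ G) (hne : ¬ ∀ᶠ t in 𝓝 c, H (y0, t) = 0) {δ : ℝ} (hδ : 0 < δ) :
    ∃ (r η : ℝ) (s : E → Multiset ℂ) (d : ℕ), 0 < r ∧ r < δ ∧ 0 < η ∧ η < δ ∧
      (∀ y ∈ closedBall y0 η, ∀ t ∈ closedBall c r, (y, t) ∈ G) ∧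
      (∀ y ∈ ball y0 η, (s y).card = d) ∧
      (∀ y ∈ ball y0 η, ∀ t, t ∈ s y ↔ t ∈ ball c r ∧ H (y, t) = 0) ∧
      (∃ e : ℂ → ℂ, DifferentiableAt ℂ e c ∧ ∀ t, H (y0, t) = (t - c) ^ d * e t) ∧
      ∀ g : E × ℂ → ℂ, DifferentiableOn ℂ g G →
        DifferentiableOn ℂ (fun y => ((s y).map fun t => g (y, t)).sum) (ball y0 η) ∧
        DifferentiableOn ℂ (fun y => ((s y).map fun t => g (y, t)).prod) (ball y0 η) := by
  haveI : ProperSpace E := FiniteDimensional.proper ℂ E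
  have hsl : ∀ y, IsOpen {t : ℂ | (y, t) ∈ G} := fun y => hG.preimage (by fun_prop)
  have hHs : ∀ y, DifferentiableOn ℂ (fun t => H (y, t)) {t : ℂ | (y, t) ∈ G} := fun y =>
    hH.comp (by fun_prop) fun t ht => ht
  obtain ⟨ρ, hρ, hρδ, hρG⟩ : ∃ ρ > 0, ρ ≤ δ ∧ ∀ t ∈ ball c ρ, (y0, t) ∈ G ∧ (t ≠ c → H (y0, t) ≠ 0) := by
    have hA : AnalyticAt ℂ (fun t => H (y0, t)) c := (hHs y0).analyticAt ((hsl y0).mem_nhds h0)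
    have h1 := hA.eventually_eq_zero_or_eventually_ne_zero.resolve_left hne
    rw [eventually_nhdsWithin_iff] at h1
    have h2 : ∀ᶠ t in 𝓝 c, (y0, t) ∈ G ∧ (t ≠ c → H (y0, t) ≠ 0) := Filter.Eventually.and ((hsl y0).mem_nhds h0) h1
    obtain ⟨ρ, hρ, h⟩ := Metric.eventually_nhds_iff_ball.1 h2
    exact ⟨min ρ δ, by positivity, min_le_right _ _, fun t ht => h t (ball_subset_ball (min_le_left _ _) ht)⟩
  set G0 : Set (E × ℂ) := {p ∈ G | H p ≠ 0} with hG0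
  have hG0o : IsOpen G0 := hH.continuousOn.isOpen_inter_preimage hG isOpen_ne
  set r := ρ / 4 with hr
  have hr0 : 0 < r := by positivity
  obtain ⟨η, hη, hηδ, hη1, hη2⟩ : ∃ η > 0, η < δ ∧ (∀ y ∈ closedBall y0 η, ∀ t ∈ closedBall c (ρ/2), (y, t) ∈ G) ∧
      ∀ y ∈ closedBall y0 η, ∀ t ∈ sphere c r, (y, t) ∈ G0 := by
    obtain ⟨u, v, hu, hv, hyu, hsv, huv⟩ := generalized_tube_lemma (isCompact_singleton (x := y0)) (isCompact_closedBall c (ρ/2)) hG (by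
      rintro ⟨y, t⟩ ⟨hy, ht⟩
      rw [mem_singleton_iff] at hy; simp only at hy; subst hy
      exact (hρG t (closedBall_subset_ball (by linarith) ht)).1)
    obtain ⟨u', v', hu', hv', hyu', hsv', huv'⟩ := generalized_tube_lemma (isCompact_singleton (x := y0)) (isCompact_sphere c r) hG0o (by
      rintro ⟨y, t⟩ ⟨hy, ht⟩
      rw [mem_singleton_iff] at hy; simp only at hy; subst hy
      have htb : t ∈ ball c ρ := by rw [mem_sphere] at ht; rw [mem_ball]; simp only at ht; linarith
      refine ⟨(hρG t htb).1, (hρG t htb).2 ?_⟩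
      rintro rfl
      rw [mem_sphere, dist_self] at ht; linarith)
    obtain ⟨η, hη, hsub⟩ := Metric.isOpen_iff.1 (hu.inter hu') y0 ⟨hyu rfl, hyu' rfl⟩
    refine ⟨min (η/2) (δ/2), by positivity, (min_le_right _ _).trans_lt (by linarith), fun y hy t ht => ?_, fun y hy t ht => ?_⟩
    · exact huv ⟨(hsub (closedBall_subset_ball ((min_le_left _ _).trans_lt (by linarith)) hy)).1, hsv ht⟩
    · exact huv' ⟨(hsub (closedBall_subset_ball ((min_le_left _ _).trans_lt (by linarith)) hy)).2, hsv' ht⟩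
  have hbc : ball y0 η ⊆ closedBall y0 η := ball_subset_closedBall
  have hfac : ∀ y, y ∈ ball y0 η → ∃ (s : Multiset ℂ) (e : ℂ → ℂ), (∀ t, t ∈ s ↔ t ∈ ball c r ∧ H (y, t) = 0) ∧
      DifferentiableOn ℂ e (ball c (ρ/2)) ∧ (∀ t ∈ closedBall c r, e t ≠ 0) ∧ ∀ t, H (y, t) = (s.map fun a => t - a).prod * e t := by
    intro y hy
    exact factor_disc (H := fun t => H (y, t)) hr0 (by rw [hr]; linarith)
      ((hHs y).mono fun t ht => hη1 y (hbc hy) t (ball_subset_closedBall ht)) fun t ht => (hη2 y (hbc hy) t ht).2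
  choose! s e hs1 hs2 hs3 hs4 using hfac
  have hcr : closedBall c r ⊆ ball c (ρ/2) := closedBall_subset_ball (by rw [hr]; linarith)
  -- sums
  have hsum : ∀ (g : E × ℂ → ℂ) (Gg : Set (E × ℂ)), IsOpen Gg → DifferentiableOn ℂ g Gg →
      (∀ y ∈ ball y0 η, ∀ t ∈ closedBall c r, (y, t) ∈ Gg) →
      DifferentiableOn ℂ (fun y => ((s y).map fun t => g (y, t)).sum) (ball y0 η) := by
    intro g Gg hGg hg hsubg
    have hΦ : DifferentiableOn ℂ (fun p : E × ℂ => g p * (fderiv ℂ H p (0, 1) / H p)) (Gg ∩ G0) := by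
      intro p hp
      have h1 := hg.differentiableAt (hGg.mem_nhds hp.1)
      have h2 := hH.differentiableAt (hG.mem_nhds hp.2.1)
      have h3 := (diff_dir hG hH (0, 1)).differentiableAt (hG.mem_nhds hp.2.1)
      simp only [div_eq_mul_inv]
      exact (h1.mul (h3.mul (h2.inv hp.2.2))).differentiableWithinAt
    intro y hy
    have hd := (diff_circle (c := c) (r := r) (y0 := y) (hGg.inter hG0o) hΦ hr0.le
      (fun t ht => ⟨hsubg y hy t (sphere_subset_closedBall ht), hη2 y (hbc hy) t ht⟩)).const_mul (2 * Real.pi * Complex.I : ℂ)⁻¹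
    refine (hd.congr_of_eventuallyEq ?_).differentiableWithinAt
    filter_upwards [isOpen_ball.mem_nhds hy] with y hy
    have hUo : IsOpen ({t : ℂ | (y, t) ∈ Gg} ∩ ball c (ρ/2)) := (hGg.preimage (by fun_prop)).inter isOpen_ball
    have := (rootsum (c := c) (r := r) (e := e y) (g := fun t => g (y, t)) hr0 hUo
      (fun t ht => ⟨hsubg y hy t ht, hcr ht⟩) ((hs2 y hy).mono inter_subset_right) (hs3 y hy)
      (hg.comp (by fun_prop) fun t ht => ht.1) (s y) (fun t ht => ((hs1 y hy t).1 ht).1) (fun t => H (y, t)) (hs4 y hy)).2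
    have h2 : (∮ t in C(c, r), g (y, t) * (fderiv ℂ H (y, t) (0, 1) / H (y, t))) = ∮ t in C(c, r), g (y, t) * (deriv (fun t => H (y, t)) t / H (y, t)) := by
      refine circleIntegral.integral_congr hr0.le fun t ht => ?_
      have h3 : HasDerivAt (fun t => H (y, t)) (fderiv ℂ H (y, t) (0, 1)) t := by
        have h4 : HasFDerivAt H (fderiv ℂ H (y, t)) (y, t) :=
          (hH.differentiableAt (hG.mem_nhds (hη2 y (hbc hy) t ht).1)).hasFDerivAt
        exact h4.comp_hasDerivAt t ((hasDerivAt_const t y).prodMk (hasDerivAt_id t))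
      rw [h3.deriv]
    rw [h2, this, inv_mul_cancel_left₀]
    simp [Real.pi_ne_zero, Complex.I_ne_zero]
  -- card
  have hcard : ∀ y ∈ ball y0 η, (s y).card = (s y0).card := by
    have h1 := hsum (fun _ => 1) G hG (differentiableOn_const _) (fun y hy t ht => hη1 y (hbc hy) t (ball_subset_closedBall (hcr ht)))
    have h2 : ContinuousOn (fun y => ((s y).card : ℝ)) (ball y0 η) := by
      have := Complex.continuous_re.comp_continuousOn h1.continuousOn
      refine this.congr fun y hy => ?_
      simp
    have h3 : ContinuousOn (fun y => (s y).card) (ball y0 η) :=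
      (Nat.isClosedEmbedding_coe_real.isEmbedding.continuousOn_iff).2 h2
    intro y hy
    exact (convex_ball y0 η).isPreconnected.constant h3 hy (mem_ball_self hη)
  refine ⟨r, η, s, (s y0).card, hr0, by linarith, hη, hηδ, fun y hy t ht => hη1 y hy t (ball_subset_closedBall (hcr ht)), hcard, hs1, ?_, ?_⟩
  · have hy0 : y0 ∈ ball y0 η := mem_ball_self hη
    refine ⟨e y0, (hs2 y0 hy0).differentiableAt (ball_mem_nhds _ (by positivity)), fun t => ?_⟩
    rw [hs4 y0 hy0 t]
    congr 1
    have : s y0 = Multiset.replicate (s y0).card c := by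
      rw [Multiset.eq_replicate]
      refine ⟨rfl, fun b hb => ?_⟩
      obtain ⟨h1, h2⟩ := (hs1 y0 hy0 b).1 hb
      by_contra hbc
      exact (hρG b (ball_subset_ball (by rw [hr]; linarith) h1)).2 hbc h2
    rw [this]; simp
  · intro g hg
    have hGs : ∀ y ∈ ball y0 η, ∀ t ∈ closedBall c r, (y, t) ∈ G := fun y hy t ht => hη1 y (hbc hy) t (ball_subset_closedBall (hcr ht))
    refine ⟨hsum g G hG hg hGs, ?_⟩
    obtain ⟨B, hB⟩ : ∃ B, ∀ p ∈ closedBall y0 η ×ˢ closedBall c r, ‖g p‖ ≤ B :=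
      ((isCompact_closedBall y0 η).prod (isCompact_closedBall c r)).exists_bound_of_continuousOn
        (hg.continuousOn.mono fun p hp => hη1 p.1 hp.1 p.2 (ball_subset_closedBall (hcr hp.2)))
    have hB0 : 0 ≤ B := (norm_nonneg _).trans (hB (y0, c) ⟨mem_closedBall_self hη.le, mem_closedBall_self hr0.le⟩)
    set d := (s y0).card with hd
    set b : ℕ → ℂ := fun k => ((B + 1 + k : ℝ) : ℂ) with hb
    have hbp : ∀ k : ℕ, 0 < B + 1 + (k:ℝ) := fun k => by positivity
    have hb0 : ∀ k, b k ≠ 0 := fun k => by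
      rw [hb]; simp only [ne_eq, Complex.ofReal_eq_zero]; exact (hbp k).ne'
    have hbinj : Set.InjOn b (Finset.range (d+1) : Set ℕ) := by
      intro k _ l _ h
      simp only [hb, Complex.ofReal_inj] at h
      exact_mod_cast (by linarith : (k:ℝ) = l)
    have hsp : ∀ k : ℕ, ∀ y ∈ ball y0 η, ∀ t ∈ closedBall c r, 1 + g (y, t) / b k ∈ Complex.slitPlane := by
      intro k y hy t ht
      refine Complex.mem_slitPlane_of_norm_lt_one ?_
      rw [norm_div, hb]
      simp only [Complex.norm_real, Real.norm_eq_abs, abs_of_pos (hbp k)]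
      rw [div_lt_one (hbp k)]
      have := hB (y, t) ⟨hbc hy, ht⟩
      have : (0:ℝ) ≤ k := by positivity
      linarith
    have hprod : ∀ y ∈ ball y0 η, ((s y).map fun t => g (y, t)).prod =
        ∑ k ∈ Finset.range (d+1), (b k) ^ d * Complex.exp (((s y).map fun t => Complex.log (1 + g (y, t) / b k)).sum) *
          (Lagrange.basis (Finset.range (d+1)) b k).eval 0 := by
      intro y hy
      set P : Polynomial ℂ := ((s y).map fun t => Polynomial.X + Polynomial.C (g (y, t))).prod with hP
      have hdeg : P.degree < ((Finset.range (d+1)).card : ℕ) := by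
        have : P.natDegree = d := by
          rw [hP, Polynomial.natDegree_multiset_prod_of_monic]
          · simp [hcard y hy]
          · intro f hf
            obtain ⟨t, -, rfl⟩ := Multiset.mem_map.1 hf
            exact Polynomial.monic_X_add_C _
        refine lt_of_le_of_lt Polynomial.degree_le_natDegree ?_
        rw [this, Finset.card_range]; exact_mod_cast Nat.lt_succ_self d
      have hev : ∀ z, P.eval z = ((s y).map fun t => z + g (y, t)).prod := by
        intro z
        rw [hP, ← Polynomial.coe_evalRingHom, map_multiset_prod, Multiset.map_map]
        simp
      have h1 := Lagrange.eq_interpolate hbinj hdeg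
      have h2 := congrArg (Polynomial.eval 0) h1
      rw [hev 0, Lagrange.interpolate_apply, Polynomial.eval_finset_sum] at h2
      simp only [zero_add] at h2
      rw [h2]
      refine Finset.sum_congr rfl fun k _ => ?_
      rw [Polynomial.eval_mul, Polynomial.eval_C, hev]
      congr 1
      rw [← hcard y hy]
      refine msprod_exp (hb0 k) _ _ fun t ht => ?_
      exact Complex.slitPlane_ne_zero (hsp k y hy t (ball_subset_closedBall ((hs1 y hy t).1 ht).1))
    have hd2 : DifferentiableOn ℂ (fun y => ∑ k ∈ Finset.range (d+1), (b k) ^ d * Complex.exp (((s y).map fun t => Complex.log (1 + g (y, t) / b k)).sum) *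
          (Lagrange.basis (Finset.range (d+1)) b k).eval 0) (ball y0 η) := by
      refine DifferentiableOn.fun_sum fun k _ => ?_
      refine DifferentiableOn.mul_const (DifferentiableOn.const_mul (DifferentiableOn.cexp ?_) _) _
      set Gk : Set (E × ℂ) := {p ∈ G | 1 + g p / b k ∈ Complex.slitPlane}
      have hGko : IsOpen Gk := by
        refine ContinuousOn.isOpen_inter_preimage (f := fun p => 1 + g p / b k) ?_ hG Complex.isOpen_slitPlane
        have := hg.continuousOn
        fun_prop
      refine hsum (fun p => Complex.log (1 + g p / b k)) Gk hGko ?_ ?_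
      · intro p hp
        have := hg.differentiableAt (hG.mem_nhds hp.1)
        have h2 : DifferentiableAt ℂ (fun p => 1 + g p / b k) p := by
          simp only [div_eq_mul_inv]
          exact (this.mul_const _).const_add 1
        exact (h2.clog hp.2).differentiableWithinAt
      · intro y hy t ht
        exact ⟨hGs y hy t ht, hsp k y hy t ht⟩
    exact hd2.congr hprod

end fileB3

section fileB4
open Set Filter Topology Metric MeasureTheory

theorem common_root (s : Multiset ℂ) (k : ℕ) (h : ℂ → Fin k → ℂ)
    (hz : ∀ l : Fin (s.card * k + 1), ∃ t ∈ s, ∑ j : Fin k, ((l : ℕ) : ℂ) ^ (j : ℕ) * h t j = 0) :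
    ∃ t ∈ s, ∀ j, h t j = 0 := by
  by_contra hcon
  push Not at hcon
  set P : ℂ → Polynomial ℂ := fun t => ∑ j : Fin k, Polynomial.C (h t j) * Polynomial.X ^ (j : ℕ) with hP
  have hP0 : ∀ t ∈ s, P t ≠ 0 := by
    intro t ht h0
    obtain ⟨j, hj⟩ := hcon t ht
    apply hj
    have := congrArg (fun p => Polynomial.coeff p j) h0
    simp only [hP, Polynomial.finset_sum_coeff, Polynomial.coeff_C_mul, Polynomial.coeff_X_pow, Polynomial.coeff_zero] at this
    rw [Finset.sum_eq_single j] at this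
    · simpa using this
    · intro b _ hb
      rw [if_neg, mul_zero]
      exact fun h => hb (Fin.ext h.symm)
    · simp
  have hPd : ∀ t, (P t).natDegree ≤ k := fun t =>
    Polynomial.natDegree_sum_le_of_forall_le _ _ fun j _ => (Polynomial.natDegree_C_mul_X_pow_le _ _).trans j.2.le
  have hQ : (s.map P).prod = 0 := by
    refine Polynomial.eq_zero_of_natDegree_lt_card_of_eval_eq_zero (ι := Fin (s.card * k + 1)) _ (f := fun l => ((l : ℕ) : ℂ))
      (fun a b hab => Fin.ext (by simpa using hab)) ?_ ?_
    · intro l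
      obtain ⟨t, ht, h0⟩ := hz l
      obtain ⟨q, hq⟩ := Multiset.dvd_prod (Multiset.mem_map_of_mem P ht)
      rw [hq, Polynomial.eval_mul]
      have : (P t).eval ((l : ℕ) : ℂ) = 0 := by
        rw [← h0, hP]; simp only [Polynomial.eval_finset_sum, Polynomial.eval_mul, Polynomial.eval_C, Polynomial.eval_pow, Polynomial.eval_X]
        exact Finset.sum_congr rfl fun _ _ => mul_comm _ _
      rw [this, zero_mul]
    · rw [Fintype.card_fin]
      refine Nat.lt_succ_of_le ((Polynomial.natDegree_multiset_prod_le _).trans ?_)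
      refine (Multiset.sum_le_card_nsmul _ k ?_).trans (by simp)
      intro x hx
      simp only [Multiset.map_map, Multiset.mem_map] at hx
      obtain ⟨t, -, rfl⟩ := hx
      exact hPd t
  rw [Multiset.prod_eq_zero_iff] at hQ
  obtain ⟨t, ht, h0⟩ := Multiset.mem_map.1 hQ
  exact hP0 t ht h0

section EE
variable {E : Type*} [NormedAddCommGroup E] [NormedSpace ℂ E] [FiniteDimensional ℂ E]

theorem E1 {k : ℕ} {H : Fin k → E × ℂ → ℂ} {G : Set (E × ℂ)} (hG : IsOpen G) (hH : ∀ j, DifferentiableOn ℂ (H j) G)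
    {y0 : E} {c : ℂ} (h0 : (y0, c) ∈ G) (j1 : Fin k) (hne : ¬ ∀ᶠ t in 𝓝 c, H j1 (y0, t) = 0) {δ : ℝ} (hδ : 0 < δ) :
    ∃ (r η : ℝ) (k' : ℕ) (R : Fin k' → E → ℂ), 0 < r ∧ r < δ ∧ 0 < η ∧ η < δ ∧
      (∀ y ∈ closedBall y0 η, ∀ t ∈ closedBall c r, (y, t) ∈ G) ∧
      (∀ l, DifferentiableOn ℂ (R l) (ball y0 η)) ∧
      ∀ y ∈ ball y0 η, (∀ l, R l y = 0) ↔ ∃ t ∈ ball c r, ∀ j, H j (y, t) = 0 := by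
  obtain ⟨r, η, s, d, hr, hrδ, hη, hηδ, hsub, hcard, hs, -, hg⟩ := wprep hG (hH j1) h0 hne hδ
  refine ⟨r, η, d * k + 1, fun l y => ((s y).map fun t => ∑ j : Fin k, ((l : ℕ) : ℂ) ^ (j : ℕ) * H j (y, t)).prod, hr, hrδ, hη, hηδ, hsub,
    fun l => (hg (fun p => ∑ j : Fin k, ((l : ℕ) : ℂ) ^ (j : ℕ) * H j p) (DifferentiableOn.fun_sum fun j _ => (hH j).const_mul _)).2, ?_⟩
  intro y hy
  constructor
  · intro h
    obtain ⟨t, ht, htz⟩ := common_root (s y) k (fun t j => H j (y, t)) (by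
      intro l
      have := h (Fin.cast (by rw [hcard y hy]) l)
      rw [Multiset.prod_eq_zero_iff] at this
      obtain ⟨t, ht, h0⟩ := Multiset.mem_map.1 this
      exact ⟨t, ht, h0⟩)
    exact ⟨t, ((hs y hy t).1 ht).1, htz⟩
  · rintro ⟨t, ht, h⟩ l
    refine Multiset.prod_eq_zero (Multiset.mem_map.2 ⟨t, (hs y hy t).2 ⟨ht, h j1⟩, ?_⟩)
    simp [h]

theorem Emulti (m : ℕ) : ∀ {k : ℕ} {H : Fin k → E × (Fin m → ℂ) → ℂ} {G : Set (E × (Fin m → ℂ))} (_ : IsOpen G)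
    (_ : ∀ j, DifferentiableOn ℂ (H j) G) {y0 : E} {v0 : Fin m → ℂ} (_ : (y0, v0) ∈ G) {δ : ℝ} (_ : 0 < δ)
    (_ : ∀ v ∈ ball v0 δ, (y0, v) ∈ G → (∀ j, H j (y0, v) = 0) → v = v0),
    ∃ (η : ℝ) (O : Set (Fin m → ℂ)) (k' : ℕ) (R : Fin k' → E → ℂ), 0 < η ∧ IsOpen O ∧ v0 ∈ O ∧ O ⊆ ball v0 δ ∧
      (∀ y ∈ ball y0 η, ∀ v ∈ O, (y, v) ∈ G) ∧ (∀ l, DifferentiableOn ℂ (R l) (ball y0 η)) ∧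
      ∀ y ∈ ball y0 η, (∀ l, R l y = 0) ↔ ∃ v ∈ O, ∀ j, H j (y, v) = 0 := by
  induction m with
  | zero =>
    intro k H G hG hH y0 v0 h0 δ hδ hiso
    have hc : Continuous fun y : E => (y, v0) := by fun_prop
    obtain ⟨η, hη, hs⟩ := Metric.isOpen_iff.1 (hG.preimage hc) y0 h0
    refine ⟨η, univ, k, fun j y => H j (y, v0), hη, isOpen_univ, trivial, fun v _ => ?_, fun y hy v _ => ?_, fun l => ?_, fun y hy => ?_⟩
    · rw [Subsingleton.elim v v0]; exact mem_ball_self hδ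
    · rw [Subsingleton.elim v v0]; exact hs hy
    · exact (hH l).comp (by fun_prop) hs
    · constructor
      · intro h; exact ⟨v0, trivial, h⟩
      · rintro ⟨v, -, h⟩; rwa [Subsingleton.elim v v0] at h
  | succ m ih =>
    intro k H G hG hH y0 v0 h0 δ hδ hiso
    set Φ : (E × (Fin m → ℂ)) × ℂ → E × (Fin (m+1) → ℂ) := fun p => (p.1.1, Fin.cons p.2 p.1.2) with hΦ
    have hΦd : Differentiable ℂ Φ := by
      refine Differentiable.prodMk (by fun_prop) ?_
      rw [differentiable_pi]
      intro i
      refine Fin.cases ?_ (fun i => ?_) i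
      · simp only [Fin.cons_zero]; fun_prop
      · simp only [Fin.cons_succ]; fun_prop
    have hv0 : Fin.cons (v0 0) (Fin.tail v0) = v0 := Fin.cons_self_tail v0
    have hG1 : IsOpen (Φ ⁻¹' G) := hG.preimage hΦd.continuous
    have hdist : ∀ (t : ℂ) (v : Fin m → ℂ) {e : ℝ}, 0 < e → dist t (v0 0) < e → dist v (Fin.tail v0) < e → dist (Fin.cons t v : Fin (m+1) → ℂ) v0 < e := by
      intro t v e he h1 h2
      rw [dist_pi_lt_iff he]
      intro i
      refine Fin.cases ?_ (fun i => ?_) i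
      · simpa using h1
      · exact (dist_le_pi_dist v (Fin.tail v0) i).trans_lt h2
    have hj : ∃ j1, ¬ ∀ᶠ t in 𝓝 (v0 0), (H j1 ∘ Φ) ((y0, Fin.tail v0), t) = 0 := by
      by_contra hcon
      push Not at hcon
      have h1 : ∀ᶠ t in 𝓝 (v0 0), ∀ j, (H j ∘ Φ) ((y0, Fin.tail v0), t) = 0 := eventually_all.2 hcon
      have hcc : Continuous fun t : ℂ => Φ ((y0, Fin.tail v0), t) := hΦd.continuous.comp (by fun_prop)
      have h2 : ∀ᶠ t in 𝓝 (v0 0), Φ ((y0, Fin.tail v0), t) ∈ G := hcc.continuousAt.eventually (hG.mem_nhds (by simpa [hΦ, hv0] using h0))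
      have h3 : ∀ᶠ t in 𝓝 (v0 0), t = v0 0 := by
        filter_upwards [h1, h2, ball_mem_nhds (v0 0) hδ] with t ht1 ht2 ht3
        have := hiso (Fin.cons t (Fin.tail v0)) (hdist t _ hδ ht3 (by simpa using hδ)) ht2 ht1
        simpa using congrFun this 0
      have h4 : ({v0 0} : Set ℂ) ∈ 𝓝 (v0 0) := h3
      exact absurd (isOpen_singleton_iff_nhds_eq_pure (v0 0) |>.2 (le_antisymm (le_pure_iff.2 h4) (pure_le_nhds _))) (not_isOpen_singleton _)
    obtain ⟨j1, hj1⟩ := hj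
    obtain ⟨r, η, k1, R, hr, hrδ, hη, hηδ, hsub, hR, hRz⟩ := E1 (y0 := (y0, Fin.tail v0)) (c := v0 0) (H := fun j => H j ∘ Φ) hG1
      (fun j => (hH j).comp hΦd.differentiableOn fun p hp => hp) (by simpa [hΦ, hv0] using h0) j1 hj1 hδ
    obtain ⟨η', O, k', R', hη', hO, hvO, hOb, hOG, hR', hR'z⟩ := ih (H := R) (G := ball (y0, Fin.tail v0) η) isOpen_ball hR
      (y0 := y0) (v0 := Fin.tail v0) (mem_ball_self hη) hη (by
        intro v hv hvb hz
        obtain ⟨t, ht, h⟩ := (hRz (y0, v) hvb).1 hz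
        have := hiso (Fin.cons t v) (hdist t v hδ (ht.trans hrδ) (hv.trans hηδ)) (hsub (y0, v) (ball_subset_closedBall hvb) t (ball_subset_closedBall ht)) h
        rw [← this, Fin.tail_cons])
    refine ⟨η', {v | v 0 ∈ ball (v0 0) r ∧ Fin.tail v ∈ O}, k', R', hη', ?_, ⟨mem_ball_self hr, hvO⟩, ?_, ?_, hR', ?_⟩
    · refine (isOpen_ball.preimage (by fun_prop)).inter (hO.preimage ?_)
      exact continuous_pi fun i => by simp only [Fin.tail]; fun_prop
    · rintro v ⟨hv1, hv2⟩
      rw [← Fin.cons_self_tail v]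
      exact hdist _ _ hδ (hv1.trans hrδ) ((hOb hv2 : dist _ _ < η).trans hηδ)
    · rintro y hy v ⟨hv1, hv2⟩
      have := hsub (y, Fin.tail v) (ball_subset_closedBall (hOG y hy _ hv2)) (v 0) (ball_subset_closedBall hv1)
      simpa [hΦ] using this
    · intro y hy
      rw [hR'z y hy]
      constructor
      · rintro ⟨v, hv, hz⟩
        obtain ⟨t, ht, h⟩ := (hRz (y, v) (hOG y hy v hv)).1 hz
        exact ⟨Fin.cons t v, ⟨by simpa using ht, by simpa using hv⟩, h⟩
      · rintro ⟨v, ⟨hv1, hv2⟩, h⟩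
        refine ⟨Fin.tail v, hv2, (hRz (y, Fin.tail v) (hOG y hy _ hv2)).2 ⟨v 0, hv1, fun j => ?_⟩⟩
        simpa [hΦ] using h j

theorem EmultiV {V : Type*} [NormedAddCommGroup V] [NormedSpace ℂ V] [FiniteDimensional ℂ V] {ι : Type*} [Fintype ι]
    {H : ι → E × V → ℂ} {G : Set (E × V)} (hG : IsOpen G) (hH : ∀ j, DifferentiableOn ℂ (H j) G) {y0 : E} {v0 : V}
    (h0 : (y0, v0) ∈ G) {O0 : Set V} (hO0 : IsOpen O0) (hv0 : v0 ∈ O0)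
    (hiso : ∀ v ∈ O0, (y0, v) ∈ G → (∀ j, H j (y0, v) = 0) → v = v0) :
    ∃ (η : ℝ) (O : Set V) (k' : ℕ) (R : Fin k' → E → ℂ), 0 < η ∧ IsOpen O ∧ v0 ∈ O ∧ O ⊆ O0 ∧
      (∀ y ∈ ball y0 η, ∀ v ∈ O, (y, v) ∈ G) ∧ (∀ l, DifferentiableOn ℂ (R l) (ball y0 η)) ∧
      ∀ y ∈ ball y0 η, (∀ l, R l y = 0) ↔ ∃ v ∈ O, ∀ j, H j (y, v) = 0 := by
  let e : V ≃L[ℂ] (Fin (Module.finrank ℂ V) → ℂ) := ContinuousLinearEquiv.ofFinrankEq (by simp)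
  let f := Fintype.equivFin ι
  have hc : Differentiable ℂ fun p : E × (Fin (Module.finrank ℂ V) → ℂ) => (p.1, e.symm p.2) := by fun_prop
  obtain ⟨δ, hδ, hs⟩ := Metric.isOpen_iff.1 (hO0.preimage e.symm.continuous) (e v0) (by simpa using hv0)
  obtain ⟨η, O, k', R, hη, hO, hvO, hOb, hOG, hR, hRz⟩ := Emulti (Module.finrank ℂ V) (H := fun j p => H (f.symm j) (p.1, e.symm p.2))
    (hG.preimage hc.continuous) (fun j => (hH _).comp hc.differentiableOn fun p hp => hp) (y0 := y0) (v0 := e v0) (by simpa using h0) hδ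
    (fun v hv hvG hz => by
      rw [← hiso (e.symm v) (hs hv) hvG fun j => by simpa using hz (f j), e.apply_symm_apply])
  refine ⟨η, e ⁻¹' O, k', R, hη, hO.preimage e.continuous, hvO, fun v hv => by simpa using hs (hOb hv), fun y hy v hv => by simpa using hOG y hy _ hv, hR, fun y hy => ?_⟩
  rw [hRz y hy]
  constructor
  · rintro ⟨v, hv, hz⟩
    exact ⟨e.symm v, by simpa using hv, fun j => by simpa using hz (f j)⟩
  · rintro ⟨v, hv, hz⟩
    exact ⟨e v, hv, fun j => by simpa using hz _⟩

end EE

theorem isol_dich {P : Set ℂ} {c : ℂ} {p : ℕ} (Q : Fin p → Set ℂ) (hP : ∀ᶠ y in 𝓝 c, y ∈ P ↔ ∃ i, y ∈ Q i)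
    (hQ : ∀ i, ∃ (k : ℕ) (R : Fin k → ℂ → ℂ), (∀ l, AnalyticAt ℂ (R l) c) ∧ ∀ᶠ y in 𝓝 c, (y ∈ Q i ↔ ∀ l, R l y = 0)) :
    P ∈ 𝓝 c ∨ Pᶜ ∈ 𝓝[≠] c := by
  have h1 : ∀ i, Q i ∈ 𝓝 c ∨ (Q i)ᶜ ∈ 𝓝[≠] c := by
    intro i
    obtain ⟨k, R, hR, h⟩ := hQ i
    by_cases hall : ∀ l, ∀ᶠ y in 𝓝 c, R l y = 0
    · left
      filter_upwards [h, eventually_all.2 hall] with y hy hy2 using hy.2 hy2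
    · right
      obtain ⟨l, hl⟩ := not_forall.1 hall
      filter_upwards [h.filter_mono nhdsWithin_le_nhds, (hR l).eventually_eq_zero_or_eventually_ne_zero.resolve_left hl] with y hy hy2 hyQ
      exact hy2 (hy.1 hyQ l)
  by_cases hi : ∃ i, Q i ∈ 𝓝 c
  · obtain ⟨i, hi⟩ := hi
    left
    filter_upwards [hP, hi] with y hy hy2 using hy.2 ⟨i, hy2⟩
  · right
    push Not at hi
    have h2 : ∀ᶠ y in 𝓝[≠] c, ∀ i, y ∈ (Q i)ᶜ := eventually_all.2 fun i => (h1 i).resolve_left (hi i)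
    filter_upwards [hP.filter_mono nhdsWithin_le_nhds, h2] with y hy hy2 hyP
    obtain ⟨i, hi⟩ := hy.1 hyP
    exact hy2 i hi

theorem finite_of_dich {P : Set ℂ} (hc : IsCompact P) (h : ∀ c ∈ P, P ∈ 𝓝 c ∨ Pᶜ ∈ 𝓝[≠] c) : P.Finite := by
  have hcl : IsClosed (interior P) := by
    refine isClosed_of_closure_subset fun c hcc => ?_
    have hcP : c ∈ P := hc.isClosed.closure_subset_iff.2 interior_subset hcc
    rcases h c hcP with h | h
    · exact mem_interior_iff_mem_nhds.2 h
    · by_contra hni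
      have h2 : ∃ᶠ y in 𝓝 c, y ∈ interior P := mem_closure_iff_frequently.1 hcc
      rw [mem_nhdsWithin_iff_eventually] at h
      obtain ⟨y, hy1, hy2⟩ := (h2.and_eventually h).exists
      exact hy2 (fun (h : y = c) => hni (h ▸ hy1)) (interior_subset hy1)
  have hint : interior P = ∅ := by
    rcases isClopen_iff.1 (⟨hcl, isOpen_interior⟩ : IsClopen (interior P)) with h | h
    · exact h
    · exfalso
      have : P = univ := univ_subset_iff.1 (h ▸ interior_subset)
      exact NoncompactSpace.noncompact_univ (X := ℂ) (this ▸ hc)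
  refine hc.finite (isDiscrete_iff_nhdsNE.2 fun c hcP => ?_)
  rcases h c hcP with h | h
  · exact absurd (mem_interior_iff_mem_nhds.2 h) (by simp [hint])
  · rw [inf_principal_eq_bot]; exact h

theorem compact_analytic_finite (m : ℕ) : ∀ {Z : Set (Fin m → ℂ)} (_ : IsCompact Z)
    (_ : ∀ z ∈ Z, ∃ (W : Set (Fin m → ℂ)) (k : ℕ) (F : Fin k → (Fin m → ℂ) → ℂ), IsOpen W ∧ z ∈ W ∧
      (∀ i, DifferentiableOn ℂ (F i) W) ∧ ∀ w ∈ W, w ∈ Z ↔ ∀ i, F i w = 0), Z.Finite := by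
  induction m with
  | zero => intro Z _ _; exact Set.toFinite Z
  | succ m ih =>
    intro Z hZ hloc
    have hΦd : Differentiable ℂ fun p : ℂ × (Fin m → ℂ) => (Fin.cons p.1 p.2 : Fin (m+1) → ℂ) := by
      rw [differentiable_pi]
      intro i
      refine Fin.cases ?_ (fun i => ?_) i
      · simp only [Fin.cons_zero]; fun_prop
      · simp only [Fin.cons_succ]; fun_prop
    have htc : Continuous fun v : Fin (m+1) → ℂ => (Fin.tail v : Fin m → ℂ) := continuous_pi fun i => by simp only [Fin.tail]; fun_prop
    have hfib : ∀ c : ℂ, {v : Fin m → ℂ | (Fin.cons c v : Fin (m+1) → ℂ) ∈ Z}.Finite := by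
      intro c
      have hd : Differentiable ℂ fun v : Fin m → ℂ => (Fin.cons c v : Fin (m+1) → ℂ) := hΦd.comp (f := fun v => (c, v)) (by fun_prop)
      refine ih ?_ ?_
      · refine (hZ.image htc).of_isClosed_subset (hZ.isClosed.preimage hd.continuous) fun v hv => ⟨_, hv, Fin.tail_cons _ _⟩
      · intro v hv
        obtain ⟨W, k, F, hW, hvW, hF, hFz⟩ := hloc _ hv
        exact ⟨_, k, fun i w => F i (Fin.cons c w), hW.preimage hd.continuous, hvW, fun i => (hF i).comp hd.differentiableOn fun w hw => hw, fun w hw => hFz _ hw⟩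
    have hP : ((fun z : Fin (m+1) → ℂ => z 0) '' Z).Finite := by
      refine finite_of_dich (hZ.image (by fun_prop)) ?_
      intro c _
      have hv : ∀ v ∈ {v : Fin m → ℂ | (Fin.cons c v : Fin (m+1) → ℂ) ∈ Z}, ∃ (η : ℝ) (O : Set (Fin m → ℂ)) (k' : ℕ) (R : Fin k' → ℂ → ℂ), 0 < η ∧ IsOpen O ∧ v ∈ O ∧
          (∀ l, DifferentiableOn ℂ (R l) (ball c η)) ∧ ∀ y ∈ ball c η, (∀ l, R l y = 0) ↔ ∃ v ∈ O, (Fin.cons y v : Fin (m+1) → ℂ) ∈ Z := by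
        intro v hv
        obtain ⟨W, k, F, hW, hvW, hF, hFz⟩ := hloc _ hv
        obtain ⟨O0, hO0, h0⟩ : ∃ O0, IsOpen O0 ∧ O0 ∩ {v : Fin m → ℂ | (Fin.cons c v : Fin (m+1) → ℂ) ∈ Z} = {v} := by
          have hcl := ((hfib c).subset (diff_subset (t := {v}))).isClosed
          refine ⟨_, hcl.isOpen_compl, ?_⟩
          ext w
          simp only [mem_inter_iff, mem_compl_iff, mem_diff, mem_singleton_iff, mem_setOf_eq]
          constructor
          · rintro ⟨h1, h2⟩; by_contra h3; exact h1 ⟨h2, h3⟩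
          · rintro rfl; exact ⟨fun h => h.2 rfl, hv⟩
        obtain ⟨η, O, k', R, hη, hO, hvO, -, hOG, hR, hRz⟩ := EmultiV (H := fun i p => F i (Fin.cons p.1 p.2)) (hW.preimage hΦd.continuous)
          (fun i => (hF i).comp hΦd.differentiableOn fun p hp => hp) (y0 := c) (v0 := v) hvW hO0 (h0.symm.subset rfl).1
          (fun w hw hwW hz => by
            have : w ∈ O0 ∩ {v : Fin m → ℂ | (Fin.cons c v : Fin (m+1) → ℂ) ∈ Z} := ⟨hw, (hFz _ hwW).2 hz⟩
            rw [h0] at this; exact this)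
        refine ⟨η, O, k', R, hη, hO, hvO, hR, fun y hy => (hRz y hy).trans (exists_congr fun w => and_congr_right fun hw => ?_)⟩
        exact (hFz _ (hOG y hy w hw)).symm
      choose! η O k' R hη hO hvO hR hRz using hv
      obtain ⟨p, g, hg⟩ : ∃ (p : ℕ) (g : Fin p → (Fin m → ℂ)), range g = {v : Fin m → ℂ | (Fin.cons c v : Fin (m+1) → ℂ) ∈ Z} := by
        obtain ⟨n, g, hg⟩ := (hfib c).fin_embedding
        exact ⟨n, g, hg⟩
      have hgm : ∀ i, g i ∈ {v : Fin m → ℂ | (Fin.cons c v : Fin (m+1) → ℂ) ∈ Z} := fun i => hg ▸ mem_range_self i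
      refine isol_dich (fun i => {y | ∃ v ∈ O (g i), (Fin.cons y v : Fin (m+1) → ℂ) ∈ Z}) ?_ ?_
      · have hK : IsCompact (Z ∩ {z | ∃ i, Fin.tail z ∈ O (g i)}ᶜ) := by
          refine hZ.inter_right (IsOpen.isClosed_compl ?_)
          rw [setOf_exists]
          exact isOpen_iUnion fun i => (hO _ (hgm i)).preimage htc
        have hne : ∀ᶠ y in 𝓝 c, y ∉ (fun z : Fin (m+1) → ℂ => z 0) '' (Z ∩ {z | ∃ i, Fin.tail z ∈ O (g i)}ᶜ) := by
          refine (hK.image (by fun_prop)).isClosed.isOpen_compl.mem_nhds ?_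
          rintro ⟨z, ⟨hz, hz2⟩, rfl⟩
          have : Fin.tail z ∈ range g := by rw [hg]; simpa using hz
          obtain ⟨i, hi⟩ := this
          exact hz2 ⟨i, hi ▸ hvO _ (hgm i)⟩
        filter_upwards [hne] with y hy
        constructor
        · rintro ⟨z, hz, rfl⟩
          by_contra hcon
          refine hy ⟨z, ⟨hz, fun ⟨i, hi⟩ => hcon ⟨i, Fin.tail z, hi, by simpa using hz⟩⟩, rfl⟩
        · rintro ⟨i, v, -, hz⟩
          exact ⟨_, hz, by simp⟩
      · intro i
        have hb := ball_mem_nhds c (hη _ (hgm i))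
        refine ⟨_, R (g i), fun l => (hR _ (hgm i) l).analyticAt hb, ?_⟩
        filter_upwards [hb] with y hy
        exact (hRz _ (hgm i) y hy).symm
    refine (hP.biUnion fun c _ => (hfib c).image (fun v => (Fin.cons c v : Fin (m+1) → ℂ))).subset fun z hz => ?_
    simp only [mem_iUnion]
    exact ⟨z 0, ⟨z, hz, rfl⟩, Fin.tail z, by simpa using hz, by simp⟩

theorem compact_analytic_finiteV {V : Type*} [NormedAddCommGroup V] [NormedSpace ℂ V] [FiniteDimensional ℂ V]
    {Z : Set V} (hZ : IsCompact Z) (hloc : ∀ z ∈ Z, ∃ (W : Set V) (k : ℕ) (F : Fin k → V → ℂ), IsOpen W ∧ z ∈ W ∧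
      (∀ i, DifferentiableOn ℂ (F i) W) ∧ ∀ w ∈ W, w ∈ Z ↔ ∀ i, F i w = 0) : Z.Finite := by
  let e : V ≃L[ℂ] (Fin (Module.finrank ℂ V) → ℂ) := ContinuousLinearEquiv.ofFinrankEq (by simp)
  have hfin : (e '' Z).Finite := by
    refine compact_analytic_finite _ (hZ.image e.continuous) ?_
    rintro _ ⟨z, hz, rfl⟩
    obtain ⟨W, k, F, hW, hzW, hF, hFz⟩ := hloc z hz
    refine ⟨e.symm ⁻¹' W, k, fun i w => F i (e.symm w), hW.preimage e.symm.continuous, by simpa using hzW,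
      fun i => (hF i).comp e.symm.differentiable.differentiableOn fun w hw => hw, fun w hw => ?_⟩
    rw [← hFz _ hw]
    constructor
    · rintro ⟨z, hz, rfl⟩; simpa using hz
    · intro h; exact ⟨_, h, by simp⟩
  exact hfin.of_finite_image e.injective.injOn

end fileB4

section fileB5
open Set Filter Topology Metric MeasureTheory

theorem geom_kernel {s t a : ℂ} (h1 : s ≠ a) (h2 : s ≠ t) (K : ℕ) :
    (s - t)⁻¹ = ∑ k ∈ Finset.range K, (t - a) ^ k / (s - a) ^ (k+1) + ((t - a) / (s - a)) ^ K * (s - t)⁻¹ := by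
  have e1 := sub_ne_zero.2 h1
  have e2 := sub_ne_zero.2 h2
  induction K with
  | zero => simp
  | succ K ih =>
    rw [Finset.sum_range_succ]
    nth_rw 1 [ih]
    rw [add_assoc]
    congr 1
    rw [div_pow, div_pow]
    field_simp
    ring

theorem poly_approx (n : ℕ) : ∀ {H : (Fin n → ℂ) → ℂ} {Ω : Set (Fin n → ℂ)} (_ : IsOpen Ω) (_ : DifferentiableOn ℂ H Ω)
    {w : Fin n → ℂ} {r : ℝ} (_ : 0 < r) (_ : closedBall w r ⊆ Ω) {ε : ℝ} (_ : 0 < ε),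
    ∃ P : MvPolynomial (Fin n) ℂ, ∀ z ∈ closedBall w r, ‖H z - MvPolynomial.eval z P‖ ≤ ε := by
  induction n with
  | zero =>
    intro H Ω _ _ w r hr hs ε hε
    refine ⟨MvPolynomial.C (H w), fun z _ => ?_⟩
    rw [Subsingleton.elim z w]; simpa using hε.le
  | succ n ih =>
    intro H Ω hΩ hH w r hr hs ε hε
    have hΦd : Differentiable ℂ fun p : (Fin n → ℂ) × ℂ => (Fin.cons p.2 p.1 : Fin (n+1) → ℂ) := by
      rw [differentiable_pi]
      intro i
      refine Fin.cases ?_ (fun i => ?_) i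
      · simp only [Fin.cons_zero]; fun_prop
      · simp only [Fin.cons_succ]; fun_prop
    obtain ⟨δ, hδ, hδs⟩ := (isCompact_closedBall w r).exists_cthickening_subset_open hΩ hs
    set r' := r + δ with hr'
    have hr'0 : 0 < r' := by positivity
    have hs' : closedBall w r' ⊆ Ω := by
      refine Subset.trans (fun z hz => ?_) hδs
      rw [cthickening_closedBall hδ.le hr.le]; rw [mem_closedBall] at hz ⊢; linarith
    have hcons : ∀ v ∈ closedBall (Fin.tail w) r', ∀ t ∈ closedBall (w 0) r', (Fin.cons t v : Fin (n+1) → ℂ) ∈ closedBall w r' := by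
      intro v hv t ht
      rw [mem_closedBall, dist_pi_le_iff hr'0.le]
      intro i
      refine Fin.cases ?_ (fun i => ?_) i
      · simpa using ht
      · exact (dist_le_pi_dist v (Fin.tail w) i).trans hv
    obtain ⟨B, hB⟩ : ∃ B, ∀ z ∈ closedBall w r', ‖H z‖ ≤ B := (isCompact_closedBall w r').exists_bound_of_continuousOn (hH.continuousOn.mono hs')
    have hB0 : 0 ≤ B := (norm_nonneg _).trans (hB w (mem_closedBall_self hr'0.le))
    obtain ⟨K, hK⟩ : ∃ K : ℕ, r' * (B * ((r / r') ^ K * δ⁻¹)) ≤ ε / 2 := by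
      have h1 : Tendsto (fun K : ℕ => r' * (B * ((r / r') ^ K * δ⁻¹))) atTop (𝓝 (r' * (B * (0 * δ⁻¹)))) :=
        (((tendsto_pow_atTop_nhds_zero_of_lt_one (by positivity) (by rw [div_lt_one hr'0]; linarith)).mul_const _).const_mul _).const_mul _
      have h2 : r' * (B * (0 * δ⁻¹)) < ε / 2 := by simp; positivity
      exact ((h1.eventually (gt_mem_nhds h2)).exists).imp fun _ h => h.le
    set a : ℕ → (Fin n → ℂ) → ℂ := fun k v => (2 * Real.pi * Complex.I : ℂ)⁻¹ * ∮ s in C(w 0, r'), H (Fin.cons s v) * ((s - w 0) ^ (k+1))⁻¹ with ha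
    have had : ∀ k, DifferentiableOn ℂ (a k) (ball (Fin.tail w) r') := by
      intro k v hv
      refine (DifferentiableAt.const_mul ?_ _).differentiableWithinAt
      have := diff_circle (Φ := fun p : (Fin n → ℂ) × ℂ => H (Fin.cons p.2 p.1) * ((p.2 - w 0) ^ (k+1))⁻¹)
        (G := {p | (Fin.cons p.2 p.1 : Fin (n+1) → ℂ) ∈ Ω ∧ p.2 ≠ w 0}) ((hΩ.preimage hΦd.continuous).inter (isOpen_ne_fun (by fun_prop) (by fun_prop)))
        (by
          intro p hp
          have h1 : DifferentiableAt ℂ (fun p : (Fin n → ℂ) × ℂ => H (Fin.cons p.2 p.1)) p :=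
            (hH.differentiableAt (hΩ.mem_nhds hp.1)).comp p (hΦd p)
          have h2 : DifferentiableAt ℂ (fun p : (Fin n → ℂ) × ℂ => ((p.2 - w 0) ^ (k+1))⁻¹) p :=
            DifferentiableAt.inv (by fun_prop) (pow_ne_zero _ (sub_ne_zero.2 hp.2))
          exact (h1.mul h2).differentiableWithinAt) (c := w 0) hr'0.le (y0 := v)
        (fun t ht => ⟨hs' (hcons v (ball_subset_closedBall hv) t (sphere_subset_closedBall ht)), fun (h : t = w 0) => by
          rw [h, mem_sphere, dist_self] at ht; linarith⟩)
      exact this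
    have hap : ∀ k, ∃ P : MvPolynomial (Fin n) ℂ, ∀ v ∈ closedBall (Fin.tail w) r, ‖a k v - MvPolynomial.eval v P‖ ≤ ε / (2 * (K+1) * r ^ k) :=
      fun k => ih isOpen_ball (had k) hr (closedBall_subset_ball (by linarith)) (by positivity)
    choose P hP using hap
    refine ⟨∑ k ∈ Finset.range K, MvPolynomial.rename Fin.succ (P k) * (MvPolynomial.X 0 - MvPolynomial.C (w 0)) ^ k, fun z hz => ?_⟩
    set t := z 0
    set v : Fin n → ℂ := Fin.tail z
    have hzc : Fin.cons t v = z := Fin.cons_self_tail z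
    have ht : ‖t - w 0‖ ≤ r := by rw [← dist_eq_norm]; exact (dist_le_pi_dist z w 0).trans hz
    have hv : v ∈ closedBall (Fin.tail w) r := by
      rw [mem_closedBall, dist_pi_le_iff hr.le]; exact fun i => (dist_le_pi_dist z w i.succ).trans hz
    have hv' : v ∈ closedBall (Fin.tail w) r' := closedBall_subset_closedBall (by linarith) hv
    have hnorm : ∀ s ∈ sphere (w 0) r', ‖s - w 0‖ = r' := fun s hs => by simpa [dist_eq_norm] using hs
    have hst : ∀ s ∈ sphere (w 0) r', δ ≤ ‖s - t‖ := fun s hs => by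
      have := norm_sub_norm_le (s - w 0) (t - w 0)
      rw [hnorm s hs] at this
      simp only [sub_sub_sub_cancel_right] at this
      linarith
    have hne1 : ∀ s ∈ sphere (w 0) r', s ≠ t := fun s hs h => by
      have := hst s hs; rw [h] at this; simp at this; linarith
    have hne2 : ∀ s ∈ sphere (w 0) r', s ≠ w 0 := fun s hs h => by
      have := hnorm s hs; rw [h] at this; simp at this; linarith
    have hcd : Differentiable ℂ fun s : ℂ => (Fin.cons s v : Fin (n+1) → ℂ) := hΦd.comp (f := fun s => (v, s)) (by fun_prop)
    have hcont : ContinuousOn (fun s => H (Fin.cons s v)) (closedBall (w 0) r') :=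
      (hH.continuousOn.comp hcd.continuous.continuousOn fun s hs => hs' (hcons v hv' s hs))
    have hcs := hcont.mono (sphere_subset_closedBall (x := w 0) (ε := r'))
    have hcau : (∮ s in C(w 0, r'), (s - t)⁻¹ • H (Fin.cons s v)) = (2 * Real.pi * Complex.I : ℂ) • H (Fin.cons t v) := by
      refine DiffContOnCl.circleIntegral_sub_inv_smul (f := fun s => H (Fin.cons s v)) (DifferentiableOn.diffContOnCl ?_) (by rw [mem_ball, dist_eq_norm]; linarith)
      rw [closure_ball _ hr'0.ne']
      exact hH.comp hcd.differentiableOn fun s hs => hs' (hcons v hv' s hs)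
    have hpi : (2 * Real.pi * Complex.I : ℂ) ≠ 0 := by simp [Real.pi_ne_zero, Complex.I_ne_zero]
    have hci1 : ∀ k, CircleIntegrable (fun s => (t - w 0) ^ k * (H (Fin.cons s v) * ((s - w 0) ^ (k+1))⁻¹)) (w 0) r' := fun k => by
      refine ContinuousOn.circleIntegrable hr'0.le ((hcs.mul (ContinuousOn.inv₀ (by fun_prop) ?_)).const_mul _)
      intro s hs; exact pow_ne_zero _ (sub_ne_zero.2 (hne2 s hs))
    have hci2 : CircleIntegrable (fun s => ((t - w 0) / (s - w 0)) ^ K * (s - t)⁻¹ * H (Fin.cons s v)) (w 0) r' := by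
      refine ContinuousOn.circleIntegrable hr'0.le (ContinuousOn.mul (ContinuousOn.mul (ContinuousOn.pow (ContinuousOn.div (by fun_prop) (by fun_prop) ?_) _) (ContinuousOn.inv₀ (by fun_prop) ?_)) hcs)
      · intro s hs; exact (sub_ne_zero.2 (hne2 s hs))
      · intro s hs; exact (sub_ne_zero.2 (hne1 s hs))
    have hkey : H z = ∑ k ∈ Finset.range K, a k v * (t - w 0) ^ k + (2 * Real.pi * Complex.I : ℂ)⁻¹ • ∮ s in C(w 0, r'), ((t - w 0) / (s - w 0)) ^ K * (s - t)⁻¹ * H (Fin.cons s v) := by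
      have h1 : (∮ s in C(w 0, r'), (s - t)⁻¹ • H (Fin.cons s v)) = ∮ s in C(w 0, r'), ((∑ k ∈ Finset.range K, (t - w 0) ^ k * (H (Fin.cons s v) * ((s - w 0) ^ (k+1))⁻¹)) +
          ((t - w 0) / (s - w 0)) ^ K * (s - t)⁻¹ * H (Fin.cons s v)) := by
        refine circleIntegral.integral_congr hr'0.le fun s hs => ?_
        simp only [smul_eq_mul]
        conv_lhs => rw [geom_kernel (hne2 s hs) (hne1 s hs) K]
        rw [add_mul, Finset.sum_mul]
        congr 1
        refine Finset.sum_congr rfl fun k _ => ?_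
        rw [div_eq_mul_inv]; ring
      have h2 : CircleIntegrable (fun s => ∑ k ∈ Finset.range K, (t - w 0) ^ k * (H (Fin.cons s v) * ((s - w 0) ^ (k+1))⁻¹)) (w 0) r' := by
        have := CircleIntegrable.sum (s := Finset.range K) (fun k _ => hci1 k)
        convert this using 1
        ext s; simp
      have h3 : (∮ s in C(w 0, r'), ∑ k ∈ Finset.range K, (t - w 0) ^ k * (H (Fin.cons s v) * ((s - w 0) ^ (k+1))⁻¹)) =
          ∑ k ∈ Finset.range K, ∮ s in C(w 0, r'), (t - w 0) ^ k * (H (Fin.cons s v) * ((s - w 0) ^ (k+1))⁻¹) := circleIntegral.integral_fun_sum fun k _ => hci1 k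
      rw [circleIntegral.integral_add h2 hci2, h3, hcau, hzc] at h1
      rw [← inv_smul_smul₀ hpi (H z), h1, smul_add, Finset.smul_sum]
      congr 1
      refine Finset.sum_congr rfl fun k _ => ?_
      rw [circleIntegral.integral_const_mul, ha, smul_eq_mul]; ring
    have hrem : ‖(2 * Real.pi * Complex.I : ℂ)⁻¹ • ∮ s in C(w 0, r'), ((t - w 0) / (s - w 0)) ^ K * (s - t)⁻¹ * H (Fin.cons s v)‖ ≤ ε / 2 := by
      refine (circleIntegral.norm_two_pi_i_inv_smul_integral_le_of_norm_le_const hr'0.le (C := B * ((r / r') ^ K * δ⁻¹)) fun s hs => ?_).trans hK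
      rw [norm_mul, mul_comm]
      have h1 := hB _ (hcons v hv' s (sphere_subset_closedBall hs))
      rw [norm_mul, norm_pow, norm_div, norm_inv, hnorm s hs]
      have := hst s hs
      gcongr
    have hev : MvPolynomial.eval z (∑ k ∈ Finset.range K, MvPolynomial.rename Fin.succ (P k) * (MvPolynomial.X 0 - MvPolynomial.C (w 0)) ^ k) =
        ∑ k ∈ Finset.range K, MvPolynomial.eval v (P k) * (t - w 0) ^ k := by
      simp only [map_sum, map_mul, map_pow, map_sub, MvPolynomial.eval_X, MvPolynomial.eval_C, MvPolynomial.eval_rename]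
      rfl
    rw [hev, hkey, add_sub_right_comm, ← Finset.sum_sub_distrib]
    have hsumle : ‖∑ k ∈ Finset.range K, (a k v * (t - w 0) ^ k - MvPolynomial.eval v (P k) * (t - w 0) ^ k)‖ ≤ ∑ k ∈ Finset.range K, ε / (2 * (K+1)) := by
      refine norm_sum_le_of_le _ fun k _ => ?_
      rw [← sub_mul, norm_mul, norm_pow]
      calc _ ≤ ε / (2 * (K+1) * r ^ k) * r ^ k := by gcongr; exact hP k v hv
        _ = _ := by field_simp
    rw [Finset.sum_const, Finset.card_range, nsmul_eq_mul] at hsumle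
    have hle2 : (K:ℝ) * (ε / (2 * (K+1))) ≤ ε / 2 := by
      rw [mul_div_assoc', div_le_div_iff₀ (by positivity) (by positivity)]; nlinarith
    exact (norm_add_le _ _).trans (by linarith)

end fileB5

section fileB6
open Set Filter Topology Metric MeasureTheory WeakDual
universe v

section peak
variable {𝔅 : Type v} [NormedCommRing 𝔅] [NormedAlgebra ℂ 𝔅] [CompleteSpace 𝔅]

/-- Joint Gelfand transform. -/
def gel {n : ℕ} (F : Fin n → 𝔅) (m : characterSpace ℂ 𝔅) : Fin n → ℂ := fun i => m (F i)

theorem gel_cont {n : ℕ} (F : Fin n → 𝔅) : Continuous (gel F) := continuous_pi fun i => char_closed_image (F i)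

theorem peakM (K O : Set (characterSpace ℂ 𝔅)) (hK : ∀ (m : characterSpace ℂ 𝔅) (x : 𝔅) (t : ℝ), (∀ k ∈ K, ‖k x‖ ≤ t) → ‖m x‖ ≤ t)
    {n : ℕ} (F : Fin n → 𝔅) (hO : IsOpen O) (hOK : Disjoint O K) {m2 : characterSpace ℂ 𝔅} (hm2 : m2 ∈ O)
    (hb : ∀ m ∈ closure O \ O, gel F m ≠ gel F m2) {H : (Fin n → ℂ) → ℂ} {Ω : Set (Fin n → ℂ)} (hΩ : IsOpen Ω)
    (hH : DifferentiableOn ℂ H Ω) (h2 : gel F m2 ∈ Ω)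
    (hlt : ∀ m ∈ closure O, gel F m ∈ Ω → gel F m ≠ gel F m2 → (H (gel F m)).re < (H (gel F m2)).re) : False := by
  set w2 := gel F m2 with hw2
  have hcomp : IsCompact (closure O \ O) := isClosed_closure.isCompact.diff hO
  obtain ⟨r, hr, hr1, hr2⟩ : ∃ r > 0, closedBall w2 r ⊆ Ω ∧ ∀ m ∈ closure O \ O, gel F m ∉ closedBall w2 r := by
    have h1 : Ω ∩ (gel F '' (closure O \ O))ᶜ ∈ 𝓝 w2 := by
      refine inter_mem (hΩ.mem_nhds h2) ((hcomp.image (gel_cont F)).isClosed.isOpen_compl.mem_nhds ?_)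
      rintro ⟨m, hm, h⟩; exact hb m hm h
    obtain ⟨r, hr, hs⟩ := Metric.nhds_basis_closedBall.mem_iff.1 h1
    exact ⟨r, hr, fun w hw => (hs hw).1, fun m hm hmb => (hs hmb).2 ⟨m, hm, rfl⟩⟩
  set U := O ∩ gel F ⁻¹' ball w2 r with hU
  have hUo : IsOpen U := hO.inter (isOpen_ball.preimage (gel_cont F))
  have hUb : ∀ m ∈ closure U \ U, m ∈ closure O ∧ gel F m ∈ sphere w2 r := by
    rintro m ⟨hm, hmU⟩
    have h1 : m ∈ closure O := closure_mono inter_subset_left hm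
    have h3 : m ∈ gel F ⁻¹' closedBall w2 r :=
      closure_minimal (fun m (hm : m ∈ U) => (ball_subset_closedBall hm.2 : gel F m ∈ _)) (Metric.isClosed_closedBall.preimage (gel_cont F)) hm
    have h4 : m ∈ O := by by_contra h; exact hr2 m ⟨h1, h⟩ h3
    refine ⟨h1, le_antisymm h3 (not_lt.1 fun h => hmU ⟨h4, h⟩)⟩
  obtain ⟨ε, hε, hεm⟩ : ∃ ε > 0, ∀ m ∈ closure U \ U, (H (gel F m)).re < (H w2).re - 2 * ε := by
    have hc2 : IsCompact (closure U \ U) := isClosed_closure.isCompact.diff hUo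
    have hcont : ContinuousOn (fun m => (H (gel F m)).re) (closure U \ U) :=
      Complex.continuous_re.comp_continuousOn (hH.continuousOn.comp (gel_cont F).continuousOn fun m hm => hr1 (sphere_subset_closedBall (hUb m hm).2))
    by_cases hne : (closure U \ U).Nonempty
    · obtain ⟨m1, hm1, hmax⟩ := hc2.exists_isMaxOn hne hcont
      have := hlt m1 (hUb m1 hm1).1 (hr1 (sphere_subset_closedBall (hUb m1 hm1).2)) (fun h => by
        have := (hUb m1 hm1).2; rw [h, mem_sphere, dist_self] at this; linarith)
      refine ⟨((H w2).re - (H (gel F m1)).re) / 4, by linarith, fun m hm => ?_⟩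
      have : (H (gel F m)).re ≤ (H (gel F m1)).re := hmax hm
      linarith
    · exact ⟨1, one_pos, fun m hm => absurd ⟨m, hm⟩ hne⟩
  obtain ⟨Q, hQ⟩ := poly_approx n hΩ hH hr hr1 hε
  have hev : ∀ m : characterSpace ℂ 𝔅, m (MvPolynomial.aeval F Q) = MvPolynomial.eval (gel F m) Q := by
    intro m
    have h1 : m (MvPolynomial.aeval F Q) = ((CharacterSpace.toAlgHom m).comp (MvPolynomial.aeval F)) Q := rfl
    have h2 : ((CharacterSpace.toAlgHom m).comp (MvPolynomial.aeval F)) = MvPolynomial.aeval (gel F m) := by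
      ext i; simp [gel]
    rw [h1, h2]; rfl
  have hre : ∀ m : characterSpace ℂ 𝔅, gel F m ∈ closedBall w2 r → |(H (gel F m)).re - (m (MvPolynomial.aeval F Q)).re| ≤ ε := by
    intro m hm
    rw [hev, ← Complex.sub_re]
    exact (Complex.abs_re_le_norm _).trans (hQ _ hm)
  refine lmp K U hK hUo (hOK.mono_left inter_subset_left) m2 ⟨hm2, mem_ball_self hr⟩ (MvPolynomial.aeval F Q) fun m hm => ?_
  have h3 := abs_le.1 (hre m (sphere_subset_closedBall (hUb m hm).2))
  have h4 := abs_le.1 (hre m2 (mem_closedBall_self hr.le))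
  have h5 := hεm m hm
  rw [← hw2] at h4
  linarith

end peak

/-- Euclidean norm squared. -/
def nsq {k : ℕ} (w : Fin k → ℂ) : ℝ := ∑ j, ‖w j‖ ^ 2

theorem nsq_exp {k : ℕ} (a h : Fin k → ℂ) : nsq (a + h) = nsq a + 2 * (∑ j, (starRingEnd ℂ) (a j) * h j).re + nsq h := by
  simp only [nsq, Complex.re_sum, Finset.mul_sum, ← Finset.sum_add_distrib]
  refine Finset.sum_congr rfl fun j _ => ?_
  simp only [Pi.add_apply, ← Complex.normSq_eq_norm_sq, Complex.normSq_apply, Complex.add_re, Complex.add_im, Complex.mul_re, Complex.conj_re, Complex.conj_im]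
  ring

theorem nsq_ge {k : ℕ} (w : Fin k → ℂ) : ‖w‖ ^ 2 ≤ nsq w := by
  have h0 : 0 ≤ nsq w := Finset.sum_nonneg fun j _ => by positivity
  have : ‖w‖ ≤ Real.sqrt (nsq w) := (pi_norm_le_iff_of_nonneg (Real.sqrt_nonneg _)).2 fun j => by
    refine Real.le_sqrt_of_sq_le ?_
    exact Finset.single_le_sum (f := fun j => ‖w j‖ ^ 2) (fun j _ => by positivity) (Finset.mem_univ j)
  calc ‖w‖ ^ 2 ≤ Real.sqrt (nsq w) ^ 2 := by gcongr
    _ = _ := Real.sq_sqrt h0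

theorem nsq_cont {k : ℕ} : Continuous (nsq : (Fin k → ℂ) → ℝ) := by unfold nsq; fun_prop

/-- The functional `w ↦ ∑ conj (a j) w j`. -/
def cfun {k : ℕ} (a : Fin k → ℂ) : (Fin k → ℂ) →L[ℂ] ℂ := ∑ j, (starRingEnd ℂ) (a j) • ContinuousLinearMap.proj j

theorem cfun_apply {k : ℕ} (a w : Fin k → ℂ) : cfun a w = ∑ j, (starRingEnd ℂ) (a j) * w j := by
  simp [cfun]

theorem maxlog {k : ℕ} {E : Set (Fin k → ℂ)} (hE : IsClosed E) {w0 : Fin k → ℂ} (L0 : (Fin k → ℂ) →L[ℂ] ℂ) {cc : ℝ} (hcc : 0 < cc)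
    {Ω : Set (Fin k → ℂ)} (hΩ : IsOpen Ω) (hw0 : w0 ∈ Ω) (hL : ∀ w ∈ E ∩ Ω, (L0 (w - w0)).re ≤ - cc * nsq (w - w0))
    {R : (Fin k → ℂ) → ℂ} (hR : DifferentiableOn ℂ R Ω) (hf : ∃ᶠ w in 𝓝 w0, w ∈ E ∧ R w ≠ 0) :
    ∃ w2 ∈ E ∩ Ω, R w2 ≠ 0 ∧ ∃ (Ω2 : Set (Fin k → ℂ)) (H : (Fin k → ℂ) → ℂ), IsOpen Ω2 ∧ w2 ∈ Ω2 ∧ Ω2 ⊆ Ω ∧ DifferentiableOn ℂ H Ω2 ∧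
      ∀ w ∈ E ∩ Ω2, w ≠ w2 → (H w).re < (H w2).re := by
  obtain ⟨ρ, hρ, hρΩ⟩ := Metric.nhds_basis_closedBall.mem_iff.1 (hΩ.mem_nhds hw0)
  set lam : (Fin k → ℂ) → ℝ := fun w => (L0 (w - w0)).re + cc / 2 * nsq (w - w0) with hlam
  have hlamc : Continuous lam := by
    have := nsq_cont (k := k)
    simp only [hlam]
    exact ((Complex.continuous_re.comp (L0.continuous.comp (by fun_prop))).add ((this.comp (by fun_prop)).const_smul (cc/2)))
  have hlamE : ∀ w ∈ E ∩ Ω, lam w ≤ - (cc / 2) * nsq (w - w0) := fun w hw => by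
    have := hL w hw; simp only [hlam]; linarith
  obtain ⟨w1, ⟨hw1E, hw1R⟩, hw1l, hw1b⟩ : ∃ w1, (w1 ∈ E ∧ R w1 ≠ 0) ∧ - (cc/4) * ρ^2 < lam w1 ∧ w1 ∈ closedBall w0 ρ := by
    have h1 : ∀ᶠ w in 𝓝 w0, - (cc/4) * ρ^2 < lam w :=
      hlamc.continuousAt.eventually (lt_mem_nhds (by simp [hlam, nsq]; positivity))
    exact (hf.and_eventually (h1.and (closedBall_mem_nhds w0 hρ))).exists
  have hRc : ContinuousOn R (closedBall w0 ρ) := hR.continuousOn.mono hρΩ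
  obtain ⟨B, hB⟩ : ∃ B, ∀ w ∈ closedBall w0 ρ, ‖R w‖ ≤ B := (isCompact_closedBall w0 ρ).exists_bound_of_continuousOn hRc
  obtain ⟨N, hN0, hN⟩ : ∃ N : ℝ, 0 < N ∧ Real.exp (- (N * (cc/4*ρ^2))) * B < ‖R w1‖ := by
    have h1 : Tendsto (fun N : ℝ => Real.exp (- (N * (cc/4*ρ^2))) * B) atTop (𝓝 (0 * B)) :=
      (Real.tendsto_exp_neg_atTop_nhds_zero.comp (tendsto_id.atTop_mul_const (by positivity))).mul_const B
    rw [zero_mul] at h1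
    exact ((eventually_gt_atTop 0).and (h1.eventually (gt_mem_nhds (norm_pos_iff.2 hw1R)))).exists
  have hcp : IsCompact (closedBall w0 ρ ∩ E) := (isCompact_closedBall w0 ρ).inter_right hE
  obtain ⟨w2, ⟨hw2b, hw2E⟩, hmax⟩ := hcp.exists_isMaxOn ⟨w1, hw1b, hw1E⟩ (f := fun w => Real.exp (N * lam w) * ‖R w‖)
    ((Real.continuous_exp.comp (hlamc.const_smul N)).continuousOn.mul (hRc.mono inter_subset_left).norm)
  have hw21 : Real.exp (N * lam w1) * ‖R w1‖ ≤ Real.exp (N * lam w2) * ‖R w2‖ := hmax ⟨hw1b, hw1E⟩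
  have hpos1 : 0 < ‖R w1‖ := norm_pos_iff.2 hw1R
  have hw2R : R w2 ≠ 0 := by
    intro h
    rw [h, norm_zero, mul_zero] at hw21
    have : 0 < Real.exp (N * lam w1) * ‖R w1‖ := by positivity
    linarith
  have hw2i : w2 ∈ ball w0 ρ := by
    by_contra hcon
    have hd : ρ ≤ ‖w2 - w0‖ := by rw [← dist_eq_norm]; exact not_lt.1 hcon
    have h1 : lam w2 ≤ - (cc/2) * ρ^2 := by
      refine (hlamE w2 ⟨hw2E, hρΩ hw2b⟩).trans ?_
      have : ρ^2 ≤ nsq (w2 - w0) := le_trans (by gcongr) (nsq_ge _)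
      nlinarith
    have h2 : Real.exp (N * lam w2) * ‖R w2‖ ≤ Real.exp (N * lam w1) * (Real.exp (- (N * (cc/4*ρ^2))) * B) := by
      rw [← mul_assoc, ← Real.exp_add]
      gcongr
      · nlinarith
      · exact hB w2 hw2b
    have h3 : Real.exp (N * lam w1) * (Real.exp (- (N * (cc/4*ρ^2))) * B) < Real.exp (N * lam w1) * ‖R w1‖ := by gcongr
    linarith
  refine ⟨w2, ⟨hw2E, hρΩ hw2b⟩, hw2R, ball w0 ρ ∩ {w | R w / R w2 ∈ Complex.slitPlane},
    fun w => (N:ℂ) * (L0 w + cc * cfun (w2 - w0) w) + Complex.log (R w / R w2), ?_, ⟨hw2i, by simp [hw2R]⟩,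
    fun w hw => hρΩ (ball_subset_closedBall hw.1), ?_, ?_⟩
  · exact ((hRc.mono ball_subset_closedBall).div_const (R w2)).isOpen_inter_preimage isOpen_ball Complex.isOpen_slitPlane
  · intro w hw
    have h1 := hR.differentiableAt (hΩ.mem_nhds (hρΩ (ball_subset_closedBall hw.1)))
    have h2 : DifferentiableAt ℂ (fun w => R w / R w2) w := by
      simp only [div_eq_mul_inv]; exact h1.mul_const _
    have h3 : DifferentiableAt ℂ (fun w => (N:ℂ) * (L0 w + cc * cfun (w2 - w0) w)) w :=
      (L0.differentiableAt.add ((cfun (w2 - w0)).differentiableAt.const_mul _)).const_mul _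
    exact (h3.add (h2.clog hw.2)).differentiableWithinAt
  · rintro w ⟨hwE, hwb, hws⟩ hne
    have hm : Real.exp (N * lam w) * ‖R w‖ ≤ Real.exp (N * lam w2) * ‖R w2‖ := hmax ⟨ball_subset_closedBall hwb, hwE⟩
    have hRw : R w ≠ 0 := fun h => by simp [h] at hws
    have hp1 := norm_pos_iff.2 hRw
    have hp2 := norm_pos_iff.2 hw2R
    have hlog : N * lam w + Real.log ‖R w‖ ≤ N * lam w2 + Real.log ‖R w2‖ := by
      have := Real.log_le_log (by positivity) hm
      rwa [Real.log_mul (Real.exp_ne_zero _) hp1.ne', Real.log_mul (Real.exp_ne_zero _) hp2.ne', Real.log_exp, Real.log_exp] at this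
    have hq := nsq_exp (w2 - w0) (w - w2)
    rw [show w2 - w0 + (w - w2) = w - w0 by abel, ← cfun_apply] at hq
    have hpos : 0 < nsq (w - w2) := lt_of_lt_of_le (by have := norm_pos_iff.2 (sub_ne_zero.2 hne); positivity) (nsq_ge _)
    simp only [hlam, map_sub, Complex.sub_re] at hlog hq
    simp only [Complex.add_re, Complex.re_ofReal_mul, Complex.log_re, norm_div, norm_div, div_self hp2.ne', Real.log_one, Real.log_div hp1.ne' hp2.ne']
    have h6 : 0 < N * cc * nsq (w - w2) := by positivity
    have h7 : N * (cc * (nsq (w - w0))) = N * cc * (nsq (w2 - w0)) + 2 * (N * cc * ((cfun (w2 - w0) w).re - (cfun (w2 - w0) w2).re)) + N * cc * nsq (w - w2) := by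
      rw [hq]; ring
    nlinarith

section img
variable {𝔅 : Type v} [NormedCommRing 𝔅] [NormedAlgebra ℂ 𝔅] [CompleteSpace 𝔅]

theorem imgM (K : Set (characterSpace ℂ 𝔅)) (hK : ∀ (m : characterSpace ℂ 𝔅) (x : 𝔅) (t : ℝ), (∀ k ∈ K, ‖k x‖ ≤ t) → ‖m x‖ ≤ t)
    {n : ℕ} (F : Fin n → 𝔅) {A : Set (Fin n → ℂ)} (hA : IsClosed A) (hKA : ∀ m ∈ K, gel F m ∈ A)
    (hloc : ∀ m, gel F m ∈ A → ∃ (Ω : Set (Fin n → ℂ)) (p : ℕ) (R : Fin p → (Fin n → ℂ) → ℂ), IsOpen Ω ∧ gel F m ∈ Ω ∧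
      (∀ l, DifferentiableOn ℂ (R l) Ω) ∧ ∀ w ∈ Ω, w ∈ A ↔ ∀ l, R l w = 0) (m : characterSpace ℂ 𝔅) : gel F m ∈ A := by
  by_contra hm
  have hrc : IsCompact (range (gel F)) := isCompact_range (gel_cont F)
  set E := closure (range (gel F) \ A) with hEdef
  have hEr : E ⊆ range (gel F) := closure_minimal diff_subset hrc.isClosed
  have hEc : IsCompact E := hrc.of_isClosed_subset isClosed_closure hEr
  obtain ⟨w0, hw0, hmax⟩ := hEc.exists_isMaxOn ⟨_, subset_closure ⟨mem_range_self m, hm⟩⟩ nsq_cont.continuousOn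
  have hL : ∀ w ∈ E, (cfun w0 (w - w0)).re ≤ - (1/2) * nsq (w - w0) := by
    intro w hw
    have h1 := nsq_exp w0 (w - w0)
    rw [add_sub_cancel, ← cfun_apply] at h1
    have : nsq w ≤ nsq w0 := hmax hw
    linarith
  have hfr : ∃ᶠ w in 𝓝 w0, w ∈ range (gel F) \ A := mem_closure_iff_frequently.1 hw0
  obtain ⟨Ω, R, hΩ, hw0Ω, hRd, hRA, hRf⟩ : ∃ (Ω : Set (Fin n → ℂ)) (R : (Fin n → ℂ) → ℂ), IsOpen Ω ∧ w0 ∈ Ω ∧ DifferentiableOn ℂ R Ω ∧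
      (∀ w ∈ Ω, w ∈ A → R w = 0) ∧ ∃ᶠ w in 𝓝 w0, w ∈ E ∧ R w ≠ 0 := by
    by_cases hwA : w0 ∈ A
    · obtain ⟨m0, rfl⟩ := hEr hw0
      obtain ⟨Ω, p, R, hΩ, h0, hR, hRz⟩ := hloc m0 hwA
      have : ∃ l, ∃ᶠ w in 𝓝 (gel F m0), w ∈ E ∧ R l w ≠ 0 := by
        by_contra hcon
        push Not at hcon
        refine hfr ?_
        filter_upwards [eventually_all.2 hcon, hΩ.mem_nhds h0] with w hw hwΩ hwE
        exact hwE.2 ((hRz w hwΩ).2 fun l => hw l (subset_closure hwE))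
      obtain ⟨l, hl⟩ := this
      exact ⟨Ω, R l, hΩ, h0, hR l, fun w hw hwA => (hRz w hw).1 hwA l, hl⟩
    · exact ⟨Aᶜ, fun _ => 1, hA.isOpen_compl, hwA, differentiableOn_const _, fun w hw hwA => absurd hwA hw, hfr.mono fun w hw => ⟨subset_closure hw, one_ne_zero⟩⟩
  obtain ⟨w2, ⟨hw2E, hw2Ω⟩, hw2R, Ω2, H, hΩ2, hw2Ω2, -, hH, hlt⟩ := maxlog isClosed_closure (cfun w0) (by norm_num : (0:ℝ) < 1/2) hΩ hw0Ω
    (fun w hw => hL w hw.1) hRd hRf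
  have hw2A : w2 ∉ A := fun h => hw2R (hRA w2 hw2Ω h)
  obtain ⟨m2, rfl⟩ := hEr hw2E
  obtain ⟨r, hr, hrA⟩ := Metric.nhds_basis_closedBall.mem_iff.1 (hA.isOpen_compl.mem_nhds hw2A)
  refine peakM K (gel F ⁻¹' ball (gel F m2) r) hK F (isOpen_ball.preimage (gel_cont F)) ?_ (m2 := m2) (mem_ball_self hr) ?_ hΩ2 hH hw2Ω2 ?_
  · rw [Set.disjoint_left]
    intro m hm hmK
    exact hrA (ball_subset_closedBall hm) (hKA m hmK)
  · rintro m ⟨-, hm⟩ h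
    exact hm (by rw [mem_preimage, h]; exact mem_ball_self hr)
  · intro m hm hmΩ hne
    have h3 : m ∈ gel F ⁻¹' closedBall (gel F m2) r :=
      closure_minimal (fun m hm => (ball_subset_closedBall hm : gel F m ∈ _)) (Metric.isClosed_closedBall.preimage (gel_cont F)) hm
    exact hlt _ ⟨subset_closure ⟨mem_range_self m, hrA h3⟩, hmΩ⟩ hne

end img

end fileB6

section fileB7
open Set Filter Topology Metric MeasureTheory

theorem trig_dense {f : ℂ → ℝ} (hf : Continuous f) {ε : ℝ} (hε : 0 < ε) :
    ∃ p : ℂ → ℂ, Differentiable ℂ p ∧ ∀ w, ‖w‖ = 1 → |f w - (p w).re| ≤ ε := by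
  haveI : Fact (0 < 2 * Real.pi) := ⟨Real.two_pi_pos⟩
  let F : C(AddCircle (2 * Real.pi), ℂ) := ⟨fun x => (f (AddCircle.toCircle x : ℂ) : ℂ), by
    have := AddCircle.continuous_toCircle (T := 2 * Real.pi)
    fun_prop⟩
  have h1 : F ∈ (Submodule.span ℂ (range (@fourier (2 * Real.pi)))).topologicalClosure := by
    rw [span_fourier_closure_eq_top]; trivial
  obtain ⟨g, hg, hd⟩ := Metric.mem_closure_iff.1 h1 ε hε
  have key : ∀ c : ℂ, ∃ p : ℂ → ℂ, Differentiable ℂ p ∧ ∀ x : ℝ, (c * g (x : AddCircle (2 * Real.pi))).re =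
      (p (Complex.exp (x * Complex.I))).re := by
    refine Submodule.span_induction (p := fun g _ => ∀ c : ℂ, ∃ p : ℂ → ℂ, Differentiable ℂ p ∧ ∀ x : ℝ,
      (c * g (x : AddCircle (2 * Real.pi))).re = (p (Complex.exp (x * Complex.I))).re) ?_ ?_ ?_ ?_ hg
    · rintro _ ⟨n, rfl⟩ c
      have hF : ∀ (n : ℤ) (x : ℝ), fourier n (x : AddCircle (2 * Real.pi)) = Complex.exp (x * Complex.I) ^ n := by
        intro n x
        rw [fourier_coe_apply, ← Complex.exp_int_mul]
        congr 1
        have : (Real.pi : ℂ) ≠ 0 := by exact_mod_cast Real.pi_ne_zero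
        push_cast
        field_simp
      obtain ⟨m, rfl | rfl⟩ := n.eq_nat_or_neg
      · refine ⟨fun w => c * w ^ m, by fun_prop, fun x => ?_⟩
        rw [hF]; simp
      · refine ⟨fun w => (starRingEnd ℂ) c * w ^ m, by fun_prop, fun x => ?_⟩
        rw [fourier_neg, hF]
        conv_lhs => rw [← Complex.conj_re]
        simp
    · exact fun c => ⟨fun _ => 0, by fun_prop, fun x => by simp⟩
    · intro g1 g2 _ _ h1 h2 c
      obtain ⟨p1, d1, e1⟩ := h1 c
      obtain ⟨p2, d2, e2⟩ := h2 c
      exact ⟨fun w => p1 w + p2 w, by fun_prop, fun x => by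
        simp only [ContinuousMap.add_apply, mul_add, Complex.add_re, e1, e2]⟩
    · intro a g1 _ h1 c
      obtain ⟨p1, d1, e1⟩ := h1 (c * a)
      exact ⟨p1, d1, fun x => by rw [← e1]; simp [mul_assoc]⟩
  obtain ⟨p, dp, ep⟩ := key 1
  refine ⟨p, dp, fun w hw => ?_⟩
  have hw' : Complex.exp (w.arg * Complex.I) = w := by
    have := Complex.norm_mul_exp_arg_mul_I w
    rwa [hw, Complex.ofReal_one, one_mul] at this
  have h3 := ep w.arg
  rw [hw', one_mul] at h3
  rw [← h3]
  have h4 := (ContinuousMap.dist_apply_le_dist (f := F) (g := g) (w.arg : AddCircle (2 * Real.pi))).trans hd.le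
  have h5 : F (w.arg : AddCircle (2 * Real.pi)) = (f w : ℂ) := by
    simp only [F, ContinuousMap.coe_mk]
    rw [AddCircle.toCircle_apply_mk, div_self Real.two_pi_pos.ne', one_mul, Circle.coe_exp, hw']
  rw [h5, Complex.dist_eq] at h4
  have := (Complex.abs_re_le_norm _).trans h4
  simpa using this

theorem taylor2 {E : Type*} [NormedAddCommGroup E] [NormedSpace ℝ E] {r : E → ℝ} (h : ContDiff ℝ 2 r) (z : E) :
    ∃ (l : E →L[ℝ] ℝ) (B : E →L[ℝ] E →L[ℝ] ℝ),
      (fun h => r (z + h) - r z - l h - B h h / 2) =o[𝓝 0] fun h => ‖h‖ ^ 2 := by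
  have hs : IsSymmSndFDerivAt ℝ r z := h.contDiffAt.isSymmSndFDerivAt (by simp)
  have hd : Differentiable ℝ r := h.differentiable (by norm_num)
  have hd1 : Differentiable ℝ (fderiv ℝ r) := (h.fderiv_right (m := 1) (by norm_num)).differentiable (by norm_num)
  refine ⟨fderiv ℝ r z, fderiv ℝ (fderiv ℝ r) z, ?_⟩
  set l := fderiv ℝ r z
  set B := fderiv ℝ (fderiv ℝ r) z with hB
  have h1 : ∀ x ∈ (univ : Set E), HasFDerivWithinAt (fun h => r (z + h) - l h - B h h / 2)
      (fderiv ℝ r (z + x) - l - B x) univ x := by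
    intro x _
    rw [hasFDerivWithinAt_univ]
    have a1 : HasFDerivAt (fun h => r (z + h)) (fderiv ℝ r (z + x)) x := by
      have := (hd (z + x)).hasFDerivAt.comp x ((hasFDerivAt_id x).const_add z)
      rw [ContinuousLinearMap.comp_id] at this; exact this
    have a2 := (B.hasFDerivAt (x := x)).clm_apply (hasFDerivAt_id x)
    have a3 := (a1.sub (l.hasFDerivAt (x := x))).sub (a2.const_mul (1/2 : ℝ))
    convert! a3 using 1
    · funext y; simp; ring
    · ext y
      have : B y x = B x y := hs y x
      simp [this]; ring
  have h2 : (fun x => fderiv ℝ r (z + x) - l - B x) =o[𝓝[univ] 0] fun x => ‖x - 0‖ ^ 1 := by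
    rw [nhdsWithin_univ]
    have := (hasFDerivAt_iff_isLittleO_nhds_zero.1 (hd1 z).hasFDerivAt)
    simpa using this.norm_right
  have h3 := convex_univ.isLittleO_pow_succ (mem_univ 0) h1 h2
  rw [nhdsWithin_univ] at h3
  refine (h3.congr (fun x => ?_) fun x => by simp)
  simp; ring

theorem quadC {E : Type*} [NormedAddCommGroup E] [NormedSpace ℂ E] [FiniteDimensional ℂ E] (B : E →L[ℝ] E →L[ℝ] ℝ) :
    ∃ Q : E → ℂ, Differentiable ℂ Q ∧ (∀ (w : ℂ) h, Q (w • h) = w ^ 2 * Q h) ∧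
      (∀ h, B h h / 2 = (Q h).re + (B h h + B (Complex.I • h) (Complex.I • h)) / 4) ∧
      ∀ (w : ℂ) h, B (w • h) (w • h) + B (Complex.I • w • h) (Complex.I • w • h) =
        ‖w‖ ^ 2 * (B h h + B (Complex.I • h) (Complex.I • h)) := by
  have dec : ∀ (w : ℂ) (h : E), w • h = w.re • h + w.im • (Complex.I • h) := fun w h => by
    conv_lhs => rw [← Complex.re_add_im w]
    rw [add_smul, mul_smul]; rfl
  have dec2 : ∀ (w : ℂ) (h : E), Complex.I • w • h = w.re • (Complex.I • h) - w.im • h := fun w h => by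
    rw [dec w, smul_add, smul_comm, smul_comm Complex.I w.im, smul_smul Complex.I, Complex.I_mul_I]
    simp [sub_eq_add_neg]
  let T : E →ₗ[ℂ] E →ₗ[ℂ] ℂ := LinearMap.mk₂ ℂ (fun h k => ((B h k - B (Complex.I • h) (Complex.I • k) : ℝ) : ℂ) / 4 -
      Complex.I * ((B (Complex.I • h) k + B h (Complex.I • k) : ℝ) : ℂ) / 4)
    (fun a b c => by simp; ring) (fun w a b => by
      simp only [dec2 w a]
      rw [dec w a]
      apply Complex.ext <;> simp <;> ring) (fun a b c => by simp; ring) (fun w a b => by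
      simp only [dec2 w b]
      rw [dec w b]
      apply Complex.ext <;> simp <;> ring)
  refine ⟨fun h => T h h, ?_, fun w h => by simp; ring, fun h => ?_, fun w h => ?_⟩
  · let T' : E →L[ℂ] E →L[ℂ] ℂ := LinearMap.toContinuousLinearMap (LinearMap.toContinuousLinearMap.toLinearMap.comp T)
    have : (fun h => T h h) = fun h => T' h h := by funext h; simp [T']
    rw [this]; fun_prop
  · simp [T]; ring
  · rw [dec2, dec, ← Complex.normSq_eq_norm_sq, Complex.normSq_apply]
    simp; ring

theorem submean {E : Type*} [NormedAddCommGroup E] [NormedSpace ℂ E] {v : E → ℝ} (hv : Continuous v) {z b : E}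
    (h : ∀ p : ℂ → ℂ, Differentiable ℂ p → (∀ w, ‖w‖ = 1 → v (z + w • b) ≤ (p w).re) → v z ≤ (p 0).re) :
    v z ≤ Real.circleAverage (fun w => v (z + w • b)) 0 1 := by
  refine le_of_forall_pos_le_add fun ε hε => ?_
  have hc : Continuous fun w : ℂ => v (z + w • b) := by fun_prop
  obtain ⟨p, dp, hp⟩ := trig_dense hc (half_pos hε)
  have h1 := h (fun w => p w + (ε / 2 : ℝ)) (by fun_prop) fun w hw => by
    have := abs_le.1 (hp w hw); simp; linarith [this.2]
  have h2 : Real.circleAverage (fun w => (p w).re) 0 1 = (p 0).re := by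
    have h3 : Real.circleAverage p 0 1 = p 0 := dp.diffContOnCl.circleAverage
    have := Complex.reCLM.circleAverage_comp_comm (f := p) (c := 0) (R := 1) dp.continuous.continuousOn.circleIntegrable'
    simpa [Function.comp_def, h3] using this
  have h4 : Real.circleAverage (fun w => (p w).re) 0 1 ≤ Real.circleAverage (fun w => v (z + w • b) + ε / 2) 0 1 := by
    apply Real.circleAverage_mono
    · exact (Complex.continuous_re.comp dp.continuous).continuousOn.circleIntegrable'
    · exact (hc.add continuous_const).continuousOn.circleIntegrable'
    · intro w hw
      have := abs_le.1 (hp w (by simpa using hw))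
      linarith [this.1]
  have h5 : Real.circleAverage (fun w => v (z + w • b) + ε / 2) 0 1 = Real.circleAverage (fun w => v (z + w • b)) 0 1 + ε / 2 := by
    have := Real.circleAverage_add (f₁ := fun w => v (z + w • b)) (f₂ := fun _ => ε / 2) (c := 0) (R := 1)
      hc.continuousOn.circleIntegrable' continuousOn_const.circleIntegrable'
    rw [Real.circleAverage_const] at this
    exact this
  simp at h1
  linarith

end fileB7

section fileB8
open Set Filter Topology Metric MeasureTheory

theorem mollify {E : Type*} [NormedAddCommGroup E] [NormedSpace ℂ E] [FiniteDimensional ℂ E] {v : E → ℝ} {C A γ η : ℝ}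
    (hC : 0 < C) (hA : ∀ x, |v x| ≤ A)
    (hv : ∀ x y, |v x - v y| ≤ C * ‖x - y‖) (hγ : 0 < γ) (hη : 0 < η) :
    ∃ r : E → ℝ, ContDiff ℝ 2 r ∧ (∀ z, |r z - v z| ≤ γ) ∧ ∀ z b : E,
      (∀ t, ‖t‖ < η → v (z + t) ≤ Real.circleAverage (fun w => v (z + t + w • b)) 0 1) →
        r z ≤ Real.circleAverage (fun w => r (z + w • b)) 0 1 := by
  letI : MeasurableSpace E := borel E
  haveI : BorelSpace E := ⟨rfl⟩
  haveI : FiniteDimensional ℝ E := FiniteDimensional.complexToReal E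
  let μ : Measure E := Measure.addHaar
  have hvc : Continuous v := by
    refine LipschitzWith.continuous (K := ⟨C, hC.le⟩) (LipschitzWith.of_dist_le_mul fun x y => ?_)
    rw [Real.dist_eq, dist_eq_norm]; exact hv x y
  have hm : 0 < min η (γ / C) := lt_min hη (div_pos hγ hC)
  let φ : ContDiffBump (0 : E) := ⟨min η (γ / C) / 2, min η (γ / C), half_pos hm, half_lt_self hm⟩
  let χ := φ.normed μ
  have hχ0 : ∀ t, 0 ≤ χ t := fun t => φ.nonneg_normed t
  have hχc : Continuous χ := φ.continuous_normed
  have hχs : HasCompactSupport χ := φ.hasCompactSupport_normed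
  have hχi : Integrable χ μ := hχc.integrable_of_hasCompactSupport hχs
  let r : E → ℝ := convolution χ v (ContinuousLinearMap.lsmul ℝ ℝ) μ
  have hr : ∀ z, r z = ∫ t, χ t * v (z - t) ∂μ := fun z => rfl
  refine ⟨r, ?_, fun z => ?_, fun z b hb => ?_⟩
  · exact (hχs.contDiff_convolution_left (n := 2) _ φ.contDiff_normed hvc.locallyIntegrable)
  · have := φ.dist_normed_convolution_le (μ := μ) (g := v) (x₀ := z) (ε := γ) hvc.aestronglyMeasurable fun x hx => by
      rw [Real.dist_eq]
      have h2 : ‖x - z‖ < γ / C := by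
        rw [← dist_eq_norm]; exact (mem_ball.1 hx).trans_le (min_le_right _ _)
      calc |v x - v z| ≤ C * ‖x - z‖ := hv x z
        _ ≤ C * (γ / C) := by gcongr
        _ = γ := by field_simp
    rwa [Real.dist_eq] at this
  · have hci : Integrable (fun t => χ t * v (z - t)) μ :=
      (hχc.mul (by fun_prop)).integrable_of_hasCompactSupport hχs.mul_right
    let f : ℝ → E → ℝ := fun θ t => χ t * v (z + circleMap 0 1 θ • b - t)
    have hcm : Continuous (circleMap 0 1) := continuous_circleMap 0 1
    have hfi : Integrable (Function.uncurry f) ((volume.restrict (uIoc 0 (2 * Real.pi))).prod μ) := by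
      haveI : IsFiniteMeasure (volume.restrict (uIoc 0 (2 * Real.pi))) :=
        ⟨by rw [Measure.restrict_apply_univ, uIoc_of_le Real.two_pi_pos.le, Real.volume_Ioc]; exact ENNReal.ofReal_lt_top⟩
      have h1 := Integrable.mul_prod (integrable_const (μ := volume.restrict (uIoc 0 (2 * Real.pi))) (1:ℝ)) hχi
      have h2 := h1.mul_bdd (g := fun q : ℝ × E => v (z + circleMap 0 1 q.1 • b - q.2)) (c := A)
        (Continuous.aestronglyMeasurable (by fun_prop)) (Eventually.of_forall fun q => by
          rw [Real.norm_eq_abs]; exact hA _)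
      refine h2.congr (Eventually.of_forall fun q => ?_)
      simp [f, Function.uncurry]
    have hsw := intervalIntegral_integral_swap hfi
    have e1 : Real.circleAverage (fun w => r (z + w • b)) 0 1 =
        ∫ t, χ t * Real.circleAverage (fun w => v (z + (-t) + w • b)) 0 1 ∂μ := by
      simp only [Real.circleAverage, smul_eq_mul]
      have : ∀ θ, r (z + circleMap 0 1 θ • b) = ∫ t, f θ t ∂μ := fun θ => hr _
      simp only [this]
      rw [hsw, ← integral_const_mul]
      congr 1
      funext t
      simp only [f, intervalIntegral.integral_const_mul]
      have : ∀ θ, z + circleMap 0 1 θ • b - t = z + -t + circleMap 0 1 θ • b := fun θ => by abel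
      simp only [this]
      ring
    rw [e1, hr]
    refine integral_mono hci ?_ fun t => ?_
    · have := hfi.integral_prod_right
      have h3 := this.const_mul (2 * Real.pi)⁻¹
      refine h3.congr (Eventually.of_forall fun t => ?_)
      simp only [Real.circleAverage, smul_eq_mul, Function.uncurry, f]
      rw [integral_const_mul, intervalIntegral.integral_of_le Real.two_pi_pos.le, uIoc_of_le Real.two_pi_pos.le]
      have : ∀ θ, z + circleMap 0 1 θ • b - t = z + -t + circleMap 0 1 θ • b := fun θ => by abel
      simp only [this]
      ring
    · simp only
      by_cases ht : ‖t‖ < η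
      · rw [sub_eq_add_neg]
        exact mul_le_mul_of_nonneg_left (hb (-t) (by simpa using ht)) (hχ0 t)
      · have : χ t = 0 := by
          by_contra h
          have h1 : t ∈ Function.support χ := h
          rw [φ.support_normed_eq, mem_ball_zero_iff] at h1
          exact ht (h1.trans_le (min_le_left _ _))
        rw [this, zero_mul, zero_mul]

theorem reAvg {p : ℂ → ℂ} (dp : Differentiable ℂ p) : Real.circleAverage (fun w => (p w).re) 0 1 = (p 0).re := by
  have h3 : Real.circleAverage p 0 1 = p 0 := dp.diffContOnCl.circleAverage
  have := Complex.reCLM.circleAverage_comp_comm (f := p) (c := 0) (R := 1) dp.continuous.continuousOn.circleIntegrable'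
  simpa [Function.comp_def, h3] using this

theorem levi {E : Type*} [NormedAddCommGroup E] [NormedSpace ℂ E] [FiniteDimensional ℂ E] {r : E → ℝ} (h : ContDiff ℝ 2 r) {z : E}
    {β : ℝ} (hβ : 0 < β) (hr : ∀ b, ‖b‖ < β → r z ≤ Real.circleAverage (fun w => r (z + w • b)) 0 1) :
    ∃ q : E → ℂ, Differentiable ℂ q ∧ q 0 = 0 ∧ ∀ ε > 0, ∀ᶠ h in 𝓝 0, (q h).re - ε * ‖h‖ ^ 2 ≤ r (z + h) - r z := by
  obtain ⟨l, B, hB⟩ := taylor2 h z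
  obtain ⟨Q, dQ, hQ, hQB, hL⟩ := quadC B
  let lC : E →L[ℂ] ℂ := StrongDual.extendRCLike (𝕜 := ℂ) l
  have hlC : ∀ h, (lC h).re = l h := fun h => StrongDual.re_extendRCLike_apply (𝕜 := ℂ) l h
  have hQ0 : Q 0 = 0 := by simpa using hQ 0 0
  have hrem : ∀ ε > 0, ∀ᶠ h in 𝓝 0, |r (z + h) - r z - l h - B h h / 2| ≤ ε * ‖h‖ ^ 2 := fun ε hε => by
    filter_upwards [(Asymptotics.isLittleO_iff.1 hB) hε] with h hh
    simpa using hh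
  have hpos : ∀ b, 0 ≤ (B b b + B (Complex.I • b) (Complex.I • b)) / 4 := by
    intro b
    by_contra hneg
    push Not at hneg
    set Lb := (B b b + B (Complex.I • b) (Complex.I • b)) / 4 with hLb
    have hb0 : 0 < ‖b‖ := norm_pos_iff.2 fun hb => by simp [hLb, hb] at hneg
    obtain ⟨τ, hτ, hτr⟩ := Metric.eventually_nhds_iff.1 (hrem (-Lb / (2 * ‖b‖ ^ 2)) (div_pos (by linarith) (by positivity)))
    have hm : 0 < min τ β := lt_min hτ hβ
    set s : ℝ := min τ β / (2 * ‖b‖) with hs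
    have hs0 : 0 < s := by positivity
    have hsb : s * ‖b‖ = min τ β / 2 := by rw [hs]; field_simp
    have hn : ‖(s : ℂ) • b‖ = s * ‖b‖ := by rw [norm_smul]; simp [abs_of_pos hs0]
    let p : ℂ → ℂ := fun w => w * lC ((s:ℂ) • b) + w ^ 2 * Q ((s : ℂ) • b) + ((r z + s ^ 2 * Lb / 2 : ℝ) : ℂ)
    have dp : Differentiable ℂ p := by fun_prop
    have h1 : Real.circleAverage (fun w => r (z + w • (s : ℂ) • b)) 0 1 ≤ Real.circleAverage (fun w => (p w).re) 0 1 := by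
      have hrc := h.continuous
      apply Real.circleAverage_mono
      · exact Continuous.continuousOn (by fun_prop) |>.circleIntegrable'
      · exact (Complex.continuous_re.comp dp.continuous).continuousOn.circleIntegrable'
      · intro w hw
        have hw1 : ‖w‖ = 1 := by simpa using hw
        have hnw : ‖w • (s : ℂ) • b‖ = s * ‖b‖ := by rw [norm_smul, hw1, one_mul, hn]
        have h2 := (abs_le.1 (hτr (y := w • (s : ℂ) • b) (by
          rw [dist_zero_right, hnw, hsb]; linarith [min_le_left τ β]))).2
        rw [hnw] at h2
        have h3 := hQB (w • (s : ℂ) • b)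
        have h4 := hL w ((s : ℂ) • b)
        have h5 := hL s b
        rw [hw1] at h4
        rw [h4, h5, hQ w] at h3
        have h6 := hlC (w • (s : ℂ) • b)
        rw [map_smul, smul_eq_mul] at h6
        have h7 : -Lb / (2 * ‖b‖ ^ 2) * (s * ‖b‖) ^ 2 = - Lb * s ^ 2 / 2 := by field_simp
        have h8 : ‖(s : ℂ)‖ ^ 2 = s ^ 2 := by simp
        rw [h8] at h3
        have h9 : B b b + B (Complex.I • b) (Complex.I • b) = 4 * Lb := by rw [hLb]; ring
        rw [h9] at h3
        rw [h7] at h2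
        simp only [p, Complex.add_re, Complex.ofReal_re]
        linarith
    rw [reAvg dp] at h1
    have h2 := hr ((s : ℂ) • b) (by rw [hn, hsb]; linarith [min_le_right τ β])
    have h3 : (p 0).re = r z + s ^ 2 * Lb / 2 := by
      simp only [p, zero_mul, zero_pow two_ne_zero, zero_add, Complex.ofReal_re]
    have : s ^ 2 * Lb < 0 := mul_neg_of_pos_of_neg (by positivity) hneg
    linarith
  refine ⟨fun h => lC h + Q h, by fun_prop, by simp [hQ0], fun ε hε => ?_⟩
  filter_upwards [hrem ε hε] with h hh
  have h1 := (abs_le.1 hh).1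
  have h2 := hQB h
  have h3 := hpos h
  rw [Complex.add_re, hlC]
  linarith

end fileB8

section fileB9
open Set Filter Topology Metric MeasureTheory

theorem partB {E : Type*} [NormedAddCommGroup E] [NormedSpace ℂ E] [FiniteDimensional ℂ E] {ψ : E → EReal} {V N N' : Set E}
    {g : E → ℝ} (hV : IsOpen V) (hψ : PSHOnE ψ V) (hN : IsCompact N) (hNV : N ⊆ V) (hg : ContinuousOn g N)
    (hN' : IsCompact N') (hNN : N' ⊆ N) {zs : E} {m : ℝ} (hzs : zs ∈ N) (hm : ψ zs = (m : EReal))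
    (hlt : ∀ z ∈ N', ψ z < ((m + g zs - g z : ℝ) : EReal)) :
    ∃ z2 ∈ N \ N', ∃ q : E → ℂ, Differentiable ℂ q ∧ ∃ δ > 0, ∀ᶠ z in 𝓝 z2, z ∈ N →
      (q z - q z2).re + g z - g z2 ≤ - δ * ‖z - z2‖ ^ 2 := by
  haveI : ProperSpace E := FiniteDimensional.proper ℂ E
  obtain ⟨hfin, husc, -, hsub⟩ := hψ
  obtain ⟨zg, hzg, hG⟩ := hN.exists_isMaxOn ⟨zs, hzs⟩ hg
  set κ := m + g zs with hκ
  set lo := min m (κ - g zg - 1) with hlo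
  obtain ⟨d0, hd0, hd0V⟩ := hN.exists_cthickening_subset_open hV hNV
  set d := d0 / 3 with hd
  have hdp : 0 < d := by positivity
  set P := cthickening (d + (d + d)) N with hP
  have hPV : P ⊆ V := by
    have : d + (d + d) = d0 := by rw [hd]; ring
    rw [hP, this]; exact hd0V
  have hPc : IsCompact P := hN.cthickening
  have hNP : N ⊆ P := self_subset_cthickening _
  have thick : ∀ {a b : ℝ} {x t : E}, 0 ≤ a → 0 ≤ b → x ∈ cthickening a N → ‖t‖ ≤ b → x + t ∈ cthickening (b + a) N := by
    intro a b x t ha hb hx ht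
    exact cthickening_cthickening_subset hb ha N (mem_cthickening_of_dist_le (x + t) x b _ hx (by simpa using ht))
  set f : E → ℝ := fun z => (max (ψ z) (lo : EReal)).toReal with hf
  have hfV : ∀ z ∈ V, (f z : EReal) = max (ψ z) (lo : EReal) := fun z hz => by
    apply EReal.coe_toReal
    · exact (max_lt (hfin z hz) (EReal.coe_lt_top lo)).ne
    · exact (lt_of_lt_of_le (EReal.bot_lt_coe lo) (le_max_right _ _)).ne'
  have hflo : ∀ z ∈ V, lo ≤ f z := fun z hz => by
    have : (lo : EReal) ≤ (f z : EReal) := by rw [hfV z hz]; exact le_max_right _ _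
    exact_mod_cast this
  have hfle : ∀ z ∈ V, ∀ c : ℝ, lo ≤ c → ψ z ≤ (c : EReal) → f z ≤ c := fun z hz c h1 h2 => by
    have : (f z : EReal) ≤ (c : EReal) := by rw [hfV z hz]; exact max_le h2 (by exact_mod_cast h1)
    exact_mod_cast this
  have hψf : ∀ z ∈ V, ψ z ≤ (f z : EReal) := fun z hz => by rw [hfV z hz]; exact le_max_left _ _
  obtain ⟨M, hM⟩ : ∃ M, ∀ z ∈ P, f z ≤ M := by
    obtain ⟨a, ha, hmax⟩ := (husc.mono hPV).exists_isMaxOn ⟨zs, hNP hzs⟩ hPc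
    exact ⟨f a, fun z hz => hfle z (hPV hz) _ (hflo a (hPV ha)) ((hmax hz).trans (hψf a (hPV ha)))⟩
  -- uniform gap
  obtain ⟨C0, γ, hγ, hgap⟩ : ∃ C0 γ : ℝ, 0 < γ ∧ ∀ C ≥ C0, ∀ z ∈ N', ∀ y ∈ P, max lo (f y - C * ‖z - y‖) + g z ≤ κ - γ := by
    have := hN'.induction_on (p := fun S => ∃ C0 γ : ℝ, 0 < γ ∧ ∀ C ≥ C0, ∀ z ∈ S ∩ N', ∀ y ∈ P,
      max lo (f y - C * ‖z - y‖) + g z ≤ κ - γ) ?_ ?_ ?_ ?_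
    · simpa using this
    · exact ⟨0, 1, one_pos, fun C _ z hz => by simp at hz⟩
    · rintro s t hst ⟨C0, γ, h1, h2⟩
      exact ⟨C0, γ, h1, fun C hC z hz => h2 C hC z ⟨hst hz.1, hz.2⟩⟩
    · rintro s t ⟨C0, γ, h1, h2⟩ ⟨C1, γ1, h3, h4⟩
      refine ⟨max C0 C1, min γ γ1, lt_min h1 h3, fun C hC z hz y hy => ?_⟩
      rcases hz.1 with h | h
      · have := h2 C ((le_max_left _ _).trans hC) z ⟨h, hz.2⟩ y hy
        linarith [min_le_left γ γ1]
      · have := h4 C ((le_max_right _ _).trans hC) z ⟨h, hz.2⟩ y hy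
        linarith [min_le_right γ γ1]
    · intro z hz
      have hzV := hNV (hNN hz)
      have h1 : f z < κ - g z := by
        have h2 : (f z : EReal) < ((κ - g z : ℝ) : EReal) := by
          rw [hfV z hzV]
          refine max_lt (hlt z hz) ?_
          have := hG (hNN hz)
          have h3 := min_le_right m (κ - g zg - 1)
          simp only [mem_setOf_eq] at this
          have : lo < κ - g z := by linarith
          exact_mod_cast this
        exact_mod_cast h2
      set γ := min 1 ((κ - g z - f z) / 3) with hγ
      have hγ0 : 0 < γ := lt_min one_pos (by linarith)
      have hγ1 : γ ≤ (κ - g z - f z) / 3 := min_le_right _ _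
      have hγ2 : γ ≤ 1 := min_le_left _ _
      have h2 : ∀ᶠ y in 𝓝[V] z, ψ y < ((κ - g z - 2 * γ : ℝ) : EReal) := husc z hzV _ (by
        refine lt_of_le_of_lt (hψf z hzV) ?_
        have : f z < κ - g z - 2 * γ := by linarith
        exact_mod_cast this)
      rw [hV.nhdsWithin_eq hzV] at h2
      obtain ⟨s, hs, hsy⟩ := Metric.eventually_nhds_iff.1 h2
      have h3 : ∀ᶠ z' in 𝓝[N'] z, g z' < g z + γ ∧ dist z' z < s / 2 :=
        Filter.Eventually.and (((hg z (hNN hz)).mono hNN).eventually (gt_mem_nhds (by linarith)))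
          (mem_nhdsWithin_of_mem_nhds (Metric.ball_mem_nhds z (half_pos hs)))
      refine ⟨_, h3, max 0 ((M + g z + 2 * γ - κ) / (s / 2)), γ, hγ0, fun C hC z' hz' y hy => ?_⟩
      obtain ⟨⟨h4, h5⟩, h6⟩ := hz'
      have hC0 : 0 ≤ C := (le_max_left _ _).trans hC
      have hC1 : M + g z + 2 * γ - κ ≤ C * (s / 2) := (div_le_iff₀ (half_pos hs)).1 ((le_max_right _ _).trans hC)
      have hlo2 : lo + g z' ≤ κ - γ := by
        have := hG (hNN h6)
        simp only [mem_setOf_eq] at this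
        have h3 := min_le_right m (κ - g zg - 1)
        linarith
      rcases le_total lo (f y - C * ‖z' - y‖) with hl | hl
      swap
      · rw [max_eq_left hl]; exact hlo2
      rw [max_eq_right hl]
      by_cases hy2 : dist y z < s
      · have h7 : f y ≤ max lo (κ - g z - 2 * γ) := hfle y (hPV hy) _ (le_max_left _ _)
          ((hsy hy2).le.trans (by exact_mod_cast le_max_right _ _))
        have h8 : 0 ≤ C * ‖z' - y‖ := by positivity
        rcases le_total lo (κ - g z - 2 * γ) with h9 | h9
        · rw [max_eq_right h9] at h7; linarith
        · rw [max_eq_left h9] at h7; linarith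
      · push Not at hy2
        have h7 : s / 2 ≤ ‖z' - y‖ := by
          rw [← dist_eq_norm, dist_comm]
          linarith [dist_triangle y z' z]
        have h8 := mul_le_mul_of_nonneg_left h7 hC0
        linarith [hM y hy]
  set C := max C0 (max 1 ((M - lo) / d)) with hC
  have hC0 : 0 < C := one_pos.trans_le ((le_max_left _ _).trans (le_max_right _ _))
  have hC1 : M - lo ≤ C * d := (div_le_iff₀ hdp).1 ((le_max_right _ _).trans (le_max_right _ _))
  have hgapC := hgap C (le_max_left _ _)
  have hlub : ∀ z, ∃ v, IsLUB ((fun y => max lo (f y - C * ‖z - y‖)) '' P) v := fun z =>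
    ⟨_, isLUB_csSup ⟨_, mem_image_of_mem _ (hNP hzs)⟩ ⟨max lo M, by
      rintro _ ⟨y, hy, rfl⟩
      refine max_le_max le_rfl ?_
      have : 0 ≤ C * ‖z - y‖ := by positivity
      linarith [hM y hy]⟩⟩
  choose v hv using hlub
  have v1 : ∀ z, ∀ y ∈ P, max lo (f y - C * ‖z - y‖) ≤ v z := fun z y hy => (hv z).1 ⟨y, hy, rfl⟩
  have v2 : ∀ z c, (∀ y ∈ P, max lo (f y - C * ‖z - y‖) ≤ c) → v z ≤ c := fun z c h => (hv z).2 (by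
    rintro _ ⟨y, hy, rfl⟩; exact h y hy)
  have vlo : ∀ z, lo ≤ v z := fun z => (le_max_left _ _).trans (v1 z zs (hNP hzs))
  have vM : ∀ z, v z ≤ max lo M := fun z => v2 z _ fun y hy => by
    refine max_le_max le_rfl ?_
    have : 0 ≤ C * ‖z - y‖ := by positivity
    linarith [hM y hy]
  have vlip1 : ∀ x y, v x ≤ v y + C * ‖x - y‖ := fun x y => v2 x _ fun t ht => by
    have h1 := v1 y t ht
    have h2 : ‖y - t‖ ≤ ‖x - y‖ + ‖x - t‖ := by
      have := norm_sub_le (x - t) (x - y)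
      rw [show x - t - (x - y) = y - t by abel] at this; linarith
    have h3 : 0 ≤ C * ‖x - y‖ := by positivity
    have h4 := mul_le_mul_of_nonneg_left h2 hC0.le
    refine max_le ((le_max_left _ _).trans (h1.trans (by linarith))) ?_
    have := (le_max_right _ _).trans h1
    linarith
  have vlip : ∀ x y, |v x - v y| ≤ C * ‖x - y‖ := fun x y => by
    have h2 := vlip1 y x
    rw [norm_sub_rev] at h2
    exact abs_le.2 ⟨by linarith, by linarith [vlip1 x y]⟩
  have vc : Continuous v := by
    refine LipschitzWith.continuous (K := ⟨C, hC0.le⟩) (LipschitzWith.of_dist_le_mul fun x y => ?_)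
    rw [Real.dist_eq, dist_eq_norm]; exact vlip x y
  have vsub : ∀ z ∈ cthickening d N, ∀ b, ‖b‖ < d → v z ≤ Real.circleAverage (fun w => v (z + w • b)) 0 1 := by
    intro z hz b hb
    refine submean vc fun p dp hp => ?_
    have hloP : lo ≤ (p 0).re := by
      rw [← reAvg dp]
      rw [← Real.circleAverage_const lo 0 1]
      apply Real.circleAverage_mono
      · exact continuousOn_const.circleIntegrable'
      · exact (Complex.continuous_re.comp dp.continuous).continuousOn.circleIntegrable'
      · intro w hw
        exact (vlo _).trans (hp w (by simpa using hw))
    refine v2 z _ fun y hy => max_le hloP ?_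
    by_cases hyd : ‖z - y‖ ≤ d
    swap
    · push Not at hyd
      have := mul_le_mul_of_nonneg_left hyd.le hC0.le
      linarith [hM y hy]
    have hyP : ∀ w : ℂ, ‖w‖ ≤ 1 → y + w • b ∈ P := fun w hw => by
      have h1 : ‖w • b + (y - z)‖ ≤ d + d := by
        refine (norm_add_le _ _).trans (add_le_add ?_ (by rwa [norm_sub_rev]))
        rw [norm_smul]
        calc ‖w‖ * ‖b‖ ≤ 1 * ‖b‖ := by gcongr
          _ ≤ d := by linarith
      have := thick hdp.le (by positivity) hz h1
      rw [show z + (w • b + (y - z)) = y + w • b by abel] at this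
      rwa [hP, add_comm]
    have hs := (hsub y b).2 0 1 one_pos (fun w hw => hPV (hyP w (by simpa using hw)))
      (fun w => (p w).re + C * ‖z - y‖) (((Complex.continuous_re.comp dp.continuous).add continuous_const).continuousOn)
      (fun w hw => ⟨ball 0 1, isOpen_ball, hw, subset_rfl, fun w => p w + (C * ‖z - y‖ : ℝ), by fun_prop,
        fun w _ => by simp⟩) (fun w hw => by
          have hw1 : ‖w‖ = 1 := by simpa using hw
          refine (hψf _ (hPV (hyP w hw1.le))).trans ?_
          have h3 := (le_max_right _ _).trans (v1 (z + w • b) (y + w • b) (hyP w hw1.le))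
          rw [show z + w • b - (y + w • b) = z - y by abel] at h3
          have : f (y + w • b) ≤ (p w).re + C * ‖z - y‖ := by linarith [hp w hw1]
          exact_mod_cast this) 0 (by simp)
    have h0 : 0 ≤ C * ‖z - y‖ := by positivity
    have := hfle y (hPV hy) ((p 0).re + C * ‖z - y‖) (by linarith) (by simpa using hs)
    linarith
  obtain ⟨r, hr, hrv, hravg⟩ := mollify (A := |lo| + |M|) (γ := γ / 8) (η := d) hC0 (fun x => abs_le.2
    ⟨by linarith [neg_abs_le lo, abs_nonneg M, vlo x], (vM x).trans (max_le (by linarith [le_abs_self lo, abs_nonneg M])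
      (by linarith [le_abs_self M, abs_nonneg lo]))⟩) vlip (by positivity) hdp
  let e : E ≃L[ℂ] (Fin (Module.finrank ℂ E) → ℂ) := (Module.finBasis ℂ E).equivFunL
  have hec : Continuous fun z => nsq (e z) := nsq_cont.comp e.continuous
  obtain ⟨zd, hzd, hD⟩ := hN.exists_isMaxOn ⟨zs, hzs⟩ hec.continuousOn
  have hn0 : ∀ w : Fin (Module.finrank ℂ E) → ℂ, 0 ≤ nsq w := fun w => (sq_nonneg _).trans (nsq_ge w)
  set D := nsq (e zd) with hDd
  set δ := γ / (4 * (D + 1)) with hδ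
  have hD1 : 0 < D + 1 := by linarith [hn0 (e zd)]
  have hδ0 : 0 < δ := by positivity
  have hδD : ∀ z ∈ N, δ * nsq (e z) ≤ γ / 4 := fun z hz => by
    have : nsq (e z) ≤ D := hD hz
    calc δ * nsq (e z) ≤ δ * (D + 1) := by gcongr; linarith
      _ = γ / 4 := by rw [hδ]; field_simp
  obtain ⟨z2, hz2, hmax⟩ := hN.exists_isMaxOn (f := fun z => r z + g z + δ * nsq (e z)) ⟨zs, hzs⟩
    ((hr.continuous.continuousOn.add hg).add (continuous_const.mul hec).continuousOn)
  have hz2N' : z2 ∉ N' := fun hz' => by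
    have h1 := hmax hzs
    simp only [mem_setOf_eq] at h1
    have h2 := abs_le.1 (hrv zs)
    have h3 := abs_le.1 (hrv z2)
    have h4 : v z2 ≤ κ - γ - g z2 := v2 z2 _ fun y hy => by linarith [hgapC z2 hz' y hy]
    have h5 : m ≤ v zs := by
      have h6 := (le_max_right _ _).trans (v1 zs zs (hNP hzs))
      have h7 : (m : EReal) ≤ (f zs : EReal) := hm ▸ hψf zs (hNV hzs)
      have h8 : m ≤ f zs := by exact_mod_cast h7
      simp at h6
      linarith
    have h6 := hδD z2 hz2
    have h7 := mul_nonneg hδ0.le (hn0 (e zs))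
    linarith [h2.1, h3.2]
  obtain ⟨q, dq, hq0, hq⟩ := levi hr hdp (z := z2) fun b hb => hravg z2 b fun t ht =>
    vsub _ (by
      have := thick le_rfl hdp.le (self_subset_cthickening (δ := 0) N hz2) ht.le
      rwa [add_zero] at this) b hb
  set cc := 1 / (‖(e.symm : (Fin (Module.finrank ℂ E) → ℂ) →L[ℂ] E)‖ + 1) ^ 2 with hcc
  have hcc0 : 0 < cc := by positivity
  have hcn : ∀ h, cc * ‖h‖ ^ 2 ≤ nsq (e h) := fun h => by
    refine le_trans ?_ (nsq_ge _)
    have h1 : ‖h‖ ≤ (‖(e.symm : (Fin (Module.finrank ℂ E) → ℂ) →L[ℂ] E)‖ + 1) * ‖e h‖ := by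
      have := (e.symm : (Fin (Module.finrank ℂ E) → ℂ) →L[ℂ] E).le_opNorm (e h)
      simp at this
      linarith [norm_nonneg (e h)]
    rw [hcc, div_mul_eq_mul_div, one_mul, div_le_iff₀ (by positivity), mul_comm, ← mul_pow]
    gcongr
  refine ⟨z2, ⟨hz2, hz2N'⟩, fun z => q (z - z2) + 2 * δ * cfun (e z2) (e (z - z2)), by fun_prop, δ * cc / 2, by positivity, ?_⟩
  have hten : Tendsto (fun z => z - z2) (𝓝 z2) (𝓝 0) := by
    have : Continuous fun z => z - z2 := by fun_prop
    simpa using this.tendsto z2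
  filter_upwards [hten.eventually (hq (δ * cc / 2) (by positivity))] with z hz hzN
  have h1 := hmax hzN
  simp only [mem_setOf_eq] at h1
  have h2 := nsq_exp (e z2) (e (z - z2))
  rw [← map_add, add_sub_cancel, ← cfun_apply] at h2
  rw [add_sub_cancel] at hz
  rw [h2] at h1
  have h3 := mul_le_mul_of_nonneg_left (hcn (z - z2)) hδ0.le
  have h4 : (2 * (δ:ℂ) * cfun (e z2) (e (z - z2))).re = 2 * δ * (cfun (e z2) (e (z - z2))).re := by
    rw [← Complex.re_ofReal_mul]; push_cast; rfl
  simp only [sub_self, map_zero, mul_zero, hq0, add_zero, sub_zero, Complex.add_re, h4]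
  linarith

end fileB9

section fileC1
open Set Filter Topology Metric MeasureTheory
section XX
variable {X : Type*} [TopologicalSpace X] {S : CSpace X} {c : CChart X}

lemma cc_open (c : CChart X) {Ω : Set c.E} (hΩ : IsOpen Ω) : IsOpen {y | y ∈ c.U ∧ c.φ y ∈ Ω} :=
  c.contOn.isOpen_inter_preimage c.openU hΩ

lemma cc_nb (c : CChart X) {x : X} (hx : x ∈ c.U) {O : Set X} (hO : IsOpen O) (hxO : x ∈ O) :
    ∃ Ω, IsOpen Ω ∧ c.φ x ∈ Ω ∧ Ω ⊆ c.V ∧ ∀ y ∈ c.U, c.φ y ∈ Ω → y ∈ O := by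
  obtain ⟨V2, h1, h2⟩ := c.open_image (c.U ∩ O) inter_subset_left (c.openU.inter hO)
  have h3 : c.φ x ∈ c.B ∩ V2 := h2 ▸ mem_image_of_mem _ ⟨hx, hxO⟩
  refine ⟨V2 ∩ c.V, h1.inter c.subvariety.1, ⟨h3.2, c.subvariety.2.1 h3.1⟩, inter_subset_right, ?_⟩
  intro y hy hyV
  have h4 : c.φ y ∈ c.φ '' (c.U ∩ O) := h2 ▸ ⟨c.mapsToB y hy, hyV.1⟩
  obtain ⟨z, hz, hzy⟩ := h4
  exact c.injOn hz.1 hy hzy ▸ hz.2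

lemma loc1 (hc : c ∈ S.atlas) {x : X} (hx : x ∈ c.U) {f : X → ℂ} (hf : SpaceHolOn S f univ) :
    ∃ W, IsOpen W ∧ c.φ x ∈ W ∧ ∃ G : c.E → ℂ, DifferentiableOn ℂ G W ∧
      ∀ y ∈ c.U, c.φ y ∈ W → G (c.φ y) = f y := by
  obtain ⟨d, hd, hxd, V', hV', _, hxV', _, F, hF, hFy⟩ := hf x trivial
  obtain ⟨W0, hW0, hxW0, T, hT, hTy⟩ := S.compat c hc d hd x ⟨hx, hxd⟩
  obtain ⟨Ω, hΩ, hxΩ, _, hΩy⟩ := cc_nb c hx d.openU hxd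
  refine ⟨(W0 ∩ T ⁻¹' V') ∩ Ω, (hT.continuousOn.isOpen_inter_preimage hW0 hV').inter hΩ,
    ⟨⟨hxW0, ?_⟩, hxΩ⟩, F ∘ T, hF.comp (hT.mono fun y hy => hy.1.1) fun y hy => hy.1.2, ?_⟩
  · simpa [hTy x ⟨hx, hxd⟩ hxW0] using hxV'
  · intro y hy hyW
    have h := hTy y ⟨hy, hΩy y hy hyW.2⟩ hyW.1.1
    have h2 : T (c.φ y) ∈ V' := hyW.1.2
    rw [Function.comp, h]
    exact hFy y (hΩy y hy hyW.2) (h ▸ h2)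

lemma model (hc : c ∈ S.atlas) {x : X} (hx : x ∈ c.U) {n : ℕ} {f : Fin n → X → ℂ}
    (hf : ∀ i, SpaceHolOn S (f i) univ) {O : Set X} (hO : IsOpen O) (hxO : x ∈ O) :
    ∃ Ω, IsOpen Ω ∧ c.φ x ∈ Ω ∧ Ω ⊆ c.V ∧ (∀ y ∈ c.U, c.φ y ∈ Ω → y ∈ O) ∧
      (∃ G : c.E → Fin n → ℂ, DifferentiableOn ℂ G Ω ∧
        ∀ y ∈ c.U, c.φ y ∈ Ω → G (c.φ y) = fun i => f i y) ∧
      ∃ (p : ℕ) (g : Fin p → c.E → ℂ), (∀ i, DifferentiableOn ℂ (g i) Ω) ∧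
        ∀ v ∈ Ω, (∀ i, g i v = 0) ↔ ∃ y ∈ c.U, c.φ y = v := by
  obtain ⟨Ω, hΩ, hxΩ, hΩV, hΩy⟩ := cc_nb c hx hO hxO
  choose W hW hxW G hG hGy using fun i => loc1 hc hx (hf i)
  obtain ⟨Z, hZ, hxZ, _, p, g, hg, hBZ⟩ := c.subvariety.2.2 _ (hΩV hxΩ)
  refine ⟨(Ω ∩ ⋂ i, W i) ∩ Z, (hΩ.inter (isOpen_iInter_of_finite hW)).inter hZ,
    ⟨⟨hxΩ, mem_iInter.2 hxW⟩, hxZ⟩, fun y hy => hΩV hy.1.1, fun y hy h => hΩy y hy h.1.1,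
    ⟨fun v i => G i v, differentiableOn_pi.2 fun i => (hG i).mono fun v hv => mem_iInter.1 hv.1.2 i,
      fun y hy h => funext fun i => hGy i y hy (mem_iInter.1 h.1.2 i)⟩,
    p, g, fun i => (hg i).mono inter_subset_right, fun v hv => ?_⟩
  have h : v ∈ c.B ↔ ∀ i, g i v = 0 := by
    have := Set.ext_iff.1 hBZ v
    simpa [hv.2] using this
  rw [← h, ← c.image_eq]; rfl

lemma hol_cont {f : X → ℂ} {D : Set X} (hf : SpaceHolOn S f D) : ContinuousOn f D := by
  intro x hx
  obtain ⟨d, hd, hxd, V', hV', _, hxV', _, F, hF, hFy⟩ := hf x hx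
  apply ContinuousAt.continuousWithinAt
  have h1 : ContinuousAt d.φ x := d.contOn.continuousAt (d.openU.mem_nhds hxd)
  have h2 : ContinuousAt (F ∘ d.φ) x :=
    (hF.continuousOn.continuousAt (hV'.mem_nhds hxV')).comp h1
  refine h2.congr ?_
  filter_upwards [(cc_open d hV').mem_nhds ⟨hxd, hxV'⟩] with y hy using hFy y hy.1 hy.2

lemma hol_restr {f : X → ℂ} {D : Set X} (hf : SpaceHolOn S f univ) (hD : IsOpen D) :
    SpaceHolOn S f D := by
  intro x hx
  obtain ⟨c, hc, hxc⟩ := S.chart_cover x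
  obtain ⟨Ω, h1, h2, h3, h4, ⟨G, h5, h6⟩, _⟩ :=
    model hc hxc (f := fun _ : Fin 1 => f) (fun _ => hf) hD hx
  exact ⟨c, hc, hxc, Ω, h1, h3, h2, fun y hy => h4 y hy.1 hy.2, fun v => G v 0,
    differentiableOn_pi.1 h5 0, fun y hy h => congrFun (h6 y hy h) 0⟩

lemma hol_comp {n : ℕ} {f : Fin n → X → ℂ} (hf : ∀ i, SpaceHolOn S (f i) univ)
    {P : (Fin n → ℂ) → ℂ} (hP : Differentiable ℂ P) :
    SpaceHolOn S (fun x => P fun i => f i x) univ := by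
  intro x _
  obtain ⟨c, hc, hxc⟩ := S.chart_cover x
  obtain ⟨Ω, h1, h2, h3, _, ⟨G, h5, h6⟩, _⟩ := model hc hxc hf isOpen_univ (mem_univ x)
  exact ⟨c, hc, hxc, Ω, h1, h3, h2, fun _ _ => trivial, P ∘ G, hP.comp_differentiableOn h5,
    fun y hy h => congrArg P (h6 y hy h)⟩

lemma hol_op {f g : X → ℂ} (hf : SpaceHolOn S f univ) (hg : SpaceHolOn S g univ)
    {P : ℂ → ℂ → ℂ} (hP : Differentiable ℂ fun w : Fin 2 → ℂ => P (w 0) (w 1)) :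
    SpaceHolOn S (fun x => P (f x) (g x)) univ :=
  hol_comp (f := ![f, g]) (fun i => by fin_cases i <;> assumption) hP

lemma hol_const (a : ℂ) : SpaceHolOn S (fun _ => a) univ :=
  hol_comp (n := 0) (f := fun _ _ => 0) (fun i => i.elim0) (P := fun _ => a) (by fun_prop)

lemma cinv_cont [Nonempty X] (c : CChart X) : ContinuousOn (Function.invFunOn c.φ c.U) c.B := by
  intro b hb
  rw [← c.image_eq] at hb
  obtain ⟨y, hy, rfl⟩ := hb
  rw [ContinuousWithinAt, c.injOn.leftInvOn_invFunOn hy, tendsto_def]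
  intro s hs
  obtain ⟨O, hOs, hO, hyO⟩ := mem_nhds_iff.1 hs
  obtain ⟨Ω, h1, h2, _, h4⟩ := cc_nb c hy hO hyO
  filter_upwards [self_mem_nhdsWithin, mem_nhdsWithin_of_mem_nhds (h1.mem_nhds h2)] with b hb hbΩ
  rw [← c.image_eq] at hb
  obtain ⟨z, hz, rfl⟩ := hb
  rw [mem_preimage, c.injOn.leftInvOn_invFunOn hz]
  exact hOs (h4 z hz hbΩ)

lemma cc_lc (S : CSpace X) (x : X) : ∃ C : Set X, IsCompact C ∧ C ∈ 𝓝 x := by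
  obtain ⟨c, hc, hxc⟩ := S.chart_cover x
  haveI : Nonempty X := ⟨x⟩
  obtain ⟨Z, hZ, hxZ, _, p, g, hg, hBZ⟩ := c.subvariety.2.2 _ (c.subvariety.2.1 (c.mapsToB x hxc))
  obtain ⟨r, hr, hrZ⟩ := Metric.nhds_basis_closedBall.mem_iff.1 (hZ.mem_nhds hxZ)
  have hcl : IsClosed (closedBall (c.φ x) r ∩ ⋂ i, (g i) ⁻¹' {0} ∩ closedBall (c.φ x) r) := by
    refine Metric.isClosed_closedBall.inter (isClosed_iInter fun i => ?_)
    rw [inter_comm]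
    exact ((hg i).continuousOn.mono hrZ).preimage_isClosed_of_isClosed Metric.isClosed_closedBall
      isClosed_singleton
  have hk : IsCompact (closedBall (c.φ x) r ∩ ⋂ i, (g i) ⁻¹' {0} ∩ closedBall (c.φ x) r) := by
    haveI : ProperSpace c.E := FiniteDimensional.proper ℂ c.E
    exact (isCompact_closedBall _ _).of_isClosed_subset hcl inter_subset_left
  have hsub : (closedBall (c.φ x) r ∩ ⋂ i, (g i) ⁻¹' {0} ∩ closedBall (c.φ x) r) ⊆ c.B := by
    intro v hv
    have : v ∈ c.B ∩ Z := by
      rw [hBZ]; exact ⟨hrZ hv.1, fun i => (mem_iInter.1 hv.2 i).1⟩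
    exact this.1
  refine ⟨_, hk.image_of_continuousOn ((cinv_cont c).mono hsub), ?_⟩
  filter_upwards [(cc_open c isOpen_ball).mem_nhds ⟨hxc, mem_ball_self hr⟩] with y hy
  have h1 : c.φ y ∈ c.B ∩ Z := ⟨c.mapsToB y hy.1, hrZ (ball_subset_closedBall hy.2)⟩
  rw [hBZ] at h1
  exact ⟨c.φ y, ⟨ball_subset_closedBall hy.2, mem_iInter.2 fun i => ⟨h1.2 i,
    ball_subset_closedBall hy.2⟩⟩, c.injOn.leftInvOn_invFunOn hy.1⟩

lemma psh_usc {u : X → EReal} (hu : SpacePSHOn S u univ) : UpperSemicontinuous u := by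
  intro x a ha
  obtain ⟨d, hd, hxd, V', hV', _, hxV', _, ψ, hψ, hy⟩ := hu.2.2 x trivial
  have h1 := hψ.2.1 _ hxV' a (show ψ _ < a by rwa [hy x hxd hxV'])
  rw [hV'.nhdsWithin_eq hxV'] at h1
  have h2 := (d.contOn.continuousAt (d.openU.mem_nhds hxd)).eventually h1
  filter_upwards [h2, (cc_open d hV').mem_nhds ⟨hxd, hxV'⟩] with y h3 h4
  exact hy y h4.1 h4.2 ▸ h3

end XX

end fileC1

section fileC2
open Set Filter Topology Metric MeasureTheory
section XX
variable {X : Type*} [TopologicalSpace X] {S : CSpace X}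

def evl (l : List (X → ℂ)) (x : X) : Fin l.length → ℂ := fun i => l.get i x

lemma evl_eq {l : List (X → ℂ)} {x y : X} : evl l x = evl l y ↔ ∀ f ∈ l, f x = f y := by
  simp only [funext_iff, evl, List.forall_mem_iff_get]

lemma evl_cont {l : List (X → ℂ)} (hl : ∀ f ∈ l, SpaceHolOn S f univ) : Continuous (evl l) :=
  continuous_pi fun i => continuousOn_univ.1 (hol_cont (hl _ (l.get_mem i)))

def GoodL (S : CSpace X) (K L : Set X) (P : Set X → Prop) (l : List (X → ℂ)) : Prop :=
  (∀ f ∈ l, SpaceHolOn S f univ) ∧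
  (∀ y ∈ L \ interior L, ∃ f ∈ l, 1 ≤ ‖f y‖ ∧ ∀ k ∈ K, ‖f k‖ < 1) ∧
  ∀ x ∈ L, ∃ O, P O ∧ ∀ y ∈ L, (∀ f ∈ l, f x = f y) → y ∈ O

lemma GoodL.app {K L : Set X} {P : Set X → Prop} {l l' : List (X → ℂ)} (h : GoodL S K L P l)
    (hl' : ∀ f ∈ l', SpaceHolOn S f univ) : GoodL S K L P (l ++ l') := by
  refine ⟨fun f hf => (List.mem_append.1 hf).elim (h.1 f) (hl' f), fun y hy => ?_, fun x hx => ?_⟩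
  · obtain ⟨f, hf, h1⟩ := h.2.1 y hy
    exact ⟨f, List.mem_append_left _ hf, h1⟩
  · obtain ⟨O, hO, h1⟩ := h.2.2 x hx
    exact ⟨O, hO, fun y hy h2 => h1 y hy fun f hf => h2 f (List.mem_append_left _ hf)⟩

lemma goodL_ex [T2Space X] (hS : ∀ x y : X, x ≠ y → ∃ f : X → ℂ, SpaceHolOn S f univ ∧ f x ≠ f y)
    {K L : Set X} (hK : IsCompact K) (hL : IsCompact L) (hKL : holHull S K univ ⊆ interior L)
    {P : Set X → Prop} (hP : ∀ x ∈ L, ∃ O, IsOpen O ∧ x ∈ O ∧ P O) : ∃ l, GoodL S K L P l := by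
  have key : ∀ x0 : X, ∀ O, IsOpen O → x0 ∈ O → ∃ N ∈ 𝓝 x0, ∃ l : List (X → ℂ),
      (∀ f ∈ l, SpaceHolOn S f univ) ∧ ∀ x ∈ N, ∀ y ∈ L \ O, ∃ f ∈ l, f x ≠ f y := by
    intro x0 O hO hx0
    refine (hL.diff hO).induction_on (p := fun s => ∃ N ∈ 𝓝 x0, ∃ l : List (X → ℂ),
      (∀ f ∈ l, SpaceHolOn S f univ) ∧ ∀ x ∈ N, ∀ y ∈ s, ∃ f ∈ l, f x ≠ f y) ?_ ?_ ?_ ?_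
    · exact ⟨univ, univ_mem, [], by simp, by simp⟩
    · rintro s t hst ⟨N, hN, l, h1, h2⟩
      exact ⟨N, hN, l, h1, fun x hx y hy => h2 x hx y (hst hy)⟩
    · rintro s t ⟨N, hN, l, h1, h2⟩ ⟨N', hN', l', h1', h2'⟩
      refine ⟨N ∩ N', inter_mem hN hN', l ++ l',
        fun f hf => (List.mem_append.1 hf).elim (h1 f) (h1' f), ?_⟩
      rintro x hx y (hy | hy)
      · obtain ⟨f, hf, h⟩ := h2 x hx.1 y hy
        exact ⟨f, List.mem_append_left _ hf, h⟩
      · obtain ⟨f, hf, h⟩ := h2' x hx.2 y hy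
        exact ⟨f, List.mem_append_right _ hf, h⟩
    · intro y hy
      obtain ⟨f, hf, hne⟩ := hS x0 y (fun h => hy.2 (h ▸ hx0))
      have hfc := continuousOn_univ.1 (hol_cont hf)
      obtain ⟨A, B, hA, hB, hxA, hyB, hAB⟩ := t2_separation hne
      exact ⟨f ⁻¹' B, mem_nhdsWithin_of_mem_nhds ((hB.preimage hfc).mem_nhds hyB), f ⁻¹' A,
        (hA.preimage hfc).mem_nhds hxA, [f], by simpa using hf, fun x hx z hz =>
        ⟨f, by simp, fun h => disjoint_left.1 hAB hx (show f x ∈ B from h ▸ hz)⟩⟩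
  obtain ⟨l2, hl2, hb⟩ : ∃ l : List (X → ℂ), (∀ f ∈ l, SpaceHolOn S f univ) ∧
      ∀ x ∈ L, ∃ O, P O ∧ ∀ y ∈ L, (∀ f ∈ l, f x = f y) → y ∈ O := by
    refine hL.induction_on (p := fun s => ∃ l : List (X → ℂ), (∀ f ∈ l, SpaceHolOn S f univ) ∧
      ∀ x ∈ s, ∃ O, P O ∧ ∀ y ∈ L, (∀ f ∈ l, f x = f y) → y ∈ O) ?_ ?_ ?_ ?_
    · exact ⟨[], by simp, by simp⟩
    · rintro s t hst ⟨l, h1, h2⟩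
      exact ⟨l, h1, fun x hx => h2 x (hst hx)⟩
    · rintro s t ⟨l, h1, h2⟩ ⟨l', h1', h2'⟩
      refine ⟨l ++ l', fun f hf => (List.mem_append.1 hf).elim (h1 f) (h1' f), ?_⟩
      rintro x (hx | hx)
      · obtain ⟨O, hO, h⟩ := h2 x hx
        exact ⟨O, hO, fun y hy h' => h y hy fun f hf => h' f (List.mem_append_left _ hf)⟩
      · obtain ⟨O, hO, h⟩ := h2' x hx
        exact ⟨O, hO, fun y hy h' => h y hy fun f hf => h' f (List.mem_append_right _ hf)⟩
    · intro x hx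
      obtain ⟨O, hO, hxO, hPO⟩ := hP x hx
      obtain ⟨N, hN, l, h1, h2⟩ := key x O hO hxO
      refine ⟨N, mem_nhdsWithin_of_mem_nhds hN, l, h1, fun z hz => ⟨O, hPO, fun y hy h => ?_⟩⟩
      by_contra hyO
      obtain ⟨f, hf, hne⟩ := h2 z hz y ⟨hy, hyO⟩
      exact hne (h f hf)
  obtain ⟨l1, hl1, ha⟩ : ∃ l : List (X → ℂ), (∀ f ∈ l, SpaceHolOn S f univ) ∧
      ∀ y ∈ L \ interior L, ∃ f ∈ l, 1 ≤ ‖f y‖ ∧ ∀ k ∈ K, ‖f k‖ < 1 := by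
    refine (hL.diff isOpen_interior).induction_on (p := fun s => ∃ l : List (X → ℂ),
      (∀ f ∈ l, SpaceHolOn S f univ) ∧
      ∀ y ∈ s, ∃ f ∈ l, 1 ≤ ‖f y‖ ∧ ∀ k ∈ K, ‖f k‖ < 1) ?_ ?_ ?_ ?_
    · exact ⟨[], by simp, by simp⟩
    · rintro s t hst ⟨l, h1, h2⟩
      exact ⟨l, h1, fun x hx => h2 x (hst hx)⟩
    · rintro s t ⟨l, h1, h2⟩ ⟨l', h1', h2'⟩
      refine ⟨l ++ l', fun f hf => (List.mem_append.1 hf).elim (h1 f) (h1' f), ?_⟩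
      rintro x (hx | hx)
      · obtain ⟨f, hf, h⟩ := h2 x hx
        exact ⟨f, List.mem_append_left _ hf, h⟩
      · obtain ⟨f, hf, h⟩ := h2' x hx
        exact ⟨f, List.mem_append_right _ hf, h⟩
    · intro y hy
      have hyK : y ∉ holHull S K univ := fun h => hy.2 (hKL h)
      simp only [holHull, mem_setOf_eq, mem_univ, true_and, not_forall, not_le] at hyK
      obtain ⟨f, hf, hlt⟩ := hyK
      have hfc := continuousOn_univ.1 (hol_cont hf)
      obtain ⟨t, ht1, ht2⟩ := exists_between hlt
      have hb := (hK.image (continuous_norm.comp hfc)).bddAbove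
      have ht0 : 0 < t := lt_of_le_of_lt (Real.sSup_nonneg (by rintro _ ⟨z, _, rfl⟩; positivity)) ht1
      refine ⟨{z | t < ‖f z‖}, mem_nhdsWithin_of_mem_nhds
        ((isOpen_lt continuous_const hfc.norm).mem_nhds ht2), [fun z => (t : ℂ)⁻¹ * f z], ?_, ?_⟩
      · simpa using hol_op (P := fun a b => a * b) (hol_const (S := S) (t : ℂ)⁻¹) hf (by fun_prop)
      · intro z hz
        have hn : ∀ z, ‖(t : ℂ)⁻¹ * f z‖ = ‖f z‖ / t := fun z => by
          rw [norm_mul, norm_inv, Complex.norm_real, Real.norm_of_nonneg ht0.le]; ring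
        refine ⟨_, List.mem_singleton_self _, ?_, fun k hk => ?_⟩
        · rw [hn, one_le_div ht0]; exact hz.le
        · rw [hn, div_lt_one ht0]
          exact lt_of_le_of_lt (le_csSup hb ⟨k, hk, rfl⟩) ht1
  refine ⟨l1 ++ l2, fun f hf => (List.mem_append.1 hf).elim (hl1 f) (hl2 f), fun y hy => ?_,
    fun x hx => ?_⟩
  · obtain ⟨f, hf, h1⟩ := ha y hy
    exact ⟨f, List.mem_append_left _ hf, h1⟩
  · obtain ⟨O, hO, h1⟩ := hb x hx
    exact ⟨O, hO, fun y hy h2 => h1 y hy fun f hf => h2 f (List.mem_append_right _ hf)⟩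

end XX

end fileC2

section fileC3
open Set Filter Topology Metric MeasureTheory
section XX
variable {X : Type*} [TopologicalSpace X] {S : CSpace X}

def PU (S : CSpace X) (O : Set X) : Prop := ∃ c ∈ S.atlas, O ⊆ c.U

lemma GoodL.mono {K L : Set X} {P Q : Set X → Prop} {l : List (X → ℂ)} (h : GoodL S K L P l)
    (hPQ : ∀ O, P O → Q O) : GoodL S K L Q l :=
  ⟨h.1, h.2.1, fun x hx => (h.2.2 x hx).imp fun O hO => ⟨hPQ O hO.1, hO.2⟩⟩

lemma model_l {c : CChart X} (hc : c ∈ S.atlas) {x : X} (hx : x ∈ c.U) {l : List (X → ℂ)}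
    (hl : ∀ f ∈ l, SpaceHolOn S f univ) {O : Set X} (hO : IsOpen O) (hxO : x ∈ O) :
    ∃ Ω, IsOpen Ω ∧ c.φ x ∈ Ω ∧ Ω ⊆ c.V ∧ (∀ y ∈ c.U, c.φ y ∈ Ω → y ∈ O) ∧
      (∃ G : c.E → Fin l.length → ℂ, DifferentiableOn ℂ G Ω ∧
        ∀ y ∈ c.U, c.φ y ∈ Ω → G (c.φ y) = evl l y) ∧
      ∃ (p : ℕ) (g : Fin p → c.E → ℂ), (∀ i, DifferentiableOn ℂ (g i) Ω) ∧
        ∀ v ∈ Ω, (∀ i, g i v = 0) ↔ ∃ y ∈ c.U, c.φ y = v :=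
  model hc hx (f := fun i => l.get i) (fun i => hl _ (l.get_mem i)) hO hxO

variable {K L : Set X} {l : List (X → ℂ)}

lemma fib_int (hg : GoodL S K L (PU S) l) {w : Fin l.length → ℂ}
    (hw : ∀ i, (∀ k ∈ K, ‖l.get i k‖ < 1) → ‖w i‖ < 1) {y : X} (hy : y ∈ L) (hyw : evl l y = w) :
    y ∈ interior L := by
  by_contra h
  obtain ⟨f, hf, h1, h2⟩ := hg.2.1 y ⟨hy, h⟩
  obtain ⟨i, rfl⟩ := List.mem_iff_get.1 hf
  have := hw i h2
  rw [← hyw] at this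
  exact absurd h1 (not_le.2 this)

lemma fib_fin [T2Space X] (hL : IsCompact L) (hg : GoodL S K L (PU S) l) {w : Fin l.length → ℂ}
    (hw : ∀ i, (∀ k ∈ K, ‖l.get i k‖ < 1) → ‖w i‖ < 1) : {y | y ∈ L ∧ evl l y = w}.Finite := by
  rcases {y | y ∈ L ∧ evl l y = w}.eq_empty_or_nonempty with h | ⟨x, hx, hxw⟩
  · rw [h]; exact finite_empty
  obtain ⟨O, ⟨c, hc, hOU⟩, hO⟩ := hg.2.2 x hx
  have hZU : {y | y ∈ L ∧ evl l y = w} ⊆ c.U := fun y hy =>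
    hOU (hO y hy.1 (evl_eq.1 (hxw.trans hy.2.symm)))
  have hZc : IsCompact {y | y ∈ L ∧ evl l y = w} :=
    hL.inter_right (isClosed_singleton.preimage (evl_cont hg.1))
  refine Set.Finite.of_finite_image ?_ (c.injOn.mono hZU)
  refine compact_analytic_finiteV (hZc.image_of_continuousOn (c.contOn.mono hZU)) ?_
  rintro _ ⟨y, hy, rfl⟩
  obtain ⟨Ω, h1, h2, _, h4, ⟨G, hG, hGy⟩, p, g, hgd, hgz⟩ :=
    model_l hc (hZU hy) hg.1 isOpen_interior (fib_int hg hw hy.1 hy.2)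
  refine ⟨Ω, p + l.length, fun i => Sum.elim g (fun j v => G v j - w j) (finSumFinEquiv.symm i),
    h1, h2, fun i => ?_, fun v hv => ?_⟩
  · dsimp only
    rcases finSumFinEquiv.symm i with j | j
    · exact hgd j
    · exact (differentiableOn_pi.1 hG j).sub_const _
  · rw [Equiv.forall_congr_left finSumFinEquiv.symm]
    simp only [Equiv.symm_symm, Equiv.symm_apply_apply, Sum.forall, Sum.elim_inl, Sum.elim_inr,
      sub_eq_zero, hgz v hv, ← @funext_iff _ _ (G v) w]
    constructor
    · rintro ⟨z, hz, rfl⟩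
      exact ⟨⟨z, hZU hz, rfl⟩, (hGy z (hZU hz) hv).trans hz.2⟩
    · rintro ⟨⟨z, hz, rfl⟩, h⟩
      exact ⟨z, ⟨interior_subset (h4 z hz hv), (hGy z hz hv).symm.trans h⟩, rfl⟩

lemma fib_loc [T2Space X] (hL : IsCompact L) (hg : GoodL S K L (PU S) l) {w : Fin l.length → ℂ}
    (hw : ∀ i, (∀ k ∈ K, ‖l.get i k‖ < 1) → ‖w i‖ < 1) :
    ∃ U : Set X, IsOpen U ∧ {y | y ∈ L ∧ evl l y = w} ⊆ U ∧ U ⊆ L ∧ ∃ Ω, IsOpen Ω ∧ w ∈ Ω ∧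
      ∃ (k : ℕ) (R : Fin k → (Fin l.length → ℂ) → ℂ), (∀ i, DifferentiableOn ℂ (R i) Ω) ∧
      ∀ v ∈ Ω, (∀ i, R i v = 0) ↔ ∃ y ∈ U, evl l y = v := by
  have hfin := fib_fin hL hg hw
  refine hfin.isCompact.induction_on (p := fun s => ∃ U : Set X, IsOpen U ∧ s ⊆ U ∧ U ⊆ L ∧
      ∃ Ω, IsOpen Ω ∧ w ∈ Ω ∧
      ∃ (k : ℕ) (R : Fin k → (Fin l.length → ℂ) → ℂ), (∀ i, DifferentiableOn ℂ (R i) Ω) ∧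
      ∀ v ∈ Ω, (∀ i, R i v = 0) ↔ ∃ y ∈ U, evl l y = v) ?_ ?_ ?_ ?_
  · exact ⟨∅, isOpen_empty, subset_rfl, empty_subset _, univ, isOpen_univ, trivial, 1, fun _ _ => 1,
      fun i => differentiableOn_const _, by simp⟩
  · rintro s t hst ⟨U, hU, hsU, h⟩
    exact ⟨U, hU, hst.trans hsU, h⟩
  · rintro s t ⟨U, hU, hsU, hUL, Ω, hΩ, hwΩ, k, R, hR, hz⟩
      ⟨U', hU', hsU', hUL', Ω', hΩ', hwΩ', k', R', hR', hz'⟩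
    refine ⟨U ∪ U', hU.union hU', union_subset_union hsU hsU', union_subset hUL hUL', Ω ∩ Ω',
      hΩ.inter hΩ', ⟨hwΩ, hwΩ'⟩, k * k', fun i v => R (finProdFinEquiv.symm i).1 v *
        R' (finProdFinEquiv.symm i).2 v, fun i => ((hR _).mono inter_subset_left).mul
        ((hR' _).mono inter_subset_right), fun v hv => ?_⟩
    rw [Equiv.forall_congr_left finProdFinEquiv.symm]
    simp only [Equiv.symm_symm, Equiv.symm_apply_apply, Prod.forall, mul_eq_zero, mem_union, or_and_right,
      exists_or, ← hz v hv.1, ← hz' v hv.2, forall_or_left, forall_or_right]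
  · intro y hy
    obtain ⟨O, ⟨c, hc, hOU⟩, hO⟩ := hg.2.2 y hy.1
    have hyU : y ∈ c.U := hOU (hO y hy.1 fun _ _ => rfl)
    obtain ⟨Ω, h1, h2, _, h4, ⟨G, hG, hGy⟩, p, g, hgd, hgz⟩ :=
      model_l hc hyU hg.1 (isOpen_interior.inter (hfin.subset diff_subset).isClosed.isOpen_compl :
        IsOpen (interior L ∩ ({y | y ∈ L ∧ evl l y = w} \ {y})ᶜ))
        ⟨fib_int hg hw hy.1 hy.2, by simp⟩
    obtain ⟨η, O', k, R, hη, hO', hyO', hOO, _, hR, hRz⟩ := EmultiV (ι := Fin p ⊕ Fin l.length)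
      (H := fun j (q : (Fin l.length → ℂ) × c.E) => Sum.elim (fun i => g i q.2) (fun i => G q.2 i - q.1 i) j)
      (G := univ ×ˢ Ω) (isOpen_univ.prod h1) (fun j => by
        rcases j with j | j
        · exact (hgd j).comp differentiableOn_snd fun q hq => hq.2
        · exact ((differentiableOn_pi.1 hG j).comp differentiableOn_snd fun q hq => hq.2).sub
            (by fun_prop)) (y0 := w) (v0 := c.φ y) ⟨trivial, h2⟩ h1 h2 (fun v hv _ hz => by
        simp only [Sum.forall, Sum.elim_inl, Sum.elim_inr, sub_eq_zero, hgz v hv,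
          ← @funext_iff _ _ (G v) w] at hz
        obtain ⟨⟨z, hz, rfl⟩, h⟩ := hz
        have h5 := h4 z hz hv
        by_contra hne
        exact h5.2 ⟨⟨interior_subset h5.1, (hGy z hz hv).symm.trans h⟩, fun h => hne (by rw [h])⟩)
    refine ⟨{z | z ∈ c.U ∧ c.φ z ∈ O'}, mem_nhdsWithin_of_mem_nhds ((cc_open c hO').mem_nhds
      ⟨hyU, hyO'⟩), _, cc_open c hO', subset_rfl, fun z hz => interior_subset
      (h4 z hz.1 (hOO hz.2)).1, ball w η, isOpen_ball, mem_ball_self hη, k, R, hR, fun v hv => ?_⟩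
    rw [hRz v hv]
    constructor
    · rintro ⟨z, hz, h⟩
      simp only [Sum.forall, Sum.elim_inl, Sum.elim_inr, sub_eq_zero, hgz z (hOO hz),
          ← @funext_iff _ _ (G z) v] at h
      obtain ⟨⟨z, hzU, rfl⟩, h⟩ := h
      exact ⟨z, ⟨hzU, hz⟩, (hGy z hzU (hOO hz)).symm.trans h⟩
    · rintro ⟨z, hz, rfl⟩
      refine ⟨_, hz.2, ?_⟩
      simp only [Sum.forall, Sum.elim_inl, Sum.elim_inr, sub_eq_zero, hgz _ (hOO hz.2),
          ← @funext_iff _ _ (G (c.φ z)) (evl l z)]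
      exact ⟨⟨z, hz.1, rfl⟩, hGy z hz.1 (hOO hz.2)⟩

lemma img_loc [T2Space X] (hL : IsCompact L) (hg : GoodL S K L (PU S) l) {w : Fin l.length → ℂ}
    (hw : ∀ i, (∀ k ∈ K, ‖l.get i k‖ < 1) → ‖w i‖ < 1) :
    ∃ (Ω : Set (Fin l.length → ℂ)) (k : ℕ) (R : Fin k → (Fin l.length → ℂ) → ℂ), IsOpen Ω ∧ w ∈ Ω ∧
      (∀ i, DifferentiableOn ℂ (R i) Ω) ∧ ∀ v ∈ Ω, v ∈ evl l '' L ↔ ∀ i, R i v = 0 := by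
  obtain ⟨U, hU, hZU, hUL, Ω, hΩ, hwΩ, k, R, hR, hz⟩ := fib_loc hL hg hw
  have hcl := ((hL.diff hU).image (evl_cont hg.1)).isClosed
  refine ⟨Ω ∩ (evl l '' (L \ U))ᶜ, k, R, hΩ.inter hcl.isOpen_compl, ⟨hwΩ, ?_⟩,
    fun i => (hR i).mono inter_subset_left, fun v hv => ?_⟩
  · rintro ⟨y, hy, hyw⟩
    exact hy.2 (hZU ⟨hy.1, hyw⟩)
  · rw [hz v hv.1]
    constructor
    · rintro ⟨y, hy, rfl⟩
      by_contra h
      exact hv.2 ⟨y, ⟨hy, fun hyU => h ⟨y, hyU, rfl⟩⟩, rfl⟩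
    · rintro ⟨y, hy, rfl⟩
      exact ⟨y, hUL hy, rfl⟩

end XX

end fileC3

section fileC4
open Set Filter Topology Metric MeasureTheory WeakDual
section XX
variable {X : Type*} [TopologicalSpace X]

def holAlg (S : CSpace X) (T : Set X) : Subalgebra ℂ C(T, ℂ) where
  carrier := {h | ∃ f, SpaceHolOn S f univ ∧ ∀ x : T, h x = f x}
  mul_mem' := by
    rintro a b ⟨f, hf, ha⟩ ⟨g, hg, hb⟩
    exact ⟨_, hol_op hf hg (P := fun a b => a * b) (by fun_prop), fun x => by simp [ha, hb]⟩
  add_mem' := by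
    rintro a b ⟨f, hf, ha⟩ ⟨g, hg, hb⟩
    exact ⟨_, hol_op hf hg (P := fun a b => a + b) (by fun_prop), fun x => by simp [ha, hb]⟩
  algebraMap_mem' := fun r => ⟨_, hol_const r, fun x => rfl⟩

def hAlg (S : CSpace X) (T : Set X) [CompactSpace T] := ↥(holAlg S T).topologicalClosure

instance (S : CSpace X) (T : Set X) [CompactSpace T] : NormedCommRing (hAlg S T) :=
  inferInstanceAs (NormedCommRing ↥(holAlg S T).topologicalClosure)

instance (S : CSpace X) (T : Set X) [CompactSpace T] : NormedAlgebra ℂ (hAlg S T) :=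
  inferInstanceAs (NormedAlgebra ℂ ↥(holAlg S T).topologicalClosure)

variable {S : CSpace X} {T : Set X} [CompactSpace T]

open Classical in
def hel (S : CSpace X) (T : Set X) [CompactSpace T] (f : X → ℂ) : hAlg S T :=
  if hf : SpaceHolOn S f univ then ⟨⟨fun x => f x, (continuousOn_univ.1 (hol_cont hf)).comp
    continuous_subtype_val⟩, Subalgebra.le_topologicalClosure _ ⟨f, hf, fun _ => rfl⟩⟩ else 0

lemma hel_apply {f : X → ℂ} (hf : SpaceHolOn S f univ) (x : T) : (hel S T f).1 x = f x := by
  exact congrArg (fun b : hAlg S T => b.1 x) (dif_pos hf)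

instance : CompleteSpace (hAlg S T) :=
  (Subalgebra.isClosed_topologicalClosure _).completeSpace_coe

def evc (S : CSpace X) (x : T) : characterSpace ℂ (hAlg S T) :=
  CharacterSpace.equivAlgHom.symm ((ContinuousMap.evalAlgHom ℂ ℂ x).comp
    (holAlg S T).topologicalClosure.val)

lemma evc_apply (x : T) (b : hAlg S T) : evc S x b = b.1 x := rfl

lemma evc_cont : Continuous (evc S : T → _) :=
  Continuous.subtype_mk (continuous_of_continuous_eval fun b => b.1.continuous) _

lemma hel_dense (b : hAlg S T) {ε : ℝ} (hε : 0 < ε) :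
    ∃ f, SpaceHolOn S f univ ∧ ‖b - hel S T f‖ < ε := by
  have hb : b.1 ∈ closure (holAlg S T : Set C(T, ℂ)) := b.2
  obtain ⟨h, ⟨f, hf, hh⟩, hd⟩ := Metric.mem_closure_iff.1 hb ε hε
  refine ⟨f, hf, ?_⟩
  have : h = (hel S T f).1 := by ext x; rw [hel_apply hf, hh]
  rw [dist_eq_norm, this] at hd
  exact hd

lemma char_le [Nonempty T] (m : characterSpace ℂ (hAlg S T)) (b : hAlg S T) : ‖m b‖ ≤ ‖b‖ := by
  have h1 : ‖(1 : hAlg S T)‖ = 1 := norm_one (α := C(T, ℂ))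
  haveI : NormOneClass (hAlg S T) := ⟨h1⟩
  exact AlgHom.norm_apply_le_self m b

lemma hull_le {K : Set X} {x : X} (hx : x ∈ holHull S K univ) {f : X → ℂ}
    (hf : SpaceHolOn S f univ) {t : ℝ} (ht : 0 ≤ t) (h : ∀ k ∈ K, ‖f k‖ ≤ t) : ‖f x‖ ≤ t :=
  (hx.2 f hf).trans (Real.sSup_le (by rintro _ ⟨k, hk, rfl⟩; exact h k hk) ht)

lemma sub_hull {K : Set X} (hK : IsCompact K) : K ⊆ holHull S K univ := fun x hx =>
  ⟨trivial, fun _ hf => le_csSup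
    (hK.image (continuous_norm.comp (continuousOn_univ.1 (hol_cont hf)))).bddAbove ⟨x, hx, rfl⟩⟩

lemma hull_lt {K : Set X} (hK : IsCompact K) (hne : K.Nonempty) {x : X}
    (hx : x ∈ holHull S K univ) {f : X → ℂ}
    (hf : SpaceHolOn S f univ) {t : ℝ} (h : ∀ k ∈ K, ‖f k‖ < t) : ‖f x‖ < t := by
  obtain ⟨k, hk, hm⟩ := hK.exists_isMaxOn hne
    (continuous_norm.comp (continuousOn_univ.1 (hol_cont hf))).continuousOn
  exact (hull_le hx hf (norm_nonneg (f k)) fun z hz => hm hz).trans_lt (h k hk)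

variable {K L : Set X} [CompactSpace (holHull S K univ)]

lemma char_hK (hK : IsCompact K) (hne : K.Nonempty)
    (m : characterSpace ℂ (hAlg S (holHull S K univ))) (b : hAlg S (holHull S K univ)) (t : ℝ)
    (h : ∀ k ∈ evc S '' {x : holHull S K univ | x.1 ∈ K}, ‖k b‖ ≤ t) : ‖m b‖ ≤ t := by
  obtain ⟨k0, hk0⟩ := hne
  haveI : Nonempty (holHull S K univ) := ⟨⟨k0, sub_hull hK hk0⟩⟩
  have hb : ∀ k : holHull S K univ, k.1 ∈ K → ‖b.1 k‖ ≤ t := fun k hk => h _ ⟨k, hk, rfl⟩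
  have ht : 0 ≤ t := (norm_nonneg _).trans (hb ⟨k0, sub_hull hK hk0⟩ hk0)
  refine (char_le m b).trans ((ContinuousMap.norm_le _ ht).2 fun x => ?_)
  refine le_of_forall_pos_le_add fun ε hε => ?_
  obtain ⟨f, hf, hd⟩ := hel_dense b (half_pos hε)
  have hd' : ∀ y, ‖b.1 y - f y‖ ≤ ε / 2 := fun y => by
    rw [← hel_apply hf y]
    exact ((b - hel S _ f).1.norm_coe_le_norm y).trans hd.le
  have h1 : ‖f x‖ ≤ t + ε / 2 := hull_le x.2 hf (by positivity) fun k hk => by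
    have h2 := hd' ⟨k, sub_hull hK hk⟩
    have h3 := hb ⟨k, sub_hull hK hk⟩ hk
    have := norm_sub_norm_le (f k) (b.1 ⟨k, sub_hull hK hk⟩)
    rw [norm_sub_rev] at this
    linarith
  have := norm_sub_norm_le (b.1 x) (f x)
  have h4 : ‖b.1 x‖ ≤ t + ε := by linarith [hd' x]
  exact h4

def Fl (S : CSpace X) (T : Set X) [CompactSpace T] (l : List (X → ℂ)) : Fin l.length → hAlg S T :=
  fun i => hel S T (l.get i)

lemma gel_evc {l : List (X → ℂ)} (hl : ∀ f ∈ l, SpaceHolOn S f univ) (x : T) :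
    gel (Fl S T l) (evc S x) = evl l x :=
  funext fun i => hel_apply (hl _ (l.get_mem i)) x

lemma gel_lt (hK : IsCompact K) (hne : K.Nonempty) {l : List (X → ℂ)}
    (hl : ∀ f ∈ l, SpaceHolOn S f univ) (m : characterSpace ℂ (hAlg S (holHull S K univ)))
    (i : Fin l.length) (h : ∀ k ∈ K, ‖l.get i k‖ < 1) : ‖gel (Fl S (holHull S K univ) l) m i‖ < 1 := by
  have hf := hl _ (l.get_mem i)
  obtain ⟨k, hk, hm⟩ := hK.exists_isMaxOn hne
    (continuous_norm.comp (continuousOn_univ.1 (hol_cont hf))).continuousOn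
  refine (char_hK hK hne m _ ‖l.get i k‖ ?_).trans_lt (h k hk)
  rintro _ ⟨x, hx, rfl⟩
  rw [evc_apply, Fl, hel_apply hf]
  exact hm hx

lemma char_surj [T2Space X] (hK : IsCompact K) (hne : K.Nonempty) (hL : IsCompact L)
    (hKL : holHull S K univ ⊆ interior L) {l0 : List (X → ℂ)} (hg : GoodL S K L (PU S) l0)
    (m : characterSpace ℂ (hAlg S (holHull S K univ))) : ∃ x, evc S x = m := by
  have h1 : ∀ l : List (X → ℂ), (∀ f ∈ l, SpaceHolOn S f univ) →
      ∃ y ∈ L, ∀ f ∈ l, f y = m (hel S _ f) := by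
    intro l hl
    have hg' := hg.app hl
    have := imgM (evc S '' {x : holHull S K univ | x.1 ∈ K}) (char_hK hK hne) (Fl S (holHull S K univ) (l0 ++ l)) (A := evl (l0 ++ l) '' L)
      (hL.image (evl_cont hg'.1)).isClosed (by
        rintro _ ⟨x, hx, rfl⟩
        rw [gel_evc hg'.1]
        exact ⟨x, interior_subset (hKL x.2), rfl⟩)
      (fun m _ => img_loc hL hg' (gel_lt hK hne hg'.1 m)) m
    obtain ⟨y, hy, hyw⟩ := this
    refine ⟨y, hy, fun f hf => ?_⟩
    obtain ⟨i, rfl⟩ := List.mem_iff_get.1 (List.mem_append_right l0 hf)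
    exact congrFun hyw i
  obtain ⟨y, hy, hy2⟩ := hL.inter_iInter_nonempty
    (fun f : {f : X → ℂ // SpaceHolOn S f univ} => {y | f.1 y = m (hel S _ f.1)})
    (fun f => isClosed_singleton.preimage (continuousOn_univ.1 (hol_cont f.2))) (fun u => by
      obtain ⟨y, hy, h⟩ := h1 (u.toList.map Subtype.val) (by simp +contextual)
      exact ⟨y, hy, mem_iInter₂.2 fun f hf => h f.1 (List.mem_map_of_mem (by simpa using hf))⟩)
  have hm : ∀ f, SpaceHolOn S f univ → f y = m (hel S _ f) := fun f hf => mem_iInter.1 hy2 ⟨f, hf⟩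
  have hyK : y ∈ holHull S K univ := by
    refine ⟨trivial, fun f hf => ?_⟩
    rw [hm f hf]
    refine char_hK hK hne m _ _ ?_
    rintro _ ⟨x, hx, rfl⟩
    rw [evc_apply, hel_apply hf]
    exact le_csSup
      (hK.image (continuous_norm.comp (continuousOn_univ.1 (hol_cont hf)))).bddAbove ⟨x, hx, rfl⟩
  haveI : Nonempty (holHull S K univ) := ⟨⟨y, hyK⟩⟩
  refine ⟨⟨y, hyK⟩, ?_⟩
  ext b
  refine eq_of_forall_dist_le fun ε hε => ?_
  obtain ⟨f, hf, hd⟩ := hel_dense b (half_pos hε)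
  have h2 := char_le (evc S ⟨y, hyK⟩) (b - hel S _ f)
  have h3 := char_le m (b - hel S _ f)
  rw [map_sub, evc_apply _ (hel S _ f), hel_apply hf] at h2
  rw [map_sub, ← hm f hf] at h3
  rw [← dist_eq_norm] at h2 h3
  have := dist_triangle_right (evc S ⟨y, hyK⟩ b) (m b) (f y)
  linarith

end XX
section XX
variable {X : Type*} [TopologicalSpace X] {S : CSpace X} {K L : Set X}

theorem peakX [T2Space X]
    (hS : ∀ x y : X, x ≠ y → ∃ f : X → ℂ, SpaceHolOn S f univ ∧ f x ≠ f y)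
    (hK : IsCompact K) (hne : K.Nonempty) (hKc : IsCompact (holHull S K univ)) (hL : IsCompact L)
    (hKL : holHull S K univ ⊆ interior L) {l : List (X → ℂ)} (hg : GoodL S K L (PU S) l)
    {x2 : X} (hx2 : x2 ∈ holHull S K univ) (hx2K : x2 ∉ K) {H : (Fin l.length → ℂ) → ℂ}
    {Ω : Set (Fin l.length → ℂ)} (hΩ : IsOpen Ω) (hH : DifferentiableOn ℂ H Ω) (h2 : evl l x2 ∈ Ω)
    (hlt : ∀ᶠ x in 𝓝 x2, x ∈ holHull S K univ → evl l x ≠ evl l x2 →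
      (H (evl l x)).re < (H (evl l x2)).re) : False := by
  haveI : CompactSpace (holHull S K univ) := isCompact_iff_compactSpace.1 hKc
  set Kh := holHull S K univ with hKh
  have hbij : Function.Bijective (evc S : Kh → _) := by
    refine ⟨fun x y hxy => ?_, char_surj hK hne hL hKL hg⟩
    by_contra hxy'
    obtain ⟨f, hf, hfne⟩ := hS x y (fun h => hxy' (Subtype.ext h))
    apply hfne
    rw [← hel_apply hf x, ← hel_apply hf y, ← evc_apply, ← evc_apply, hxy]
  let e : Kh ≃ₜ characterSpace ℂ (hAlg S Kh) :=
    Continuous.homeoOfEquivCompactToT2 (f := Equiv.ofBijective _ hbij) evc_cont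
  have he : ∀ x, e x = evc S x := fun _ => rfl
  have hfin := fib_fin hL hg (w := evl l x2) (fun i h => hull_lt hK hne hx2 (hg.1 _ (l.get_mem i)) h)
  have hN : ∀ᶠ x in 𝓝 x2, (x ∉ K ∧ x ∉ ({y | y ∈ L ∧ evl l y = evl l x2} \ {x2})) ∧
      (x ∈ Kh → evl l x ≠ evl l x2 → (H (evl l x)).re < (H (evl l x2)).re) :=
    Filter.Eventually.and (Filter.Eventually.and (hK.isClosed.isOpen_compl.mem_nhds hx2K)
      ((hfin.subset diff_subset).isClosed.isOpen_compl.mem_nhds (by simp))) hlt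
  have hN' := (continuous_subtype_val.continuousAt (x := (⟨x2, hx2⟩ : Kh))).eventually hN
  obtain ⟨C, ⟨hC, hCcl⟩, hCs⟩ := (closed_nhds_basis (⟨x2, hx2⟩ : Kh)).mem_iff.1 hN'
  have hcl : closure (e '' interior C) ⊆ e '' C := by
    rw [← e.image_closure]
    exact image_mono (closure_minimal interior_subset hCcl)
  refine peakM _ (e '' interior C) (char_hK hK hne) (Fl S Kh l) (e.isOpenMap _ isOpen_interior) ?_
    (m2 := e ⟨x2, hx2⟩) ⟨_, mem_interior_iff_mem_nhds.2 hC, rfl⟩ ?_ hΩ hH ?_ ?_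
  · rw [disjoint_left]
    rintro _ ⟨x, hx, rfl⟩ ⟨y, hy, hxy⟩
    have : y = x := hbij.1 hxy
    exact (hCs (interior_subset hx)).1.1 (this ▸ hy)
  · rintro _ ⟨hm, hmO⟩
    obtain ⟨x, hx, rfl⟩ := hcl hm
    rw [he, he, gel_evc hg.1, gel_evc hg.1]
    intro h
    refine (hCs hx).1.2 ⟨⟨interior_subset (hKL x.2), h⟩, fun h' => hmO ⟨x, ?_, rfl⟩⟩
    have : x = ⟨x2, hx2⟩ := Subtype.ext h'
    rw [this]; exact mem_interior_iff_mem_nhds.2 hC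
  · rw [he, gel_evc hg.1]; exact h2
  · intro m hm
    obtain ⟨x, hx, rfl⟩ := hcl hm
    rw [he, he, gel_evc hg.1, gel_evc hg.1]
    exact fun _ => (hCs hx).2 x.2

end XX

end fileC4

section fileC5
open Set Filter Topology Metric MeasureTheory
section XX
variable {V : Type*} [NormedAddCommGroup V] [NormedSpace ℂ V]

lemma slice_deriv {W : V × ℂ → ℂ} {G : Set (V × ℂ)} (hG : IsOpen G) (hW : DifferentiableOn ℂ W G)
    {w : V} {t : ℂ} (h : (w, t) ∈ G) :
    HasDerivAt (fun s => W (w, s)) (fderiv ℂ W (w, t) (0, 1)) t := by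
  have h1 : HasDerivAt (fun s : ℂ => (w, s)) ((0 : V), (1 : ℂ)) t :=
    (hasDerivAt_const t w).prodMk (hasDerivAt_id t)
  exact ((hW.differentiableAt (hG.mem_nhds h)).hasFDerivAt).comp_hasDerivAt t h1

lemma ordind {A : Type*} {𝓕 : Filter A} [𝓕.NeBot] {γ : A → V × ℂ} {w0 : V} {b0 : ℂ}
    (hγ : Tendsto γ 𝓕 (𝓝 (w0, b0))) {G : Set (V × ℂ)} (hG : IsOpen G) (h0 : (w0, b0) ∈ G) (d : ℕ) :
    ∀ W : V × ℂ → ℂ, DifferentiableOn ℂ W G → (∃ e : ℂ → ℂ, AnalyticAt ℂ e b0 ∧ e b0 ≠ 0 ∧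
      ∀ᶠ t in 𝓝 b0, W (w0, t) = (t - b0) ^ d • e t) → (∀ᶠ x in 𝓕, W (γ x) = 0) →
    ∃ W' : V × ℂ → ℂ, DifferentiableOn ℂ W' G ∧ (∀ᶠ x in 𝓕, W' (γ x) = 0) ∧
      ∃ᶠ x in 𝓕, fderiv ℂ W' (γ x) (0, 1) ≠ 0 := by
  induction d with
  | zero =>
    rintro W hW ⟨e, he, he0, heq⟩ hz
    have h1 : Tendsto (fun x => W (γ x)) 𝓕 (𝓝 (W (w0, b0))) :=
      ((hW.continuousOn.continuousAt (hG.mem_nhds h0)).tendsto).comp hγ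
    have h2 := tendsto_nhds_unique (h1.congr' hz) tendsto_const_nhds
    have h3 := heq.self_of_nhds
    rw [h2] at h3
    exact absurd (by simpa using h3.symm) he0
  | succ d ih =>
    rintro W hW ⟨e, he, he0, heq⟩ hz
    by_cases hf : ∃ᶠ x in 𝓕, fderiv ℂ W (γ x) (0, 1) ≠ 0
    · exact ⟨W, hW, hz, hf⟩
    refine ih (fun p => fderiv ℂ W p (0, 1)) (diff_dir hG hW _)
      ⟨fun t => (d + 1) * e t + (t - b0) * deriv e t, by fun_prop (disch := exact he), ?_, ?_⟩
      ((Filter.not_frequently.1 hf).mono fun x h => not_not.1 h)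
    · simp only [sub_self, zero_mul, add_zero]
      exact mul_ne_zero (by exact_mod_cast Nat.succ_ne_zero d) he0
    · have hev : ∀ᶠ t in 𝓝 b0, (w0, t) ∈ G :=
        (by fun_prop : Continuous fun t : ℂ => (w0, t)).continuousAt.eventually (hG.mem_nhds h0)
      filter_upwards [heq.eventually_nhds, hev, he.eventually_analyticAt] with t ht htG hte
      have h1 := (slice_deriv hG hW htG).congr_of_eventuallyEq (EventuallyEq.symm ht)
      have h2 := (((hasDerivAt_id t).sub_const b0).pow (d + 1)).mul hte.differentiableAt.hasDerivAt
      have h3 := h1.unique h2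
      rw [h3]
      simp only [smul_eq_mul, id, Nat.add_sub_cancel, Pi.pow_apply]
      push_cast; ring

lemma maxlogV {P : Type*} [NormedAddCommGroup P] [NormedSpace ℂ P] [FiniteDimensional ℂ P]
    {E : Set P} (hE : IsClosed E) {w0 : P} (L0 : P →L[ℂ] ℂ) {cc : ℝ} (hcc : 0 < cc)
    {Ω : Set P} (hΩ : IsOpen Ω) (hw0 : w0 ∈ Ω)
    (hL : ∀ w ∈ E ∩ Ω, (L0 (w - w0)).re ≤ - cc * ‖w - w0‖ ^ 2)
    {R : P → ℂ} (hR : DifferentiableOn ℂ R Ω) (hf : ∃ᶠ w in 𝓝 w0, w ∈ E ∧ R w ≠ 0) :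
    ∃ w2 ∈ E ∩ Ω, R w2 ≠ 0 ∧ ∃ (Ω2 : Set P) (H : P → ℂ), IsOpen Ω2 ∧ w2 ∈ Ω2 ∧ Ω2 ⊆ Ω ∧
      DifferentiableOn ℂ H Ω2 ∧ ∀ w ∈ E ∩ Ω2, w ≠ w2 → (H w).re < (H w2).re := by
  let e : P ≃L[ℂ] (Fin (Module.finrank ℂ P) → ℂ) := ContinuousLinearEquiv.ofFinrankEq (by simp)
  set M : ℝ := Module.finrank ℂ P * ‖(e : P →L[ℂ] (Fin (Module.finrank ℂ P) → ℂ))‖ ^ 2 + 1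
  have hM : 0 < M := by positivity
  have hns : ∀ w, nsq (e w) ≤ M * ‖w‖ ^ 2 := fun w => by
    have h1 : ∀ j, ‖e w j‖ ^ 2 ≤ (‖(e : P →L[ℂ] (Fin (Module.finrank ℂ P) → ℂ))‖ * ‖w‖) ^ 2 := fun j =>
      pow_le_pow_left₀ (norm_nonneg _) ((norm_le_pi_norm _ j).trans
        ((e : P →L[ℂ] (Fin (Module.finrank ℂ P) → ℂ)).le_opNorm w)) 2
    have h2 := Finset.sum_le_sum fun j (_ : j ∈ Finset.univ) => h1 j
    simp only [Finset.sum_const, Finset.card_univ, Fintype.card_fin, nsmul_eq_mul] at h2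
    have h3 : (0 : ℝ) ≤ ‖w‖ ^ 2 := by positivity
    rw [nsq]
    refine h2.trans ?_
    simp only [M]; nlinarith
  have hes : Continuous e.symm := e.symm.continuous
  obtain ⟨w2, hw2, hR2, Ω2, H, h1, h2, h3, h4, h5⟩ := maxlog (E := e.symm ⁻¹' E) (hE.preimage hes)
    (w0 := e w0) (L0.comp (e.symm : _ →L[ℂ] P)) (cc := cc / M) (by positivity)
    (Ω := e.symm ⁻¹' Ω) (hΩ.preimage hes) (by simpa using hw0) (fun w hw => by
      have h1 := hL _ hw
      have h2 := hns (e.symm w - w0)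
      simp only [map_sub, e.apply_symm_apply] at h2
      simp only [ContinuousLinearMap.comp_apply, ContinuousLinearEquiv.coe_coe, map_sub,
        e.symm_apply_apply] at h1 ⊢
      refine h1.trans ?_
      have h3 : cc / M * nsq (w - e w0) ≤ cc / M * (M * ‖e.symm w - w0‖ ^ 2) := by gcongr
      rw [← mul_assoc, div_mul_cancel₀ _ hM.ne'] at h3
      linarith) (R := fun w => R (e.symm w)) (hR.comp (by fun_prop) fun w hw => hw) (by
      rw [← e.map_nhds_eq, Filter.frequently_map]
      simpa using hf)
  refine ⟨e.symm w2, hw2, hR2, e ⁻¹' Ω2, fun w => H (e w), h1.preimage e.continuous, by simpa using h2,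
    fun w hw => by simpa using h3 hw, h4.comp (by fun_prop) fun w hw => hw, fun w hw hne => ?_⟩
  simpa using h5 (e w) ⟨by simpa using hw.1, hw.2⟩ (fun h => hne (by simp [← h]))

lemma impl1 [FiniteDimensional ℂ V] {W : V × ℂ → ℂ} {G : Set (V × ℂ)} (hG : IsOpen G)
    (hW : DifferentiableOn ℂ W G) {p : V × ℂ} (h0 : p ∈ G) (hz : W p = 0)
    (hD : fderiv ℂ W p (0, 1) ≠ 0) : ∃ (β : V → ℂ) (r : ℝ), 0 < r ∧
      DifferentiableOn ℂ β (ball p.1 r) ∧ ∀ y ∈ ball p.1 r, ∀ t ∈ ball p.2 r, W (y, t) = 0 → β y = t := by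
  obtain ⟨y0, c⟩ := p
  have hd := slice_deriv hG hW h0
  obtain ⟨r, η, s, d, hr, _, hη, _, _, hcard, hs, ⟨e, he, heq⟩, hg⟩ := wprep hG hW h0 (fun h => hD
    (hd.unique ((hasDerivAt_const c (0 : ℂ)).congr_of_eventuallyEq h))) one_pos
  have hd1 : d = 1 := by
    rcases d with _ | _ | d
    · have h1 := (hs y0 (mem_ball_self hη) c).2 ⟨mem_ball_self hr, hz⟩
      rw [Multiset.card_eq_zero.1 (hcard y0 (mem_ball_self hη))] at h1
      simp at h1
    · rfl
    · exfalso
      apply hD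
      have h2 := (((hasDerivAt_id c).sub_const c).pow (d + 2)).mul he.hasDerivAt
      rw [show (fun s => W (y0, s)) = _ from funext heq] at hd
      rw [hd.unique h2]; simp
  subst hd1
  refine ⟨_, min r η, lt_min hr hη, ((hg (fun q => q.2) (by fun_prop)).1).mono
    (ball_subset_ball (min_le_right _ _)), fun y hy t ht hWt => ?_⟩
  have hy' := ball_subset_ball (min_le_right r η) hy
  have ht' := (hs y hy' t).2 ⟨ball_subset_ball (min_le_left r η) ht, hWt⟩
  obtain ⟨a, ha⟩ := Multiset.card_eq_one.1 (hcard y hy')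
  rw [ha] at ht' ⊢
  simpa using (Multiset.mem_singleton.1 ht').symm

end XX

end fileC5

section fileC6
open Set Filter Topology Metric MeasureTheory
section XX
variable {X : Type*} [TopologicalSpace X] {S : CSpace X} {K L : Set X} {l : List (X → ℂ)}

lemma eqn [T2Space X] (hL : IsCompact L) (hg : GoodL S K L (PU S) l) {x0 : X} (hx0L : x0 ∈ L)
    (hw : ∀ i, (∀ k ∈ K, ‖l.get i k‖ < 1) → ‖evl l x0 i‖ < 1) {c : CChart X} (hc : c ∈ S.atlas)
    (hx0 : x0 ∈ c.U) {b : c.E → ℂ} {Ωb : Set c.E} (hΩb : IsOpen Ωb) (hb0 : c.φ x0 ∈ Ωb)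
    (hb : DifferentiableOn ℂ b Ωb) :
    (∃ C > 0, ∀ᶠ x in 𝓝 x0, ‖(evl l x, b (c.φ x)) - (evl l x0, b (c.φ x0))‖ ≤ C * ‖c.φ x - c.φ x0‖) ∧
    ∃ η > 0, ∃ R : (Fin l.length → ℂ) × ℂ → ℂ, DifferentiableOn ℂ R (ball (evl l x0, b (c.φ x0)) η) ∧
      (∀ᶠ x in 𝓝 x0, R (evl l x, b (c.φ x)) = 0) ∧
      ¬ ∀ᶠ t in 𝓝 (b (c.φ x0)), R (evl l x0, t) = 0 := by
  have hfin := fib_fin hL hg hw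
  obtain ⟨Ω, h1, h2, _, h4, ⟨G, hG, hGy⟩, p, g, hgd, hgz⟩ :=
    model_l hc hx0 hg.1 (isOpen_interior.inter (hfin.subset diff_subset).isClosed.isOpen_compl :
      IsOpen (interior L ∩ ({y | y ∈ L ∧ evl l y = evl l x0} \ {x0})ᶜ))
      ⟨fib_int hg hw hx0L rfl, by simp⟩
  have hφ : ContinuousAt c.φ x0 := c.contOn.continuousAt (c.openU.mem_nhds hx0)
  have hevl := evl_cont hg.1
  constructor
  · have hd : DifferentiableAt ℂ (fun v => (G v, b v)) (c.φ x0) :=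
      (hG.differentiableAt (h1.mem_nhds h2)).prodMk (hb.differentiableAt (hΩb.mem_nhds hb0))
    obtain ⟨C, hC, hO⟩ := hd.isBigO_sub.exists_pos
    refine ⟨C, hC, ?_⟩
    filter_upwards [hφ.eventually hO.bound, hφ.eventually (h1.mem_nhds h2), c.openU.mem_nhds hx0]
      with x hx hxΩ hxU
    rwa [hGy x hxU hxΩ, hGy x0 hx0 h2] at hx
  have hΩ' := h1.inter hΩb
  obtain ⟨η, O, k, R, hη, hO, hyO, hOO, _, hR, hRz⟩ := EmultiV (ι := Fin p ⊕ Fin l.length ⊕ Unit)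
    (E := (Fin l.length → ℂ) × ℂ)
    (H := fun j (q : ((Fin l.length → ℂ) × ℂ) × c.E) => Sum.elim (fun i => g i q.2)
      (Sum.elim (fun i => G q.2 i - q.1.1 i) fun _ => b q.2 - q.1.2) j)
    (G := univ ×ˢ (Ω ∩ Ωb)) (isOpen_univ.prod hΩ') (fun j => by
      rcases j with j | j | j
      · exact (hgd j).comp differentiableOn_snd fun q hq => hq.2.1
      · exact ((differentiableOn_pi.1 hG j).comp differentiableOn_snd fun q hq => hq.2.1).sub
          (by fun_prop)
      · exact (hb.comp differentiableOn_snd fun q hq => hq.2.2).sub (by fun_prop))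
    (y0 := (evl l x0, b (c.φ x0))) (v0 := c.φ x0) ⟨trivial, h2, hb0⟩ hΩ' ⟨h2, hb0⟩
    (fun v hv _ hz => by
      simp only [Sum.forall, Sum.elim_inl, Sum.elim_inr, sub_eq_zero, hgz v hv.1,
        ← @funext_iff _ _ (G v) (evl l x0)] at hz
      obtain ⟨⟨z, hz, rfl⟩, h, _⟩ := hz
      have h5 := h4 z hz hv.1
      by_contra hne
      exact h5.2 ⟨⟨interior_subset h5.1, (hGy z hz hv.1).symm.trans h⟩, fun h => hne (by rw [h])⟩)
  have hbφ : ContinuousAt (fun x => b (c.φ x)) x0 :=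
    (hb.continuousOn.continuousAt (hΩb.mem_nhds hb0)).comp hφ
  have hγ : ContinuousAt (fun x => (evl l x, b (c.φ x))) x0 := hevl.continuousAt.prodMk hbφ
  have hz : ∀ᶠ x in 𝓝 x0, ∀ i, R i (evl l x, b (c.φ x)) = 0 := by
    filter_upwards [hγ.eventually (ball_mem_nhds _ hη), hφ.eventually (hO.mem_nhds hyO),
      c.openU.mem_nhds hx0] with x hx hxO hxU
    refine (hRz _ hx).2 ⟨_, hxO, ?_⟩
    simp only [Sum.forall, Sum.elim_inl, Sum.elim_inr, sub_eq_zero, hgz _ (hOO hxO).1]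
    exact ⟨⟨x, hxU, rfl⟩, fun i => by rw [hGy x hxU (hOO hxO).1], fun _ => trivial⟩
  by_contra! hcon
  have hall : ∀ i, ∀ᶠ t in 𝓝 (b (c.φ x0)), R i (evl l x0, t) = 0 := fun i =>
    hcon η hη (R i) (hR i) (hz.mono fun x hx => hx i)
  have hmem : ∀ᶠ t in 𝓝 (b (c.φ x0)), (evl l x0, t) ∈ ball (evl l x0, b (c.φ x0)) η :=
    (by fun_prop : Continuous fun t : ℂ => (evl l x0, t)).continuousAt.eventually (ball_mem_nhds _ hη)
  obtain ⟨t, ht, ⟨htz, htm⟩⟩ := ((eventually_mem_nhdsWithin (a := b (c.φ x0)) (s := {b (c.φ x0)}ᶜ)).and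
    (Filter.Eventually.filter_mono nhdsWithin_le_nhds ((eventually_all.2 hall).and hmem))).exists
  obtain ⟨v, hv, hj⟩ := (hRz _ htm).1 htz
  simp only [Sum.forall, Sum.elim_inl, Sum.elim_inr, sub_eq_zero, hgz v (hOO hv).1,
        ← @funext_iff _ _ (G v) (evl l x0)] at hj
  obtain ⟨⟨z, hzU, rfl⟩, h, h'⟩ := hj
  have h5 := h4 z hzU (hOO hv).1
  have hzx : z = x0 := by
    by_contra hne
    exact h5.2 ⟨⟨interior_subset h5.1, (hGy z hzU (hOO hv).1).symm.trans h⟩, hne⟩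
  exact ht (by rw [← h' (), hzx]; rfl)

theorem peakLoc [T2Space X]
    (hS : ∀ x y : X, x ≠ y → ∃ f : X → ℂ, SpaceHolOn S f univ ∧ f x ≠ f y)
    (hK : IsCompact K) (hne : K.Nonempty) (hKc : IsCompact (holHull S K univ)) (hL : IsCompact L)
    (hKL : holHull S K univ ⊆ interior L) (hg : GoodL S K L (PU S) l) {c : CChart X}
    (hc : c ∈ S.atlas) {x0 : X} (hx0 : x0 ∈ c.U) (hx0h : x0 ∈ holHull S K univ) (hx0K : x0 ∉ K)
    {b : c.E → ℂ} {Ωb : Set c.E} (hΩb : IsOpen Ωb) (hb0 : c.φ x0 ∈ Ωb)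
    (hb : DifferentiableOn ℂ b Ωb) {δ : ℝ} (hδ : 0 < δ) (h : ∀ᶠ x in 𝓝 x0, x ∈ holHull S K univ →
      (b (c.φ x) - b (c.φ x0)).re ≤ - δ * ‖c.φ x - c.φ x0‖ ^ 2) : False := by
  set Kh := holHull S K univ with hKh
  obtain ⟨⟨C, hC, hlip⟩, η, hη, R, hR, hRz, hRn⟩ := eqn hL hg (interior_subset (hKL hx0h))
    (fun i h => hull_lt hK hne hx0h (hg.1 _ (l.get_mem i)) h) hc hx0 hΩb hb0 hb
  set γ : X → (Fin l.length → ℂ) × ℂ := fun x => (evl l x, b (c.φ x)) with hγd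
  have hevl := evl_cont hg.1
  have hbφ : ContinuousOn (fun x => b (c.φ x)) {y | y ∈ c.U ∧ c.φ y ∈ Ωb} :=
    hb.continuousOn.comp (c.contOn.mono fun y hy => hy.1) fun y hy => hy.2
  have hγ : ContinuousOn γ {y | y ∈ c.U ∧ c.φ y ∈ Ωb} := hevl.continuousOn.prodMk hbφ
  have hgo : IsOpen {y | y ∈ c.U ∧ c.φ y ∈ Ωb} := cc_open c hΩb
  have hγ0 : ContinuousAt γ x0 := hγ.continuousAt (hgo.mem_nhds ⟨hx0, hb0⟩)
  have hnb : (𝓝[Kh] x0).NeBot := mem_closure_iff_nhdsWithin_neBot.1 (subset_closure hx0h)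
  have hsl : AnalyticAt ℂ (fun t => R (evl l x0, t)) (b (c.φ x0)) := by
    have : DifferentiableOn ℂ (fun t => R (evl l x0, t)) (ball (b (c.φ x0)) η) :=
      hR.comp (by fun_prop) fun t ht => by
        rw [mem_ball, Prod.dist_eq]; simpa using ht
    exact this.analyticAt (ball_mem_nhds _ hη)
  obtain ⟨d, hd⟩ := hsl.exists_eventuallyEq_pow_smul_nonzero_iff.2 hRn
  obtain ⟨W, hW, hWz, hWf⟩ := ordind (hγ0.tendsto.mono_left (nhdsWithin_le_nhds (s := Kh)))
    isOpen_ball (mem_ball_self hη) d R hR hd (hRz.filter_mono nhdsWithin_le_nhds)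
  have hWz' := eventually_nhdsWithin_iff.1 hWz
  haveI : WeaklyLocallyCompactSpace X := ⟨fun x => cc_lc S x⟩
  have hev : ∀ᶠ x in 𝓝 x0, (x ∉ K ∧ x ∈ {y | y ∈ c.U ∧ c.φ y ∈ Ωb}) ∧ (x ∈ Kh → W (γ x) = 0) ∧
      ‖γ x - γ x0‖ ≤ C * ‖c.φ x - c.φ x0‖ ∧
      (x ∈ Kh → (b (c.φ x) - b (c.φ x0)).re ≤ - δ * ‖c.φ x - c.φ x0‖ ^ 2) :=
    Filter.Eventually.and (Filter.Eventually.and (hK.isClosed.isOpen_compl.mem_nhds hx0K)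
      (hgo.mem_nhds ⟨hx0, hb0⟩)) (hWz'.and (hlip.and h))
  obtain ⟨Cn, hCn, hCs, hCc⟩ := local_compact_nhds hev
  have hγC : ContinuousOn γ Cn := hγ.mono fun x hx => (hCs hx).1.2
  have hcl : IsClosed (γ '' (Kh ∩ Cn)) := ((hKc.inter hCc).image_of_continuousOn
    (hγC.mono inter_subset_right)).isClosed
  have hcl2 : IsClosed (γ '' (Kh ∩ (Cn \ interior Cn))) :=
    ((hKc.inter (hCc.diff isOpen_interior)).image_of_continuousOn
    (hγC.mono (inter_subset_right.trans diff_subset))).isClosed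
  have hineq : ∀ x ∈ Kh ∩ Cn, (b (c.φ x) - b (c.φ x0)).re ≤ - (δ / C ^ 2) * ‖γ x - γ x0‖ ^ 2 := by
    rintro x ⟨hx, hxC⟩
    obtain ⟨-, -, h1, h2⟩ := hCs hxC
    refine (h2 hx).trans ?_
    have h3 : ‖γ x - γ x0‖ ^ 2 ≤ (C * ‖c.φ x - c.φ x0‖) ^ 2 := pow_le_pow_left₀ (norm_nonneg _) h1 2
    have h4 : δ / C ^ 2 * ‖γ x - γ x0‖ ^ 2 ≤ δ / C ^ 2 * (C * ‖c.φ x - c.φ x0‖) ^ 2 := by gcongr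
    rw [mul_pow, ← mul_assoc, div_mul_cancel₀ _ (by positivity)] at h4
    linarith
  have hx0n : γ x0 ∉ γ '' (Kh ∩ (Cn \ interior Cn)) := by
    rintro ⟨x, ⟨hx, hxC, hxi⟩, hxe⟩
    obtain ⟨⟨-, hxU, -⟩, -, -, h2⟩ := hCs hxC
    have h3 := h2 hx
    rw [show b (c.φ x) = b (c.φ x0) from congrArg Prod.snd hxe, sub_self, Complex.zero_re] at h3
    have h5 : ‖c.φ x - c.φ x0‖ = 0 := by
      by_contra hn
      have : 0 < δ * ‖c.φ x - c.φ x0‖ ^ 2 := by positivity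
      linarith
    have h6 : x = x0 := c.injOn hxU hx0 (sub_eq_zero.1 (norm_eq_zero.1 h5))
    exact hxi (h6 ▸ mem_interior_iff_mem_nhds.2 hCn)
  obtain ⟨_, ⟨⟨x2, ⟨hx2, hx2C⟩, rfl⟩, hx2Ω⟩, hD, Ω2, H, hΩ2, h2Ω, -, hH, hlt⟩ := maxlogV hcl
    (w0 := γ x0) (ContinuousLinearMap.snd ℂ _ ℂ) (cc := δ / C ^ 2) (by positivity)
    (Ω := ball (γ x0) η ∩ (γ '' (Kh ∩ (Cn \ interior Cn)))ᶜ) (isOpen_ball.inter hcl2.isOpen_compl)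
    ⟨mem_ball_self hη, hx0n⟩ (by
      rintro _ ⟨⟨x, hx, rfl⟩, -⟩
      exact hineq x hx) (R := fun p => fderiv ℂ W p (0, 1))
    ((diff_dir isOpen_ball hW _).mono inter_subset_left) (by
      have h1 : ∃ᶠ x in 𝓝[Kh] x0, γ x ∈ γ '' (Kh ∩ Cn) ∧ fderiv ℂ W (γ x) (0, 1) ≠ 0 :=
        (hWf.and_eventually (eventually_mem_nhdsWithin.and (nhdsWithin_le_nhds hCn))).mono
          fun x hx => ⟨⟨x, hx.2, rfl⟩, hx.1⟩
      exact (hγ0.tendsto.mono_left nhdsWithin_le_nhds).frequently h1)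
  have hx2i : x2 ∈ interior Cn := by
    by_contra hn
    exact hx2Ω.2 ⟨x2, ⟨hx2, hx2C, hn⟩, rfl⟩
  have hCn2 : Cn ∈ 𝓝 x2 := mem_interior_iff_mem_nhds.1 hx2i
  have hγ2 : ContinuousAt γ x2 := hγC.continuousAt hCn2
  obtain ⟨β, r, hr, hβ, hβe⟩ := impl1 isOpen_ball hW hx2Ω.1 ((hCs hx2C).2.1 hx2) hD
  have hβ2 : β (evl l x2) = b (c.φ x2) := hβe _ (mem_ball_self hr) _ (mem_ball_self hr)
    ((hCs hx2C).2.1 hx2)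
  have hβd : DifferentiableOn ℂ (fun w => (w, β w)) (ball (evl l x2) r) :=
    differentiableOn_id.prodMk hβ
  refine peakX hS hK hne hKc hL hKL hg hx2 (hCs hx2C).1.1 (H := fun w => H (w, β w))
    (hβd.continuousOn.isOpen_inter_preimage isOpen_ball hΩ2)
    (hH.comp (hβd.mono inter_subset_left) fun w hw => hw.2)
    ⟨mem_ball_self hr, by rw [mem_preimage, hβ2]; exact h2Ω⟩ ?_
  have hb2 : ∀ᶠ x in 𝓝 x2, γ x ∈ Ω2 ∧ evl l x ∈ ball (evl l x2) r ∧ b (c.φ x) ∈ ball (b (c.φ x2)) r :=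
    (hγ2.eventually (hΩ2.mem_nhds h2Ω)).and
      ((hγ2.fst.eventually (ball_mem_nhds _ hr)).and (hγ2.snd.eventually (ball_mem_nhds _ hr)))
  filter_upwards [hb2, hCn2] with x hx hxC hxK hxne
  have h1 := hβe _ hx.2.1 _ hx.2.2 ((hCs hxC).2.1 hxK)
  simp only [h1, hβ2]
  exact hlt (γ x) ⟨⟨x, ⟨hxK, hxC⟩, rfl⟩, hx.1⟩ fun h => hxne (congrArg Prod.fst h)

end XX

end fileC6

section fileC7
open Set Filter Topology Metric MeasureTheory
section XX
variable {X : Type*} [TopologicalSpace X] {S : CSpace X} {K : Set X}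

lemma eps_ex {Q : Set X} (hQ : IsCompact Q) {u : X → EReal} (hu : UpperSemicontinuous u) {g : X → ℝ}
    (hgc : Continuous g) {M gs : ℝ} (hle : ∀ x ∈ Q, u x ≤ (M : EReal))
    (h : ∀ x ∈ Q, u x = (M : EReal) → g x < gs) :
    ∃ ε > 0, ∀ x ∈ Q, u x < ((M + ε * (gs - g x) : ℝ) : EReal) := by
  suffices hs : ∃ ε0 > 0, ∀ ε, 0 < ε → ε ≤ ε0 → ∀ x ∈ Q ∩ Q, u x < ((M + ε * (gs - g x) : ℝ) : EReal) by
    obtain ⟨ε, hε, h2⟩ := hs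
    exact ⟨ε, hε, fun x hx => h2 ε hε le_rfl x ⟨hx, hx⟩⟩
  refine hQ.induction_on (p := fun s => ∃ ε0 > 0, ∀ ε, 0 < ε → ε ≤ ε0 → ∀ x ∈ s ∩ Q,
    u x < ((M + ε * (gs - g x) : ℝ) : EReal)) ?_ ?_ ?_ ?_
  · exact ⟨1, one_pos, by simp⟩
  · rintro s t hst ⟨ε, hε, h2⟩
    exact ⟨ε, hε, fun e h1 h3 x hx => h2 e h1 h3 x ⟨hst hx.1, hx.2⟩⟩
  · rintro s t ⟨ε, hε, h2⟩ ⟨ε', hε', h2'⟩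
    refine ⟨min ε ε', lt_min hε hε', fun e h1 h3 x hx => ?_⟩
    rcases hx.1 with h | h
    · exact h2 e h1 (h3.trans (min_le_left _ _)) x ⟨h, hx.2⟩
    · exact h2' e h1 (h3.trans (min_le_right _ _)) x ⟨h, hx.2⟩
  · intro x hx
    rcases (hle x hx).eq_or_lt with he | hlt
    · refine ⟨_, mem_nhdsWithin_of_mem_nhds (hgc.continuousAt.eventually (gt_mem_nhds (h x hx he))),
        1, one_pos, fun e h1 _ y hy => (hle y hy.2).trans_lt ?_⟩
      have : 0 < e * (gs - g y) := mul_pos h1 (sub_pos.2 hy.1)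
      exact_mod_cast (by linarith : M < M + e * (gs - g y))
    · obtain ⟨t, ht1, ht2⟩ := EReal.lt_iff_exists_real_btwn.1 hlt
      have ht2' : t < M := by exact_mod_cast ht2
      have hB : 0 < |gs - g x| + 1 := by positivity
      have hg' : ∀ᶠ y in 𝓝 x, |gs - g y| < |gs - g x| + 1 :=
        (by fun_prop : Continuous fun y => |gs - g y|).continuousAt.eventually
          (gt_mem_nhds (lt_add_one _))
      refine ⟨_, mem_nhdsWithin_of_mem_nhds (Filter.Eventually.and (hu x t ht1) hg'),
        (M - t) / (|gs - g x| + 1), div_pos (by linarith) hB, fun e h1 h2 y hy => ?_⟩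
      refine lt_trans hy.1.1 ?_
      have h3 := (le_div_iff₀ hB).1 h2
      have h4 : e * |gs - g y| < e * (|gs - g x| + 1) := mul_lt_mul_of_pos_left hy.1.2 h1
      have h5 : e * (-|gs - g y|) ≤ e * (gs - g y) := mul_le_mul_of_nonneg_left (neg_abs_le _) h1.le
      exact_mod_cast (by linarith : t < M + e * (gs - g y))

theorem hull_sub [T2Space X]
    (hS : ∀ x y : X, x ≠ y → ∃ f : X → ℂ, SpaceHolOn S f univ ∧ f x ≠ f y)
    (hK : IsCompact K) (hne : K.Nonempty) (hKc : IsCompact (holHull S K univ))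
    {u : X → EReal} (hu : SpacePSHOn S u univ) {r : ℝ} (huK : ∀ x ∈ K, u x < (r : EReal)) :
    ∀ x ∈ holHull S K univ, u x < (r : EReal) := by
  set Kh := holHull S K univ with hKh
  by_contra! hcon
  obtain ⟨x1, hx1, hx1r⟩ := hcon
  haveI : Nonempty X := ⟨x1⟩
  haveI : WeaklyLocallyCompactSpace X := ⟨fun x => cc_lc S x⟩
  have husc := psh_usc hu
  obtain ⟨xm, hxm, hmax⟩ := (husc.upperSemicontinuousOn Kh).exists_isMaxOn ⟨x1, hx1⟩ hKc
  have hrm : (r : EReal) ≤ u xm := hx1r.trans (hmax hx1)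
  obtain ⟨M, hM⟩ : ∃ M : ℝ, u xm = (M : EReal) := by
    have h1 := hu.1 xm trivial
    exact ⟨(u xm).toReal, (EReal.coe_toReal h1.ne fun h => by simp [h] at hrm).symm⟩
  have hle : ∀ x ∈ Kh, u x ≤ (M : EReal) := fun x hx => hM ▸ hmax hx
  obtain ⟨L, hL, hKL⟩ := exists_compact_superset hKc
  obtain ⟨l, hg⟩ := goodL_ex hS hK hL hKL (P := fun O => ∃ c ∈ S.atlas, ∃ V' : Set c.E, IsOpen V' ∧
    O = {y | y ∈ c.U ∧ c.φ y ∈ V'} ∧ ∃ ψ : c.E → EReal, PSHOnE ψ V' ∧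
      ∀ y ∈ c.U, c.φ y ∈ V' → ψ (c.φ y) = u y) (fun x _ => by
    obtain ⟨c, hc, hxc, V', hV', _, hxV, _, h⟩ := hu.2.2 x trivial
    exact ⟨_, cc_open c hV', ⟨hxc, hxV⟩, c, hc, V', hV', rfl, h⟩)
  have hgU : GoodL S K L (PU S) l := hg.mono fun O ⟨c, hc, V', _, hO, _⟩ =>
    ⟨c, hc, hO ▸ fun y hy => hy.1⟩
  have hevl := evl_cont hg.1
  have hT : IsCompact (Kh ∩ u ⁻¹' Ici (M : EReal)) := hKc.inter_right (husc.isClosed_preimage _)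
  obtain ⟨xs, hxs, hxsm⟩ := hT.exists_isMaxOn ⟨xm, hxm, hM.ge⟩ (nsq_cont.comp hevl).continuousOn
  set w := evl l xs
  set f0 : X → ℂ := fun x => cfun w (evl l x)
  have hf0 : SpaceHolOn S f0 univ := hol_comp (f := fun i => l.get i) (fun i => hg.1 _ (l.get_mem i))
    (P := cfun w) (cfun w).differentiable
  have hgc : Continuous fun x => (f0 x).re :=
    Complex.continuous_re.comp (continuousOn_univ.1 (hol_cont hf0))
  have hcmp : ∀ x ∈ Kh, u x = (M : EReal) → evl l x ≠ w → (f0 x).re < (f0 xs).re := by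
    intro x hx hxM hxw
    have h1 : nsq (evl l x) ≤ nsq w := hxsm ⟨hx, hxM.ge⟩
    have h2 := nsq_exp w (evl l x - w)
    rw [add_sub_cancel, ← cfun_apply, map_sub, Complex.sub_re] at h2
    have h3 := nsq_ge (evl l x - w)
    have h4 : 0 < ‖evl l x - w‖ := norm_pos_iff.2 (sub_ne_zero.2 hxw)
    have h5 : 0 < ‖evl l x - w‖ ^ 2 := by positivity
    show (cfun w (evl l x)).re < (cfun w w).re
    linarith
  obtain ⟨_, ⟨c, hc, V', hV', rfl, ψ, hψ, hψu⟩, hO⟩ := hg.2.2 xs (interior_subset (hKL hxs.1))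
  obtain ⟨Kc, hKcc, hTK, hKcO⟩ := exists_compact_between
    (hT.inter_right (isClosed_singleton.preimage hevl : IsClosed (evl l ⁻¹' {w})))
    ((cc_open c hV').inter hK.isClosed.isOpen_compl) (by
      rintro x ⟨⟨hx, hxM⟩, hxw⟩
      refine ⟨hO x (interior_subset (hKL hx)) (evl_eq.1 (Eq.symm hxw)), fun hxK => ?_⟩
      exact absurd (huK x hxK) (not_lt.2 (hrm.trans (hM ▸ hxM))))
  obtain ⟨ε, hε, hlt⟩ := eps_ex (hKc.diff (isOpen_interior (s := Kc))) husc hgc (M := M)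
    (gs := (f0 xs).re) (fun x hx => hle x hx.1) (fun x hx hxM => hcmp x hx.1 hxM fun h =>
      hx.2 (hTK ⟨⟨hx.1, hxM.ge⟩, h⟩))
  have hinv : ∀ x ∈ c.U, Function.invFunOn c.φ c.U (c.φ x) = x := c.injOn.leftInvOn_invFunOn
  have hφK : ContinuousOn c.φ Kc := c.contOn.mono fun x hx => (hKcO hx).1.1
  have hxsK : xs ∈ Kc := interior_subset (hTK ⟨hxs, rfl⟩)
  have huxs : u xs = (M : EReal) := le_antisymm (hle _ hxs.1) hxs.2
  have hU : ∀ x ∈ Kc, x ∈ c.U := fun x hx => (hKcO hx).1.1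
  obtain ⟨_, ⟨⟨x0, ⟨hx0, hx0K⟩, rfl⟩, hx0n⟩, q, hq, δ, hδ, hfin⟩ := partB hV' hψ
    (N := c.φ '' (Kh ∩ Kc)) (N' := c.φ '' (Kh ∩ (Kc \ interior Kc)))
    (g := fun z => ε * (f0 (Function.invFunOn c.φ c.U z)).re)
    ((hKc.inter hKcc).image_of_continuousOn (hφK.mono inter_subset_right))
    (by rintro _ ⟨x, hx, rfl⟩; exact (hKcO hx.2).1.2)
    (continuousOn_const.mul (hgc.comp_continuousOn ((cinv_cont c).mono (by
      rintro _ ⟨x, hx, rfl⟩; exact c.mapsToB x (hU x hx.2)))))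
    ((hKc.inter (hKcc.diff isOpen_interior)).image_of_continuousOn
      (hφK.mono (inter_subset_right.trans diff_subset)))
    (image_mono (inter_subset_inter_right _ diff_subset)) (zs := c.φ xs) (m := M)
    ⟨xs, ⟨hxs.1, hxsK⟩, rfl⟩ (by rw [hψu xs (hU _ hxsK) (hKcO hxsK).1.2, huxs]) (by
      rintro _ ⟨x, ⟨hx, hxK, hxi⟩, rfl⟩
      rw [hψu x (hU _ hxK) (hKcO hxK).1.2, hinv x (hU _ hxK), hinv xs (hU _ hxsK)]
      convert hlt x ⟨hx, hxi⟩ using 2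
      ring)
  have hx0i : x0 ∈ interior Kc := by
    by_contra hn
    exact hx0n ⟨x0, ⟨hx0, hx0K, hn⟩, rfl⟩
  have hx0U := hU x0 hx0K
  obtain ⟨W, hW, hxW, G, hG, hGy⟩ := loc1 hc hx0U hf0
  have hφ : ContinuousAt c.φ x0 := c.contOn.continuousAt (c.openU.mem_nhds hx0U)
  refine peakLoc hS hK hne hKc hL hKL hgU hc hx0U hx0 (hKcO hx0K).2 (b := fun v => q v + ε * G v) hW hxW
    (hq.differentiableOn.add (hG.const_mul _)) hδ ?_
  filter_upwards [hφ.eventually hfin, hφ.eventually (hW.mem_nhds hxW),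
    mem_interior_iff_mem_nhds.1 hx0i] with x hx hxW' hxK hxh
  have h1 := hx ⟨x, ⟨hxh, hxK⟩, rfl⟩
  rw [hinv x (hU x hxK), hinv x0 hx0U] at h1
  rw [hGy x (hU x hxK) hxW', hGy x0 hx0U hxW]
  refine le_trans (le_of_eq ?_) h1
  simp only [Complex.sub_re, Complex.add_re, Complex.re_ofReal_mul]
  ring

theorem final_thm {X : Type*} [TopologicalSpace X] [T2Space X]
    (S : CSpace X) (hStein : IsSteinIn S univ)
    (u : X → EReal) (hu : SpacePSHOn S u univ) (c : ℝ) :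
    (∀ K : Set X, K ⊆ {x | u x < ((c : ℝ) : EReal)} → IsCompact K →
      IsCompact (holHull S K univ ∩ {x | u x < ((c : ℝ) : EReal)})) ∧
    IsSteinIn S {x | u x < ((c : ℝ) : EReal)} := by
  set Y := {x | u x < ((c : ℝ) : EReal)} with hY
  have hYo : IsOpen Y := (psh_usc hu).isOpen_preimage (c : EReal)
  have hsep : ∀ x y : X, x ≠ y → ∃ f : X → ℂ, SpaceHolOn S f univ ∧ f x ≠ f y := fun x y h =>
    hStein.2 x trivial y trivial h
  have hc : ∀ K : Set X, IsCompact K → IsCompact (holHull S K univ) := fun K hK =>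
    hStein.1 K (subset_univ _) hK
  have hsub : ∀ K : Set X, K ⊆ Y → IsCompact K → holHull S K univ ⊆ Y := by
    intro K hKY hK x hx
    rcases K.eq_empty_or_nonempty with rfl | hne
    · have := hx.2 _ (hol_const 1)
      norm_num at this
    · exact hull_sub hsep hK hne (hc K hK) hu hKY x hx
  refine ⟨fun K hKY hK => ?_, fun K hKY hK => ?_, fun x _ y _ h => ?_⟩
  · rw [inter_eq_left.2 (hsub K hKY hK)]
    exact hc K hK
  · have hh : holHull S K Y = ⋂ f : {f : X → ℂ // SpaceHolOn S f Y}, holHull S K univ ∩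
        {x | x ∈ holHull S K univ ∧ ‖f.1 x‖ ≤ sSup ((fun y => ‖f.1 y‖) '' K)} := by
      ext x
      simp only [mem_iInter, mem_inter_iff, mem_setOf_eq, Subtype.forall]
      constructor
      · rintro ⟨hx, h⟩ f hf
        have h1 : x ∈ holHull S K univ := ⟨trivial, fun f hf => h f (hol_restr hf hYo)⟩
        exact ⟨h1, h1, h f hf⟩
      · intro h
        exact ⟨hsub K hKY hK (h _ (hol_restr (hol_const 1) hYo)).1, fun f hf => (h f hf).2.2⟩
    have hcl : IsClosed (holHull S K Y) := by
      rw [hh]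
      refine isClosed_iInter fun f => (hc K hK).isClosed.inter ?_
      exact ((hol_cont f.2).norm.mono (hsub K hKY hK)).preimage_isClosed_of_isClosed
        (hc K hK).isClosed isClosed_Iic
    refine (hc K hK).of_isClosed_subset hcl fun x hx => ?_
    exact ⟨trivial, fun f hf => hx.2 f (hol_restr hf hYo)⟩
  · obtain ⟨f, hf, hne⟩ := hsep x y h
    exact ⟨f, hol_restr hf hYo, hne⟩

end XX

end fileC7

/-- Proposition 2.5.  If `X` is a Stein space and `u ∈ PSH(X)`, then
for every `c ∈ ℝ` the sublevel set `Y = {u < c}` is Runge in `X` (for every compact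
`K ⊆ Y` the set `K̂_X ∩ Y` is compact); in particular `Y` is a Stein space. -/
theorem psh_sublevel_runge {X : Type*} [TopologicalSpace X] [T2Space X]
    [SecondCountableTopology X] (S : CSpace X) (hStein : IsSteinIn S univ)
    (u : X → EReal) (hu : SpacePSHOn S u univ) (c : ℝ) :
    (∀ K : Set X, K ⊆ {x | u x < ((c : ℝ) : EReal)} → IsCompact K →
      IsCompact (holHull S K univ ∩ {x | u x < ((c : ℝ) : EReal)})) ∧
    IsSteinIn S {x | u x < ((c : ℝ) : EReal)} := by
  exact final_thm S hStein u hu c
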